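/- Let X be a simplicial set with an ordered open cover U = (U_i)_{i∈I}, and let C^{pq}(U) = ∏_{i₀<⋯<i_q} C^p(U_{i₀}∩⋯∩U_{i_q}; R) be the Mayer–Vietoris double complex. Then the total complex Tot C^{**}(U) carries the structure of a Hirsch algebra which extends the familiar dg algebra structure of the Mayer–Vietoris double complex. -/

import Mathlib

open scoped TensorProduct

noncomputable section

/-- The sign `(-1)^n` as an integer, for `n : ℤ`. -/
def pm (n : ℤ) : ℤ := (((-1 : ℤˣ) ^ n : ℤˣ) : ℤ)

/-- The total desuspended degree `Σᵢ (nᵢ - 1)` of a list of (cohomological) degrees;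
this is the degree of the bar word `[a₁|⋯|a_k]` when `aᵢ` has degree `nᵢ`. -/
def bdeg (ds : List ℤ) : ℤ := (ds.map (fun n => n - 1)).sum

/-- An augmented, unital, associative differential graded algebra over a commutative
unital ring `R`, with cohomological grading (the differential has degree `+1`).
The grading is internal (`grading_internal`), multiplication and unit are graded,
the differential satisfies the graded Leibniz rule, and the augmentation is a
map of augmented dg algebras.  The operator `sgn` is the canonical "sign" operator
multiplying the component of degree `i` by `(-1)^i`; it is uniquely determined by the
grading and is included as data for convenience (Koszul signs). -/
structure DGAlgebra (R : Type) [CommRing R] : Type 1 where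
  carrier : Type
  [ring : Ring carrier]
  [alg : Algebra R carrier]
  grading : ℤ → Submodule R carrier
  grading_internal : DirectSum.IsInternal grading
  one_mem : (1 : carrier) ∈ grading 0
  mul_mem : ∀ {i j : ℤ} {a b : carrier},
    a ∈ grading i → b ∈ grading j → (a * b) ∈ grading (i + j)
  d : carrier →ₗ[R] carrier
  d_mem : ∀ {i : ℤ} {a : carrier}, a ∈ grading i → d a ∈ grading (i + 1)
  d_sq : ∀ a, d (d a) = 0
  leibniz : ∀ {i : ℤ} {a b : carrier}, a ∈ grading i →
    d (a * b) = d a * b + pm i • (a * d b)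
  aug : carrier →ₐ[R] R
  aug_d : ∀ a, aug (d a) = 0
  aug_graded : ∀ {i : ℤ} {a : carrier}, a ∈ grading i → i ≠ 0 → aug a = 0
  sgn : carrier →ₗ[R] carrier
  sgn_apply : ∀ {i : ℤ} {a : carrier}, a ∈ grading i → sgn a = pm i • a

attribute [instance] DGAlgebra.ring DGAlgebra.alg

namespace DGAlgebra

variable {R : Type} [CommRing R] (A : DGAlgebra R)

/-- The unnormalized bar construction `BA = T(s⁻¹A)` of `A`, *as a graded `R`-module*.
At the level of (ungraded) `R`-modules it is the tensor algebra on the underlying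
module of `A`; the word `[a₁|⋯|a_k]` is the product `ι a₁ ⋯ ι a_k`.  The
(de)suspension is invisible at the module level; it is accounted for by the degree
conventions (`bdeg`) and the sign operators. -/
abbrev Bar : Type := TensorAlgebra R A.carrier

/-- The bar word `[a₁|⋯|a_k] ∈ BA`. The empty word is the counit element `𝟙`. -/
def word (l : List A.carrier) : A.Bar := (l.map (TensorAlgebra.ι R)).prod

/-- `A.Homog l ds` says that the list `l` consists of homogeneous elements,
`l i` having degree `ds i`. -/
def Homog (l : List A.carrier) (ds : List ℤ) : Prop :=
  l.length = ds.length ∧ ∀ i : ℕ, l.getD i 0 ∈ A.grading (ds.getD i 0)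

/-- The concatenation operator `∇ : BA ⊗ BA → BA`. -/
def concat : A.Bar ⊗[R] A.Bar →ₗ[R] A.Bar := LinearMap.mul' R A.Bar

/-- The augmentation ideal `Ā ⊆ A`. -/
def augIdeal : Submodule R A.carrier := LinearMap.ker A.aug.toLinearMap

/-- The normalized bar construction `B̄A = T(s⁻¹Ā)`. -/
abbrev NBar : Type := TensorAlgebra R A.augIdeal

/-- words in the normalized bar construction. -/
def nword (l : List A.augIdeal) : A.NBar := (l.map (TensorAlgebra.ι R)).prod

/-- The canonical inclusion `B̄A → BA`. -/
def nincl : A.NBar →ₗ[R] A.Bar :=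
  (TensorAlgebra.lift R ((TensorAlgebra.ι R) ∘ₗ A.augIdeal.subtype)).toLinearMap

/-- The (internal, total-degree) grading of the bar construction:
`(BA)_n` is spanned by the homogeneous words of total desuspended degree `n`. -/
def barGrading (n : ℤ) : Submodule R A.Bar :=
  Submodule.span R {x | ∃ l ds, A.Homog l ds ∧ bdeg ds = n ∧ x = A.word l}

end DGAlgebra

/-- All the canonical structure carried by the bar construction `BA` of an augmented
dg algebra `A`: the deconcatenation coproduct `Δ`, the bar differential `dB`
(tensor-product differential plus the `∂` multiplying adjacent entries through the
desuspended multiplication), the sign operator `sgnB`, the graded twist `tw`, the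
canonical twisting cochain `α` (projection to `B₁A = s⁻¹A` followed by `σ`), and the
counit `εB`.  Each operator is uniquely determined by its prescribed values on the
words `[a₁|⋯|a_k]`, which span `BA`. -/
structure BarData {R : Type} [CommRing R] (A : DGAlgebra R) : Type where
  /-- deconcatenation coproduct -/
  Δ : A.Bar →ₗ[R] A.Bar ⊗[R] A.Bar
  Δ_word : ∀ l : List A.carrier,
    Δ (A.word l) = ∑ i ∈ Finset.range (l.length + 1),
      A.word (l.take i) ⊗ₜ[R] A.word (l.drop i)
  /-- the bar differential -/
  dB : A.Bar →ₗ[R] A.Bar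
  dB_word : ∀ (l : List A.carrier) (ds : List ℤ), A.Homog l ds →
    dB (A.word l) =
      - (∑ i ∈ Finset.range l.length,
          pm (bdeg (ds.take i)) • A.word (l.set i (A.d (l.getD i 0))))
      + ∑ i ∈ Finset.range (l.length - 1),
          pm (bdeg (ds.take (i + 1))) •
            A.word (l.take i ++ (l.getD i 0 * l.getD (i + 1) 0) :: l.drop (i + 2))
  /-- the sign operator of `BA` -/
  sgnB : A.Bar →ₗ[R] A.Bar
  sgnB_word : ∀ (l : List A.carrier) (ds : List ℤ), A.Homog l ds →
    sgnB (A.word l) = pm (bdeg ds) • A.word l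
  /-- the graded (Koszul) twist `BA ⊗ BA → BA ⊗ BA` -/
  tw : A.Bar ⊗[R] A.Bar →ₗ[R] A.Bar ⊗[R] A.Bar
  tw_word : ∀ (l m : List A.carrier) (ds es : List ℤ), A.Homog l ds → A.Homog m es →
    tw (A.word l ⊗ₜ[R] A.word m) = pm (bdeg ds * bdeg es) • (A.word m ⊗ₜ[R] A.word l)
  /-- the canonical twisting cochain `α : BA → A` -/
  α : A.Bar →ₗ[R] A.carrier
  α_single : ∀ a : A.carrier, α (A.word [a]) = a
  α_word : ∀ l : List A.carrier, l.length ≠ 1 → α (A.word l) = 0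
  /-- the counit of `BA` -/
  εB : A.Bar →ₗ[R] R
  εB_one : εB (1 : A.Bar) = 1
  εB_word : ∀ l : List A.carrier, l ≠ [] → εB (A.word l) = 0

namespace BarData

variable {R : Type} [CommRing R] {A : DGAlgebra R} (BD : BarData A)

/-- `sgnB` raised to the power `n` (only the parity of `n` matters);
used to express Koszul signs `(-1)^{n·|x|}`. -/
def sgnPow (n : ℤ) : A.Bar →ₗ[R] A.Bar :=
  if n % 2 = 0 then LinearMap.id else BD.sgnB

/-- The differential of `BA ⊗ BA` (with the Koszul sign rule). -/
def dBB : A.Bar ⊗[R] A.Bar →ₗ[R] A.Bar ⊗[R] A.Bar :=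
  TensorProduct.map BD.dB LinearMap.id + TensorProduct.map BD.sgnB BD.dB

/-- The middle interchange `1 ⊗ tw ⊗ 1` on `(BA ⊗ BA) ⊗ (BA ⊗ BA)`
(the graded twist of the two middle factors). -/
def midTw : (A.Bar ⊗[R] A.Bar) ⊗[R] (A.Bar ⊗[R] A.Bar) →ₗ[R]
    (A.Bar ⊗[R] A.Bar) ⊗[R] (A.Bar ⊗[R] A.Bar) :=
  let e₁ := TensorProduct.assoc R A.Bar A.Bar (A.Bar ⊗[R] A.Bar)
  let e₂ := TensorProduct.congr (LinearEquiv.refl R A.Bar)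
    (TensorProduct.assoc R A.Bar A.Bar A.Bar).symm
  e₁.symm.toLinearMap ∘ₗ e₂.symm.toLinearMap ∘ₗ
    (TensorProduct.map LinearMap.id (TensorProduct.map BD.tw LinearMap.id)) ∘ₗ
    e₂.toLinearMap ∘ₗ e₁.toLinearMap

/-- The coproduct of `BA ⊗ BA` (with Koszul signs). -/
def ΔBB : A.Bar ⊗[R] A.Bar →ₗ[R] (A.Bar ⊗[R] A.Bar) ⊗[R] (A.Bar ⊗[R] A.Bar) :=
  BD.midTw ∘ₗ TensorProduct.map BD.Δ BD.Δ

/-- The counit of `BA ⊗ BA`. -/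
def εBB : A.Bar ⊗[R] A.Bar →ₗ[R] R :=
  (TensorProduct.lid R R).toLinearMap ∘ₗ TensorProduct.map BD.εB BD.εB

/-- The twisting cochain `β = ε_{BA} ⊗ α : BA ⊗ BA → A`. -/
def β : A.Bar ⊗[R] A.Bar →ₗ[R] A.carrier :=
  (TensorProduct.lid R A.carrier).toLinearMap ∘ₗ TensorProduct.map BD.εB BD.α

end BarData

/-- `E : BA ⊗ BA → A` is a twisting cochain: it has degree `+1`, satisfies
`E(𝟙,-) = E(-,𝟙) = α` and the twisting cochain equation `d(E) = E ∪ E`,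
written as `d∘E + E∘d_{BA⊗BA} = μ_A (E ⊗ E) Δ_{BA⊗BA}` (all Koszul signs being
expressed via the sign operators). -/
structure IsTwistingCochain {R : Type} [CommRing R] {A : DGAlgebra R} (BD : BarData A)
    (E : A.Bar ⊗[R] A.Bar →ₗ[R] A.carrier) : Prop where
  degree : ∀ (l m : List A.carrier) (ds es : List ℤ), A.Homog l ds → A.Homog m es →
    E (A.word l ⊗ₜ[R] A.word m) ∈ A.grading (bdeg ds + bdeg es + 1)
  unit_left : ∀ b : A.Bar, E ((1 : A.Bar) ⊗ₜ[R] b) = BD.α b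
  unit_right : ∀ a : A.Bar, E (a ⊗ₜ[R] (1 : A.Bar)) = BD.α a
  twist : A.d ∘ₗ E + E ∘ₗ BD.dBB =
    LinearMap.mul' R A.carrier ∘ₗ
      TensorProduct.map (E ∘ₗ TensorProduct.map BD.sgnB BD.sgnB) E ∘ₗ BD.ΔBB

/-- A twisting cochain is *normalized* if `E([1],𝟙) = E(𝟙,[1]) = 1`, if `E(a,b) = 0`
whenever the total bar length is `> 1` and some entry equals `1 ∈ A`, and if
`E(a,b)` lies in the augmentation ideal whenever the total bar length is `> 1`. -/
structure IsNormalized {R : Type} [CommRing R] {A : DGAlgebra R}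
    (E : A.Bar ⊗[R] A.Bar →ₗ[R] A.carrier) : Prop where
  one_right : E (A.word [(1 : A.carrier)] ⊗ₜ[R] (1 : A.Bar)) = 1
  one_left : E ((1 : A.Bar) ⊗ₜ[R] A.word [(1 : A.carrier)]) = 1
  vanish : ∀ l m : List A.carrier, 1 < l.length + m.length →
    ((1 : A.carrier) ∈ l ∨ (1 : A.carrier) ∈ m) → E (A.word l ⊗ₜ[R] A.word m) = 0
  aug_ideal : ∀ l m : List A.carrier, 1 < l.length + m.length →
    A.aug (E (A.word l ⊗ₜ[R] A.word m)) = 0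

/-- A twisting cochain has *level 3* if `E(a,b) = 0` whenever `a` has bar length `> 1`. -/
def IsLevel3 {R : Type} [CommRing R] {A : DGAlgebra R}
    (E : A.Bar ⊗[R] A.Bar →ₗ[R] A.carrier) : Prop :=
  ∀ (l m : List A.carrier), 1 < l.length → E (A.word l ⊗ₜ[R] A.word m) = 0

/-- A multiplication on the unnormalized bar construction `BA`: a morphism of
dg coalgebras `BA ⊗ BA → BA` of degree `0` having the counit element `𝟙` as a
two-sided unit (associativity is *not* required). -/
structure BarMult {R : Type} [CommRing R] {A : DGAlgebra R} (BD : BarData A) : Type where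
  f : A.Bar ⊗[R] A.Bar →ₗ[R] A.Bar
  one_mul : ∀ b : A.Bar, f ((1 : A.Bar) ⊗ₜ[R] b) = b
  mul_one : ∀ a : A.Bar, f (a ⊗ₜ[R] (1 : A.Bar)) = a
  graded : ∀ (l m : List A.carrier) (ds es : List ℤ), A.Homog l ds → A.Homog m es →
    f (A.word l ⊗ₜ[R] A.word m) ∈ A.barGrading (bdeg ds + bdeg es)
  chain : BD.dB ∘ₗ f = f ∘ₗ BD.dBB
  counit : BD.εB ∘ₗ f = BD.εBB
  coalg : BD.Δ ∘ₗ f = TensorProduct.map f f ∘ₗ BD.ΔBB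


/-! ## Simplicial sets, cochains, covers and the Mayer–Vietoris double complex -/

open Opposite in
/-- The set of `p`-simplices of a simplicial set. -/
abbrev SSet.simplex (X : SSet.{0}) (p : ℕ) : Type :=
  X.obj (Opposite.op (SimplexCategory.mk p))

/-- Transport of simplices along an equality of dimensions. -/
def SSet.simpCast (X : SSet.{0}) {a b : ℕ} (h : a = b) : X.simplex a → X.simplex b :=
  fun x => h ▸ x

/-- The front inclusion `[p] → [p+q]`. -/
def frontHom (p q : ℕ) : SimplexCategory.mk p ⟶ SimplexCategory.mk (p + q) :=
  SimplexCategory.mkHom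
    ⟨fun i => ⟨i.1, by have := i.isLt; omega⟩,
     fun a b h => by simpa [Fin.mk_le_mk] using h⟩

/-- The back inclusion `[q] → [p+q]`. -/
def backHom (p q : ℕ) : SimplexCategory.mk q ⟶ SimplexCategory.mk (p + q) :=
  SimplexCategory.mkHom
    ⟨fun i => ⟨p + i.1, by have := i.isLt; omega⟩,
     fun a b h => by simpa [Fin.mk_le_mk] using h⟩

/-- The cochain algebra `C^*(X; R)` of a simplicial set `X`: an augmented dg algebra
`C` concentrated in non-negative degrees whose degree-`p` part is identified with the
module of functions on `p`-simplices, with the simplicial coboundary as differential,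
the cup product (front face times back face) as multiplication, and evaluation at a
base vertex as augmentation. -/
structure CochainStr (R : Type) [CommRing R] (X : SSet.{0}) : Type 1 where
  C : DGAlgebra R
  grading_neg : ∀ i : ℤ, i < 0 → C.grading i = ⊥
  κ : ∀ p : ℕ, C.grading (p : ℤ) ≃ₗ[R] (X.simplex p → R)
  κ_one : ∀ σ : X.simplex 0, κ 0 ⟨1, by exact_mod_cast C.one_mem⟩ σ = 1
  κ_d : ∀ (p : ℕ) (α : C.grading (p : ℤ)) (σ : X.simplex (p + 1)),
    κ (p + 1) ⟨C.d α, by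
        have h := C.d_mem α.2
        rwa [show ((p : ℤ) + 1) = ((p + 1 : ℕ) : ℤ) by push_cast; ring] at h⟩ σ =
      ∑ i : Fin (p + 2), pm (i : ℕ) • κ p α (X.map (SimplexCategory.δ i).op σ)
  κ_mul : ∀ (p q : ℕ) (α : C.grading (p : ℤ)) (β : C.grading (q : ℤ))
    (σ : X.simplex (p + q)),
    κ (p + q) ⟨(α : C.carrier) * β, by
        have h := C.mul_mem α.2 β.2
        rwa [show ((p : ℤ) + (q : ℤ)) = ((p + q : ℕ) : ℤ) by push_cast; ring] at h⟩ σ =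
      κ p α (X.map (frontHom p q).op σ) * κ q β (X.map (backHom p q).op σ)
  basept : X.simplex 0
  κ_aug : ∀ α : C.grading ((0 : ℕ) : ℤ), C.aug α = κ 0 α basept

/-- A simplicial subset (subcomplex) of a simplicial set. -/
structure SubSSet (X : SSet.{0}) : Type 1 where
  carrier : ∀ n : SimplexCategoryᵒᵖ, Set (X.obj n)
  map_mem : ∀ {n m : SimplexCategoryᵒᵖ} (f : n ⟶ m) {x : X.obj n},
    x ∈ carrier n → X.map f x ∈ carrier m

lemma SubSSet.simpCast_mem {X : SSet.{0}} (SU : SubSSet X) {a b : ℕ} (h : a = b)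
    {x : X.simplex a} (hx : x ∈ SU.carrier (Opposite.op (SimplexCategory.mk a))) :
    X.simpCast h x ∈ SU.carrier (Opposite.op (SimplexCategory.mk b)) := by
  subst h; exact hx

section MayerVietoris

variable {X : SSet.{0}} {I : Type} [LinearOrder I]

/-- Strictly increasing `(q+1)`-tuples of indices. -/
def OrdTuple (I : Type) [LinearOrder I] (q : ℕ) : Type := {v : Fin (q + 1) → I // StrictMono v}

/-- The `p`-simplices of the intersection `U_{i₀} ∩ ⋯ ∩ U_{i_q}`. -/
def InterSimp (X : SSet.{0}) (U : I → SubSSet X) {q : ℕ} (v : Fin (q + 1) → I)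
    (p : ℕ) : Type :=
  {x : X.simplex p // ∀ t : Fin (q + 1), x ∈ (U (v t)).carrier (Opposite.op (SimplexCategory.mk p))}

/-- The Mayer–Vietoris bigraded module
`C^{pq}(U) = ∏_{i₀<⋯<i_q} C^p(U_{i₀} ∩ ⋯ ∩ U_{i_q}; R)`. -/
abbrev MVmod (R : Type) [CommRing R] (X : SSet.{0}) (U : I → SubSSet X) (p q : ℕ) : Type :=
  ∀ v : OrdTuple I q, InterSimp X U v.1 p → R

/-- The index set `{(p,q) : p + q = n}` of the bidegrees contributing to total
degree `n`. -/
def MVIdx (n : ℤ) : Type := {pq : ℕ × ℕ // (pq.1 : ℤ) + pq.2 = n}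

/-- The total Mayer–Vietoris complex `Tot C^{**}(U)` as an augmented dg algebra: its
degree-`n` part is identified with `∏_{p+q=n} C^{pq}(U)`, its differential is the
simplicial coboundary plus `(-1)^p` times the Čech differential, its product is the
standard one (front face/front tuple times back face/back tuple, with the Koszul
sign), and its augmentation is evaluation at a base vertex. -/
structure MVTotStr (R : Type) [CommRing R] (X : SSet.{0}) (U : I → SubSSet X) : Type 1 where
  Tot : DGAlgebra R
  κ : ∀ n : ℤ, Tot.grading n ≃ₗ[R]
    (∀ pq : MVIdx n, MVmod R X U pq.1.1 pq.1.2)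
  grading_neg : ∀ n : ℤ, n < 0 → Tot.grading n = ⊥
  κ_d : ∀ (n : ℤ) (α : Tot.grading n) (p q : ℕ) (h : (p : ℤ) + q = n + 1)
    (v : OrdTuple I q) (x : InterSimp X U v.1 p),
    κ (n + 1) ⟨Tot.d α, Tot.d_mem α.2⟩ ⟨(p, q), h⟩ v x =
      -- simplicial coboundary
      (if hp : 0 < p then
        ∑ i : Fin (p + 1), pm (i : ℕ) •
          κ n α ⟨(p - 1, q), by omega⟩ v
            (⟨X.map (SimplexCategory.δ (Fin.cast (by omega) i)).op
                (X.simpCast (by omega) x.1),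
              fun t => (U (v.1 t)).map_mem _
                ((U (v.1 t)).simpCast_mem (by omega) (x.2 t))⟩ :
              InterSimp X U v.1 (p - 1))
       else (0 : R))
      +
      -- Čech differential, with the sign `(-1)^p`
      pm (p : ℕ) • (if hq : 0 < q then
        ∑ t : Fin (q + 1), pm (t : ℕ) •
          (let vc : OrdTuple I (q - 1) :=
            ⟨fun s => v.1 (t.succAbove (Fin.cast (by omega) s)),
             fun a b hab => v.2 (Fin.strictMono_succAbove t hab)⟩
          κ n α ⟨(p, q - 1), by omega⟩ vc
            (⟨x.1, fun s => x.2 _⟩ : InterSimp X U vc.1 p))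
       else (0 : R))
  κ_mul : ∀ (n n' : ℤ) (α : Tot.grading n) (β : Tot.grading n') (P Q : ℕ)
    (h : (P : ℤ) + Q = n + n') (v : OrdTuple I Q) (x : InterSimp X U v.1 P),
    κ (n + n') ⟨(α : Tot.carrier) * β, Tot.mul_mem α.2 β.2⟩ ⟨(P, Q), h⟩ v x =
      ∑ p ∈ Finset.range (P + 1), ∑ q ∈ Finset.range (Q + 1),
        (if hc : p ≤ P ∧ q ≤ Q ∧ (p : ℤ) + q = n ∧
            ((P - p : ℕ) : ℤ) + ((Q - q : ℕ) : ℤ) = n' then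
          let vf : OrdTuple I q :=
            ⟨fun s => v.1 ⟨s.1, by have hs := s.isLt; omega⟩,
             fun a b hab => v.2 hab⟩
          let vb : OrdTuple I (Q - q) :=
            ⟨fun s => v.1 ⟨q + s.1, by have hs := s.isLt; omega⟩,
             fun a b hab => v.2 (by
               have hab' : (a : ℕ) < b := hab
               exact Fin.mk_lt_mk.mpr (by omega))⟩
          pm ((q : ℤ) * ((P - p : ℕ) : ℤ)) •
            (κ n α ⟨(p, q), hc.2.2.1⟩ vf
              (⟨X.map (frontHom p (P - p)).op (X.simpCast (by omega) x.1),
                fun t => (U _).map_mem _ ((U _).simpCast_mem (by omega)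
                  (x.2 ⟨t.1, by have ht := t.isLt; omega⟩))⟩ :
                InterSimp X U vf.1 p) *
             κ n' β ⟨(P - p, Q - q), hc.2.2.2⟩ vb
              (⟨X.map (backHom p (P - p)).op (X.simpCast (by omega) x.1),
                fun t => (U _).map_mem _ ((U _).simpCast_mem (by omega)
                  (x.2 ⟨q + t.1, by have ht := t.isLt; omega⟩))⟩ :
                InterSimp X U vb.1 (P - p)))
         else (0 : R))
  pti : I
  ptx : InterSimp X U (fun _ : Fin 1 => pti) 0
  κ_aug : ∀ α : Tot.grading ((0 : ℕ) : ℤ), Tot.aug α =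
    κ 0 α ⟨(0, 0), by norm_num⟩
      (⟨fun _ => pti, fun a b hab => absurd (Fin.lt_def.mp hab)
        (by have ha := a.isLt; have hb := b.isLt; omega)⟩ : OrdTuple I 0) ptx

end MayerVietoris


noncomputable section
open scoped TensorProduct
set_option linter.unusedSectionVars false
set_option linter.unusedSimpArgs false
set_option linter.unusedVariables false
namespace MVH

theorem pm_add (a b : ℤ) : pm (a + b) = pm a * pm b := by
  simp [pm, zpow_add]

theorem pm_zero : pm 0 = 1 := by simp [pm]

theorem pm_one : pm 1 = -1 := by simp [pm]

theorem pm_neg (a : ℤ) : pm (-a) = pm a := by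
  rcases Int.even_or_odd a with h | h
  · simp [pm, Even.neg_one_zpow h, Even.neg_one_zpow h.neg]
  · simp [pm, Odd.neg_one_zpow h, Odd.neg_one_zpow h.neg]

theorem pm_sub (a b : ℤ) : pm (a - b) = pm a * pm b := by
  rw [sub_eq_add_neg, pm_add, pm_neg]

theorem pm_sq (a : ℤ) : pm a * pm a = 1 := by
  rw [← pm_add]
  have : Even (a + a) := ⟨a, rfl⟩
  simp [pm, Even.neg_one_zpow this]

theorem pm_mul_self (a : ℤ) : pm (a * a) = pm a := by
  rcases Int.even_or_odd a with h | h
  · simp [pm, Even.neg_one_zpow h, Even.neg_one_zpow (h.mul_left a)]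
  · simp [pm, Odd.neg_one_zpow h, Odd.neg_one_zpow (h.mul h)]

theorem pm_two_mul (a : ℤ) : pm (2 * a) = 1 := by
  rw [two_mul, pm_add, pm_sq]

theorem pm_cases (a : ℤ) : pm a = 1 ∨ pm a = -1 := by
  rcases Int.even_or_odd a with h | h
  · left; simp [pm, Even.neg_one_zpow h]
  · right; simp [pm, Odd.neg_one_zpow h]

theorem pm_eq_of_even (a b : ℤ) (h : Even (a - b)) : pm a = pm b := by
  have : pm (a - b) = 1 := by simp [pm, Even.neg_one_zpow h]
  rw [pm_sub] at this
  have h2 := pm_sq b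
  calc pm a = pm a * (pm b * pm b) := by rw [h2, mul_one]
    _ = pm b := by rw [← mul_assoc, this, one_mul]

/-- A graded differential algebra, unbundled version with homogeneity predicates. -/
structure GDA (M : Type*) [AddCommGroup M] where
  mul : M →+ M →+ M
  d : M →+ M
  Hom : ℤ → AddSubgroup M
  mul_mem : ∀ {i j a b}, a ∈ Hom i → b ∈ Hom j → mul a b ∈ Hom (i + j)
  d_mem : ∀ {i a}, a ∈ Hom i → d a ∈ Hom (i + 1)
  dd : ∀ {i a}, a ∈ Hom i → d (d a) = 0
  leib : ∀ {i j a b}, a ∈ Hom i → b ∈ Hom j → d (mul a b) = mul (d a) b + pm i • mul a (d b)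
  assoc : ∀ {i j k a b c}, a ∈ Hom i → b ∈ Hom j → c ∈ Hom k →
    mul (mul a b) c = mul a (mul b c)

section bcalc

variable {M : Type*} [AddCommGroup M] (𝒢 : GDA M)
variable {V : Type*} [AddCommGroup V] {W : Type*} [AddCommGroup W]

/-- Degree of a bar word. -/
def bd : List (ℤ × M) → ℤ
  | [] => 0
  | a :: l => (a.1 - 1) + bd l

@[simp] theorem bd_nil : bd ([] : List (ℤ × M)) = 0 := rfl
@[simp] theorem bd_cons (a : ℤ × M) (l) : bd (a :: l) = (a.1 - 1) + bd l := rfl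
theorem bd_append (l m : List (ℤ × M)) : bd (l ++ m) = bd l + bd m := by
  induction l with
  | nil => simp
  | cons a l ih => simp [ih]; ring

/-- tagged differential -/
def dG (a : ℤ × M) : ℤ × M := (a.1 + 1, 𝒢.d a.2)
/-- tagged product -/
def mG (a b : ℤ × M) : ℤ × M := (a.1 + b.1, 𝒢.mul a.2 b.2)

/-- all entries homogeneous -/
def HomL (l : List (ℤ × M)) : Prop := ∀ g ∈ l, g.2 ∈ 𝒢.Hom g.1

/-- sum over all splittings of a word -/
def S : List (ℤ × M) → (List (ℤ × M) → List (ℤ × M) → V) → V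
  | [], F => F [] []
  | a :: l, F => F [] (a :: l) + S l (fun x y => F (a :: x) y)

/-- merging of the first entry with a word -/
def mh (F : List (ℤ × M) → V) (a : ℤ × M) : List (ℤ × M) → V
  | [] => 0
  | b :: l => F (mG 𝒢 a b :: l)

/-- precomposition with the bar differential -/
def D1 : (List (ℤ × M) → V) → List (ℤ × M) → V
  | _, [] => 0
  | F, a :: l => - F (dG 𝒢 a :: l) + pm (a.1 - 1) • D1 (fun x => F (a :: x)) l
      + pm (a.1 - 1) • mh 𝒢 F a l

/-- the part of the bar differential merging adjacent entries -/
def mrg : (List (ℤ × M) → V) → List (ℤ × M) → V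
  | _, [] => 0
  | F, a :: l => pm (a.1 - 1) • mrg (fun x => F (a :: x)) l + pm (a.1 - 1) • mh 𝒢 F a l

/-- the internal part of the bar differential -/
def dint : (List (ℤ × M) → V) → List (ℤ × M) → V
  | _, [] => 0
  | F, a :: l => - F (dG 𝒢 a :: l) + pm (a.1 - 1) • dint (fun x => F (a :: x)) l

theorem D1_eq (F : List (ℤ × M) → V) (l) : D1 𝒢 F l = dint 𝒢 F l + mrg 𝒢 F l := by
  induction l generalizing F with
  | nil => simp [D1, dint, mrg]
  | cons a l ih => simp only [D1, dint, mrg, ih, smul_add]; abel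

theorem S_add (l : List (ℤ × M)) (F F' : List (ℤ × M) → List (ℤ × M) → V) :
    S l (fun x y => F x y + F' x y) = S l F + S l F' := by
  induction l generalizing F F' with
  | nil => simp [S]
  | cons a l ih => simp only [S, ih]; abel

theorem S_map (φ : V →+ W) (l : List (ℤ × M)) (F : List (ℤ × M) → List (ℤ × M) → V) :
    φ (S l F) = S l (fun x y => φ (F x y)) := by
  induction l generalizing F with
  | nil => simp [S]
  | cons a l ih => simp only [S, ih, map_add]

theorem S_zsmul (n : ℤ) (l : List (ℤ × M)) (F : List (ℤ × M) → List (ℤ × M) → V) :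
    S l (fun x y => n • F x y) = n • S l F := by
  induction l generalizing F with
  | nil => simp [S]
  | cons a l ih => simp only [S, ih, smul_add]

theorem S_neg (l : List (ℤ × M)) (F : List (ℤ × M) → List (ℤ × M) → V) :
    S l (fun x y => - F x y) = - S l F := by
  have := S_zsmul (-1) l F
  simpa using this

theorem S_sub (l : List (ℤ × M)) (F F' : List (ℤ × M) → List (ℤ × M) → V) :
    S l (fun x y => F x y - F' x y) = S l F - S l F' := by
  simp only [sub_eq_add_neg, S_add, S_neg]

theorem S_zero (l : List (ℤ × M)) : S l (fun _ _ => (0 : V)) = 0 := by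
  have := S_zsmul 0 l (fun _ _ => (0 : V))
  simpa using this

/-- congruence for splittings -/
theorem S_congr {l : List (ℤ × M)} {F F' : List (ℤ × M) → List (ℤ × M) → V}
    (h : ∀ x y, x ++ y = l → F x y = F' x y) : S l F = S l F' := by
  induction l generalizing F F' with
  | nil => simpa [S] using h [] [] rfl
  | cons a l ih =>
    simp only [S]
    rw [h [] (a :: l) rfl, ih (fun x y hxy => h (a :: x) y (by simp [hxy]))]

theorem S_swap (l m : List (ℤ × M))
    (F : List (ℤ × M) → List (ℤ × M) → List (ℤ × M) → List (ℤ × M) → V) :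
    S l (fun x y => S m (fun u v => F x y u v)) = S m (fun u v => S l (fun x y => F x y u v)) := by
  induction l generalizing F with
  | nil => simp [S]
  | cons a l ih => simp only [S, ih, S_add]

theorem S_coassoc (l : List (ℤ × M)) (F : List (ℤ × M) → List (ℤ × M) → List (ℤ × M) → V) :
    S l (fun x z => S x (fun u v => F u v z)) = S l (fun u y => S y (fun v z => F u v z)) := by
  induction l generalizing F with
  | nil => simp [S]
  | cons a l ih =>
    simp only [S, S_add, ih]
    abel

theorem mh_map (φ : V →+ W) (F : List (ℤ × M) → V) (a) (l) :
    φ (mh 𝒢 F a l) = mh 𝒢 (fun x => φ (F x)) a l := by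
  cases l <;> simp [mh]

theorem D1_map (φ : V →+ W) (F : List (ℤ × M) → V) (l) :
    φ (D1 𝒢 F l) = D1 𝒢 (fun x => φ (F x)) l := by
  induction l generalizing F with
  | nil => simp [D1]
  | cons a l ih => simp [D1, ih, mh_map]

theorem D1_add (F F' : List (ℤ × M) → V) (l) :
    D1 𝒢 (fun x => F x + F' x) l = D1 𝒢 F l + D1 𝒢 F' l := by
  induction l generalizing F F' with
  | nil => simp [D1]
  | cons a l ih =>
    simp only [D1, ih]
    cases l <;> simp only [mh, smul_add, smul_zero, neg_add] <;> abel

theorem D1_zsmul (n : ℤ) (F : List (ℤ × M) → V) (l) :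
    D1 𝒢 (fun x => n • F x) l = n • D1 𝒢 F l :=
  (D1_map 𝒢 (zsmulAddGroupHom n) F l).symm

theorem D1_neg (F : List (ℤ × M) → V) (l) : D1 𝒢 (fun x => - F x) l = - D1 𝒢 F l := by
  simpa using D1_zsmul 𝒢 (-1) F l

theorem D1_sub (F F' : List (ℤ × M) → V) (l) :
    D1 𝒢 (fun x => F x - F' x) l = D1 𝒢 F l - D1 𝒢 F' l := by
  simp only [sub_eq_add_neg, D1_add, D1_neg]

theorem D1_S (m : List (ℤ × M)) (F : List (ℤ × M) → List (ℤ × M) → List (ℤ × M) → V) (l) :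
    D1 𝒢 (fun x => S m (F x)) l = S m (fun u v => D1 𝒢 (fun x => F x u v) l) := by
  induction m generalizing F with
  | nil => simp [S]
  | cons a m ih => simp only [S, D1_add, ih]

theorem D1_swap (F : List (ℤ × M) → List (ℤ × M) → V) (l m) :
    D1 𝒢 (fun x => D1 𝒢 (F x) m) l = D1 𝒢 (fun y => D1 𝒢 (fun x => F x y) l) m := by
  induction m generalizing F with
  | nil =>
    simpa [D1] using D1_zsmul 𝒢 0 (fun _ => (0 : V)) l
  | cons a m ih =>
    simp only [D1, D1_add, D1_neg, D1_zsmul, ih]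
    congr 2
    cases m with
    | nil => simpa [mh] using D1_zsmul 𝒢 0 (fun _ => (0 : V)) l
    | cons b m => simp [mh]

/-- the bar differential raises the degree by one -/
theorem D1_sign (k c : ℤ) (F : List (ℤ × M) → V) (l) :
    D1 𝒢 (fun x => pm (k * bd x + c) • F x) l = pm (k * (bd l + 1) + c) • D1 𝒢 F l := by
  induction l generalizing F c with
  | nil => simp [D1]
  | cons a l ih =>
    have h1 : ∀ x, k * bd (a :: x) + c = k * bd x + (k * (a.1 - 1) + c) := by
      intro x; simp; ring
    have s1 : k * bd (dG 𝒢 a :: l) + c = k * (bd (a :: l) + 1) + c := by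
      simp only [dG, bd_cons]; ring
    have s2 : k * (bd l + 1) + (k * (a.1 - 1) + c) = k * (bd (a :: l) + 1) + c := by
      simp only [bd_cons]; ring
    simp only [D1, h1, ih, smul_add, smul_neg, s2]
    have s1' : k * bd l + (k * ((dG 𝒢 a).1 - 1) + c) = k * (bd (a :: l) + 1) + c := by
      simp only [dG, bd_cons]; ring
    rw [s1]
    congr 1
    · congr 1
      rw [smul_comm]
    · cases l with
      | nil => simp [mh]
      | cons b l =>
        simp only [mh]
        rw [smul_comm]
        have s3 : k * bd (mG 𝒢 a b :: l) + c = k * (bd (a :: b :: l) + 1) + c := by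
          simp only [mG, bd_cons]; ring
        rw [s3]

/-- the bar differential is a coderivation -/
theorem D1_coder (F : List (ℤ × M) → List (ℤ × M) → V) (l) :
    D1 𝒢 (fun x => S x F) l =
      S l (fun x y => D1 𝒢 (fun u => F u y) x + pm (bd x) • D1 𝒢 (F x) y) := by
  induction l generalizing F with
  | nil => simp [D1, S]
  | cons a l ih =>
    simp only [D1, S, D1_add, ih, S_add, S_zsmul, smul_add, neg_add, bd_nil, bd_cons, pm_zero,
      one_smul, S_neg]
    have h2 : S l (fun x y => pm (a.1 - 1 + bd x) • D1 𝒢 (F (a :: x)) y) =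
        pm (a.1 - 1) • S l (fun x y => pm (bd x) • D1 𝒢 (F (a :: x)) y) := by
      rw [← S_zsmul]; simp only [pm_add, mul_smul]
    rw [h2]
    cases l with
    | nil => simp [mh, S, D1]
    | cons b l =>
      simp only [mh, S, smul_add, S_add, S_zsmul]
      abel_nf

theorem HomL_cons {a : ℤ × M} {l} : HomL 𝒢 (a :: l) ↔ a.2 ∈ 𝒢.Hom a.1 ∧ HomL 𝒢 l := by
  simp [HomL]

theorem HomL_nil : HomL 𝒢 ([] : List (ℤ × M)) := by simp [HomL]

theorem HomL_append {l m : List (ℤ × M)} : HomL 𝒢 (l ++ m) ↔ HomL 𝒢 l ∧ HomL 𝒢 m := by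
  simp only [HomL, List.mem_append]
  constructor
  · intro h; exact ⟨fun g hg => h g (Or.inl hg), fun g hg => h g (Or.inr hg)⟩
  · rintro ⟨h1, h2⟩ g (hg | hg)
    · exact h1 g hg
    · exact h2 g hg

/-- multi-additivity -/
def MA (F : List (ℤ × M) → V) : Prop :=
  ∀ (l1 l2 : List (ℤ × M)) (n : ℤ) (a b : M),
    F (l1 ++ (n, a + b) :: l2) = F (l1 ++ (n, a) :: l2) + F (l1 ++ (n, b) :: l2)

theorem MA.tail {F : List (ℤ × M) → V} (h : MA F) (g) : MA (fun x => F (g :: x)) :=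
  fun l1 l2 n a b => h (g :: l1) l2 n a b

theorem MA.head {F : List (ℤ × M) → V} (h : MA F) (n a b l) :
    F ((n, a + b) :: l) = F ((n, a) :: l) + F ((n, b) :: l) := h [] l n a b

theorem MA.zero {F : List (ℤ × M) → V} (h : MA F) (n l) : F ((n, 0) :: l) = 0 := by
  have := h.head n 0 0 l
  simpa using this

theorem MA.neg {F : List (ℤ × M) → V} (h : MA F) (n a l) :
    F ((n, -a) :: l) = - F ((n, a) :: l) := by
  have := h.head n a (-a) l
  rw [add_neg_cancel, h.zero] at this
  exact (neg_eq_of_add_eq_zero_right this.symm).symm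

theorem MA.pm {F : List (ℤ × M) → V} (h : MA F) (k n a l) :
    F ((n, pm k • a) :: l) = _root_.pm k • F ((n, a) :: l) := by
  rcases pm_cases k with e | e <;> simp [e, h.neg]

theorem D1_D1 {F : List (ℤ × M) → V} (hF : MA F) {l} (hl : HomL 𝒢 l) :
    D1 𝒢 (D1 𝒢 F) l = 0 := by
  induction l generalizing F with
  | nil => simp [D1]
  | cons a l ih =>
    obtain ⟨ha, hl⟩ := (HomL_cons 𝒢).1 hl
    have ih' := ih (hF.tail a) hl
    have e1 : (fun x => D1 𝒢 F (a :: x)) = fun x => - F (dG 𝒢 a :: x)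
      + pm (a.1 - 1) • D1 𝒢 (fun x => F (a :: x)) x + pm (a.1 - 1) • mh 𝒢 F a x := by
      funext x; simp [D1]
    rw [D1, e1]
    simp only [D1_add, D1_neg, D1_zsmul]
    have e2 : D1 𝒢 F (dG 𝒢 a :: l) = - (pm (a.1 - 1) • D1 𝒢 (fun x => F (dG 𝒢 a :: x)) l)
        - pm (a.1 - 1) • mh 𝒢 F (dG 𝒢 a) l := by
      rw [D1]
      have : F (dG 𝒢 (dG 𝒢 a) :: l) = 0 := by
        simp only [dG, 𝒢.dd ha]; exact hF.zero _ _
      rw [this]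
      have : pm ((dG 𝒢 a).1 - 1) = - pm (a.1 - 1) := by
        simp [dG, pm_sub, pm_one]
      rw [this]; simp; abel
    have ih2 : D1 𝒢 (fun x => D1 𝒢 (fun x => F (a :: x)) x) l = 0 := ih'
    rw [e2, ih2]
    cases l with
    | nil => simp [mh, D1]
    | cons b l =>
      obtain ⟨hb, hl⟩ := (HomL_cons 𝒢).1 hl
      have e3 : D1 𝒢 (fun x => mh 𝒢 F a x) (b :: l) = - F (mG 𝒢 a (dG 𝒢 b) :: l)
        + pm (b.1 - 1) • D1 𝒢 (fun x => F (mG 𝒢 a b :: x)) l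
        + pm (b.1 - 1) • mh 𝒢 F (mG 𝒢 a b) l := by
        simp only [D1, mh]
        congr 2
        cases l with
        | nil => simp [mh]
        | cons c l =>
          obtain ⟨hc, hl⟩ := (HomL_cons 𝒢).1 hl
          simp only [mh, mG, 𝒢.assoc ha hb hc, add_assoc]
      have e4 : F (dG 𝒢 (mG 𝒢 a b) :: l) = F (mG 𝒢 (dG 𝒢 a) b :: l)
          + pm a.1 • F (mG 𝒢 a (dG 𝒢 b) :: l) := by
        simp only [dG, mG, 𝒢.leib ha hb]
        rw [hF.head, hF.pm]
        have t1 : a.1 + 1 + b.1 = a.1 + b.1 + 1 := by ring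
        have t2 : a.1 + (b.1 + 1) = a.1 + b.1 + 1 := by ring
        rw [t1, t2]
      rw [e3]
      simp only [mh, D1, e4]
      have h5 : pm ((mG 𝒢 a b).1 - 1) = - (pm (a.1 - 1) * pm (b.1 - 1)) := by
        simp [mG, pm_sub, pm_add, pm_one]
      have h6 : pm a.1 = - pm (a.1 - 1) := by simp [pm_sub, pm_one]
      rw [h5, h6]
      have h7 := pm_sq (a.1 - 1)
      generalize pm (a.1 - 1) = p at *
      generalize pm (b.1 - 1) = q at *
      simp only [smul_add, smul_neg, neg_smul, smul_smul, h7, mul_neg, neg_neg, smul_sub, ← mul_assoc, one_mul, smul_zero,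
        neg_add_rev, sub_neg_eq_add, neg_sub]
      abel

end bcalc
end MVH

end


noncomputable section
open scoped TensorProduct
set_option linter.unusedSectionVars false
set_option linter.unusedSimpArgs false
set_option linter.unusedVariables false
namespace MVH

section bianchi

variable {M : Type*} [AddCommGroup M] (𝒢 : GDA M)
variable {V : Type*} [AddCommGroup V]

/-- sum over all splittings of two words -/
def SS (l m : List (ℤ × M))
    (K : List (ℤ × M) → List (ℤ × M) → List (ℤ × M) → List (ℤ × M) → V) : V :=
  S l (fun l1 l2 => S m (fun m1 m2 => K l1 m1 l2 m2))

theorem SS_congr {l m : List (ℤ × M)}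
    {K K' : List (ℤ × M) → List (ℤ × M) → List (ℤ × M) → List (ℤ × M) → V}
    (h : ∀ l1 l2 m1 m2, l1 ++ l2 = l → m1 ++ m2 = m → K l1 m1 l2 m2 = K' l1 m1 l2 m2) :
    SS l m K = SS l m K' :=
  S_congr (fun x y hxy => S_congr (fun u v huv => h x y u v hxy huv))

theorem SS_add (l m : List (ℤ × M))
    (K K' : List (ℤ × M) → List (ℤ × M) → List (ℤ × M) → List (ℤ × M) → V) :
    SS l m (fun a b c d => K a b c d + K' a b c d) = SS l m K + SS l m K' := by
  simp only [SS, S_add]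

theorem SS_sub (l m : List (ℤ × M))
    (K K' : List (ℤ × M) → List (ℤ × M) → List (ℤ × M) → List (ℤ × M) → V) :
    SS l m (fun a b c d => K a b c d - K' a b c d) = SS l m K - SS l m K' := by
  simp only [SS, S_sub]

theorem SS_neg (l m : List (ℤ × M))
    (K : List (ℤ × M) → List (ℤ × M) → List (ℤ × M) → List (ℤ × M) → V) :
    SS l m (fun a b c d => - K a b c d) = - SS l m K := by
  simp only [SS, S_neg]

theorem SS_zero (l m : List (ℤ × M)) :
    SS l m (fun _ _ _ _ => (0 : V)) = 0 := by
  simp only [SS, S_zero]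

theorem SS_zsmul (n : ℤ) (l m : List (ℤ × M))
    (K : List (ℤ × M) → List (ℤ × M) → List (ℤ × M) → List (ℤ × M) → V) :
    SS l m (fun a b c d => n • K a b c d) = n • SS l m K := by
  simp only [SS, S_zsmul]

theorem SS_map {W : Type*} [AddCommGroup W] (φ : V →+ W) (l m : List (ℤ × M))
    (K : List (ℤ × M) → List (ℤ × M) → List (ℤ × M) → List (ℤ × M) → V) :
    φ (SS l m K) = SS l m (fun a b c d => φ (K a b c d)) := by
  simp only [SS, S_map]

/-- cup product with the second sign convention -/
def cup1 (f g : List (ℤ × M) → List (ℤ × M) → M) (l m : List (ℤ × M)) : M :=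
  SS l m (fun l1 m1 l2 m2 => pm (bd l1 + bd m1 + bd l2 * bd m1) • 𝒢.mul (f l1 m1) (g l2 m2))

/-- cup product -/
def cup0 (f g : List (ℤ × M) → List (ℤ × M) → M) (l m : List (ℤ × M)) : M :=
  SS l m (fun l1 m1 l2 m2 => pm (bd l2 * bd m1) • 𝒢.mul (f l1 m1) (g l2 m2))

/-- precomposition with the differential of the tensor square -/
def DD (f : List (ℤ × M) → List (ℤ × M) → V) (l m : List (ℤ × M)) : V :=
  D1 𝒢 (fun x => f x m) l + pm (bd l) • D1 𝒢 (f l) m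

/-- the defect of the twisting cochain equation -/
def Th (f : List (ℤ × M) → List (ℤ × M) → M) (l m : List (ℤ × M)) : M :=
  𝒢.d (f l m) + DD 𝒢 f l m - cup1 𝒢 f f l m

theorem pm_mul_one_add (a b : ℤ) : pm (a * (b + 1)) = pm (a * b) * pm a := by
  rw [mul_add, mul_one, pm_add]

theorem DD_cup1 (f g : List (ℤ × M) → List (ℤ × M) → M) (l m) :
    DD 𝒢 (cup1 𝒢 f g) l m = - cup1 𝒢 (DD 𝒢 f) g l m + cup0 𝒢 f (DD 𝒢 g) l m := by
  have k1 : ∀ (a b c e : ℤ) (φ : M →+ M) (F : List (ℤ × M) → M) (x),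
      D1 𝒢 (fun u => pm (bd u + b + c * e) • φ (F u)) x =
      pm (bd x + 1 + b + c * e) • φ (D1 𝒢 F x) := by
    intro a b c e φ F x
    have := D1_sign 𝒢 1 (b + c * e) (fun u => φ (F u)) x
    rw [D1_map]
    convert this using 2
    · funext u; congr 2; ring
    · congr 1; ring
  have k2 : ∀ (a b e : ℤ) (φ : M →+ M) (F : List (ℤ × M) → M) (x),
      D1 𝒢 (fun u => pm (a + b + bd u * e) • φ (F u)) x =
      pm (a + b + bd x * e + e) • φ (D1 𝒢 F x) := by
    intro a b e φ F x
    have := D1_sign 𝒢 e (a + b) (fun u => φ (F u)) x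
    rw [D1_map]
    convert this using 2
    · funext u; congr 2; ring
    · congr 1; ring
  have k3 : ∀ (a c : ℤ) (φ : M →+ M) (F : List (ℤ × M) → M) (x),
      D1 𝒢 (fun u => pm (a + bd u + c * bd u) • φ (F u)) x =
      pm (a + bd x + 1 + c * bd x + c) • φ (D1 𝒢 F x) := by
    intro a c φ F x
    have := D1_sign 𝒢 (1 + c) a (fun u => φ (F u)) x
    rw [D1_map]
    convert this using 2
    · funext u; congr 2; ring
    · congr 1; ring
  have k4 : ∀ (a : ℤ) (φ : M →+ M) (F : List (ℤ × M) → M) (x),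
      D1 𝒢 (fun u => pm a • φ (F u)) x = pm a • φ (D1 𝒢 F x) := by
    intro a φ F x
    rw [D1_map, D1_zsmul]
  have e1 : D1 𝒢 (fun x => cup1 𝒢 f g x m) l =
      SS l m (fun l1 m1 l2 m2 =>
        pm (bd l1 + 1 + bd m1 + bd l2 * bd m1) • 𝒢.mul (D1 𝒢 (fun u => f u m1) l1) (g l2 m2)
        + pm (bd l1) • pm (bd l1 + bd m1 + bd l2 * bd m1 + bd m1) •
          𝒢.mul (f l1 m1) (D1 𝒢 (fun u => g u m2) l2)) := by
    simp only [cup1, SS]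
    rw [D1_coder]
    refine S_congr (fun l1 l2 h => ?_)
    rw [D1_S, D1_S, ← S_zsmul, ← S_add]
    refine S_congr (fun m1 m2 h => ?_)
    rw [k2]
    have := k1 0 (bd m1) (bd l2) (bd m1) (𝒢.mul.flip (g l2 m2)) (fun u => f u m1) l1
    simp only [AddMonoidHom.flip_apply] at this
    rw [this]
  have e2 : D1 𝒢 (cup1 𝒢 f g l) m =
      SS l m (fun l1 m1 l2 m2 =>
        pm (bd l1 + bd m1 + 1 + bd l2 * bd m1 + bd l2) • 𝒢.mul (D1 𝒢 (f l1) m1) (g l2 m2)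
        + pm (bd m1) • pm (bd l1 + bd m1 + bd l2 * bd m1) •
          𝒢.mul (f l1 m1) (D1 𝒢 (g l2) m2)) := by
    have : cup1 𝒢 f g l = fun y => S l (fun l1 l2 => S y (fun m1 m2 =>
      pm (bd l1 + bd m1 + bd l2 * bd m1) • 𝒢.mul (f l1 m1) (g l2 m2))) := rfl
    rw [this, D1_S]
    refine S_congr (fun l1 l2 h => ?_)
    rw [D1_coder]
    refine S_congr (fun m1 m2 h => ?_)
    rw [k4]
    have := k3 (bd l1) (bd l2) (𝒢.mul.flip (g l2 m2)) (fun u => f l1 u) m1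
    simp only [AddMonoidHom.flip_apply] at this
    rw [this]
  rw [DD, e1, e2, cup1, cup0, ← SS_zsmul, ← SS_add, ← SS_neg, ← SS_add]
  refine SS_congr (fun l1 l2 m1 m2 hl hm => ?_)
  have hb : bd l = bd l1 + bd l2 := by rw [← hl, bd_append]
  simp only [DD, map_add, AddMonoidHom.add_apply, map_zsmul, AddMonoidHom.smul_apply, smul_add, smul_smul, hb, pm_add, pm_one,
    AddMonoidHom.coe_smul, Pi.smul_apply]
  have a1 := pm_sq (bd l1)
  have a2 := pm_sq (bd l2)
  have a3 := pm_sq (bd m1)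
  rcases pm_cases (bd l1) with h1 | h1 <;> rcases pm_cases (bd l2) with h2 | h2 <;>
    rcases pm_cases (bd m1) with h3 | h3 <;> simp only [h1, h2, h3] <;> simp <;> abel

theorem DD_DD {f : List (ℤ × M) → List (ℤ × M) → V} (h1 : ∀ m, MA (fun x => f x m))
    (h2 : ∀ l, MA (f l)) {l m} (hl : HomL 𝒢 l) (hm : HomL 𝒢 m) :
    DD 𝒢 (DD 𝒢 f) l m = 0 := by
  have s := D1_sign 𝒢 1 0 (fun x => D1 𝒢 (f x) m) l
  simp only [one_mul, add_zero] at s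
  have e : DD 𝒢 f l = fun m => D1 𝒢 (fun x => f x m) l + pm (bd l) • D1 𝒢 (f l) m := rfl
  rw [DD, e]
  simp only [DD, D1_add, s, D1_zsmul]
  have z1 : D1 𝒢 (fun x => D1 𝒢 (fun x => f x m) x) l = 0 := D1_D1 𝒢 (h1 m) hl
  have z2 : D1 𝒢 (fun x => D1 𝒢 (f l) x) m = 0 := D1_D1 𝒢 (h2 l) hm
  rw [z1, z2, D1_swap, pm_add, pm_one]
  simp

theorem DD_add (f g : List (ℤ × M) → List (ℤ × M) → V) (l m) :
    DD 𝒢 (fun x y => f x y + g x y) l m = DD 𝒢 f l m + DD 𝒢 g l m := by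
  simp only [DD, D1_add, smul_add]; abel

theorem DD_sub (f g : List (ℤ × M) → List (ℤ × M) → V) (l m) :
    DD 𝒢 (fun x y => f x y - g x y) l m = DD 𝒢 f l m - DD 𝒢 g l m := by
  simp only [DD, D1_sub, smul_sub]; abel

theorem DD_map {W : Type*} [AddCommGroup W] (φ : V →+ W)
    (f : List (ℤ × M) → List (ℤ × M) → V) (l m) :
    DD 𝒢 (fun x y => φ (f x y)) l m = φ (DD 𝒢 f l m) := by
  simp only [DD, map_add, map_zsmul, D1_map]

theorem cup_assoc {f : List (ℤ × M) → List (ℤ × M) → M}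
    (hdeg : ∀ l m, HomL 𝒢 l → HomL 𝒢 m → f l m ∈ 𝒢.Hom (bd l + bd m + 1))
    {l m} (hl : HomL 𝒢 l) (hm : HomL 𝒢 m) :
    cup1 𝒢 (cup1 𝒢 f f) f l m = cup0 𝒢 f (cup1 𝒢 f f) l m := by
  have e1 : cup1 𝒢 (cup1 𝒢 f f) f l m = S l (fun x l3 => S x (fun l1 l2 =>
      S m (fun y m3 => S y (fun m1 m2 =>
        pm (bd l1 + bd l2 + (bd m1 + bd m2) + bd l3 * (bd m1 + bd m2)) •
        pm (bd l1 + bd m1 + bd l2 * bd m1) •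
        𝒢.mul (𝒢.mul (f l1 m1) (f l2 m2)) (f l3 m3))))) := by
    refine S_congr (fun x l3 hx => ?_)
    rw [S_swap]
    refine S_congr (fun y m3 hy => ?_)
    have := SS_map (𝒢.mul.flip (f l3 m3)) x y (fun l1 m1 l2 m2 =>
      pm (bd l1 + bd m1 + bd l2 * bd m1) • 𝒢.mul (f l1 m1) (f l2 m2))
    simp only [AddMonoidHom.flip_apply] at this
    change pm (bd x + bd y + bd l3 * bd y) • 𝒢.mul (SS x y (fun l1 m1 l2 m2 =>
      pm (bd l1 + bd m1 + bd l2 * bd m1) • 𝒢.mul (f l1 m1) (f l2 m2))) (f l3 m3) = _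
    rw [this, ← SS_zsmul]
    refine SS_congr (fun l1 l2 m1 m2 h1 h2 => ?_)
    rw [← h1, ← h2, bd_append, bd_append]
    simp
  have e2 : cup0 𝒢 f (cup1 𝒢 f f) l m = S l (fun l1 x => S x (fun l2 l3 =>
      S m (fun m1 y => S y (fun m2 m3 =>
        pm ((bd l2 + bd l3) * bd m1) •
        pm (bd l2 + bd m2 + bd l3 * bd m2) •
        𝒢.mul (f l1 m1) (𝒢.mul (f l2 m2) (f l3 m3)))))) := by
    refine S_congr (fun l1 x hx => ?_)
    rw [S_swap]
    refine S_congr (fun m1 y hy => ?_)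
    have := SS_map (𝒢.mul (f l1 m1)) x y (fun l1 m1 l2 m2 =>
      pm (bd l1 + bd m1 + bd l2 * bd m1) • 𝒢.mul (f l1 m1) (f l2 m2))
    change pm (bd x * bd m1) • 𝒢.mul (f l1 m1) (SS x y (fun l1 m1 l2 m2 =>
      pm (bd l1 + bd m1 + bd l2 * bd m1) • 𝒢.mul (f l1 m1) (f l2 m2))) = _
    rw [this, ← SS_zsmul]
    refine SS_congr (fun l2 l3 m2 m3 h1 h2 => ?_)
    rw [← h1, bd_append]
    simp
  rw [e1, e2, S_coassoc]
  refine S_congr (fun l1 x hx => S_congr (fun l2 l3 hx' => ?_))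
  rw [S_coassoc]
  refine S_congr (fun m1 y hy => S_congr (fun m2 m3 hy' => ?_))
  subst hx' hy'
  rw [← hx, HomL_append, HomL_append] at hl
  rw [← hy, HomL_append, HomL_append] at hm
  rw [𝒢.assoc (hdeg _ _ hl.1 hm.1) (hdeg _ _ hl.2.1 hm.2.1) (hdeg _ _ hl.2.2 hm.2.2),
    smul_smul, smul_smul, ← pm_add, ← pm_add]
  congr 1
  apply pm_eq_of_even
  exact ⟨bd l1 + bd m1, by ring⟩

/-- the Bianchi identity -/
theorem bianchi {f : List (ℤ × M) → List (ℤ × M) → M} (h1 : ∀ m, MA (fun x => f x m))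
    (h2 : ∀ l, MA (f l))
    (hdeg : ∀ l m, HomL 𝒢 l → HomL 𝒢 m → f l m ∈ 𝒢.Hom (bd l + bd m + 1))
    {l m} (hl : HomL 𝒢 l) (hm : HomL 𝒢 m) :
    𝒢.d (Th 𝒢 f l m) - DD 𝒢 (Th 𝒢 f) l m =
      cup0 𝒢 f (Th 𝒢 f) l m - cup1 𝒢 (Th 𝒢 f) f l m := by
  have z : 𝒢.d (𝒢.d (f l m)) = 0 := 𝒢.dd (hdeg l m hl hm)
  have e1 : DD 𝒢 (Th 𝒢 f) l m = 𝒢.d (DD 𝒢 f l m) - DD 𝒢 (cup1 𝒢 f f) l m := by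
    have : Th 𝒢 f = fun x y => (𝒢.d (f x y) + DD 𝒢 f x y) - cup1 𝒢 f f x y := rfl
    rw [this, DD_sub, DD_add, DD_map, DD_DD 𝒢 h1 h2 hl hm, add_zero]
  have e2 : 𝒢.d (cup1 𝒢 f f l m) = cup1 𝒢 (fun x y => 𝒢.d (f x y)) f l m
      - cup0 𝒢 f (fun x y => 𝒢.d (f x y)) l m := by
    rw [cup1, cup1, cup0, SS_map, ← SS_sub]
    refine SS_congr (fun l1 l2 m1 m2 hx hy => ?_)
    rw [← hx, HomL_append] at hl
    rw [← hy, HomL_append] at hm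
    rw [map_zsmul, 𝒢.leib (hdeg _ _ hl.1 hm.1) (hdeg _ _ hl.2 hm.2), smul_add, sub_eq_add_neg,
      smul_smul, ← pm_add]
    congr 1
    rw [← neg_smul]
    congr 1
    have : - pm (bd l2 * bd m1) = pm (bd l2 * bd m1 + 1) := by rw [pm_add, pm_one]; simp
    rw [this]
    apply pm_eq_of_even
    exact ⟨bd l1 + bd m1, by ring⟩
  have e3 : cup0 𝒢 f (Th 𝒢 f) l m = cup0 𝒢 f (fun x y => 𝒢.d (f x y)) l m
      + cup0 𝒢 f (DD 𝒢 f) l m - cup0 𝒢 f (cup1 𝒢 f f) l m := by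
    simp only [cup0]
    rw [← SS_add, ← SS_sub]
    refine SS_congr (fun l1 l2 m1 m2 hx hy => ?_)
    rw [Th, map_sub, map_add, smul_sub, smul_add]
  have e4 : cup1 𝒢 (Th 𝒢 f) f l m = cup1 𝒢 (fun x y => 𝒢.d (f x y)) f l m
      + cup1 𝒢 (DD 𝒢 f) f l m - cup1 𝒢 (cup1 𝒢 f f) f l m := by
    conv_lhs => rw [cup1]
    conv_rhs => rw [cup1, cup1, cup1]
    rw [← SS_add, ← SS_sub]
    refine SS_congr (fun l1 l2 m1 m2 hx hy => ?_)
    rw [Th, map_sub, map_add, AddMonoidHom.sub_apply, AddMonoidHom.add_apply, smul_sub, smul_add]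
  rw [e1, e3, e4, cup_assoc 𝒢 hdeg hl hm, DD_cup1, Th, map_sub, map_add, z, e2]
  abel

end bianchi
end MVH

end


noncomputable section
open scoped TensorProduct
set_option linter.unusedSectionVars false
set_option linter.unusedSimpArgs false
set_option linter.unusedVariables false
namespace MVH

section splits

variable {α : Type*} {V W : Type*} [AddCommGroup V] [AddCommGroup W]

/-- sum over all overlapping splittings (front face, back face) -/
def Sp : List α → (List α → List α → V) → V
  | [], _ => 0
  | x :: s, F => F [x] (x :: s) + Sp s (fun u v => F (x :: u) v)

/-- simplicial coboundary -/
def del : (List α → V) → List α → V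
  | _, [] => 0
  | f, x :: s => f s - del (fun u => f (x :: u)) s

/-- signed length minus one -/
def dm (s : List α) : ℤ := (s.length : ℤ) - 1

theorem dm_cons (x : α) (s : List α) : dm (x :: s) = dm s + 1 := by
  simp [dm]

theorem Sp_add (s : List α) (F F' : List α → List α → V) :
    Sp s (fun x y => F x y + F' x y) = Sp s F + Sp s F' := by
  induction s generalizing F F' with
  | nil => simp [Sp]
  | cons a l ih => simp only [Sp, ih]; abel

theorem Sp_map (φ : V →+ W) (l : List α) (F : List α → List α → V) :
    φ (Sp l F) = Sp l (fun x y => φ (F x y)) := by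
  induction l generalizing F with
  | nil => simp [Sp]
  | cons a l ih => simp only [Sp, ih, map_add]

theorem Sp_zsmul (n : ℤ) (l : List α) (F : List α → List α → V) :
    Sp l (fun x y => n • F x y) = n • Sp l F :=
  (Sp_map (zsmulAddGroupHom n) l F).symm

theorem Sp_neg (l : List α) (F : List α → List α → V) :
    Sp l (fun x y => - F x y) = - Sp l F := by
  simpa using Sp_zsmul (-1) l F

theorem Sp_sub (l : List α) (F F' : List α → List α → V) :
    Sp l (fun x y => F x y - F' x y) = Sp l F - Sp l F' := by
  simp only [sub_eq_add_neg, Sp_add, Sp_neg]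

theorem Sp_zero (l : List α) : Sp l (fun _ _ => (0 : V)) = 0 := by
  simpa using Sp_zsmul 0 l (fun _ _ => (0 : V))

theorem Sp_congr {l : List α} {F F' : List α → List α → V}
    (h : ∀ x y, x ≠ [] → y ≠ [] → x.Sublist l → y.Sublist l →
      (x.length : ℤ) + y.length = l.length + 1 → F x y = F' x y) : Sp l F = Sp l F' := by
  induction l generalizing F F' with
  | nil => simp [Sp]
  | cons a l ih =>
    simp only [Sp]
    rw [h [a] (a :: l) (by simp) (by simp) (by simp) (by simp) (by simp; ring),
      ih (fun x y h1 h2 h3 h4 h5 => h (a :: x) y (by simp) h2 (by simpa using h3)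
        (h4.cons a) (by push_cast [List.length_cons]; linarith))]

theorem Sp_swap {β : Type*} (l : List α) (m : List β)
    (F : List α → List α → List β → List β → V) :
    Sp l (fun x y => Sp m (fun u v => F x y u v)) = Sp m (fun u v => Sp l (fun x y => F x y u v)) := by
  induction l generalizing F with
  | nil => simp [Sp, Sp_zero]
  | cons a l ih => simp only [Sp, ih, Sp_add]

theorem Sp_coassoc (l : List α) (F : List α → List α → List α → V) :
    Sp l (fun x z => Sp x (fun u v => F u v z)) = Sp l (fun u y => Sp y (fun v z => F u v z)) := by
  induction l generalizing F with
  | nil => simp [Sp]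
  | cons a l ih =>
    simp only [Sp, Sp_add, ih]
    abel

theorem del_map (φ : V →+ W) (F : List α → V) (l) :
    φ (del F l) = del (fun x => φ (F x)) l := by
  induction l generalizing F with
  | nil => simp [del]
  | cons a l ih => simp [del, ih]

theorem del_add (F F' : List α → V) (l) :
    del (fun x => F x + F' x) l = del F l + del F' l := by
  induction l generalizing F F' with
  | nil => simp [del]
  | cons a l ih => simp only [del, ih]; abel

theorem del_zsmul (n : ℤ) (F : List α → V) (l) :
    del (fun x => n • F x) l = n • del F l :=
  (del_map (zsmulAddGroupHom n) F l).symm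

theorem del_neg (F : List α → V) (l) : del (fun x => - F x) l = - del F l := by
  simpa using del_zsmul (-1) F l

theorem del_sub (F F' : List α → V) (l) :
    del (fun x => F x - F' x) l = del F l - del F' l := by
  simp only [sub_eq_add_neg, del_add, del_neg]

theorem del_zero (l : List α) : del (fun _ => (0 : V)) l = 0 := by
  simpa using del_zsmul 0 (fun _ => (0 : V)) l

theorem del_congr {l : List α} {F F' : List α → V}
    (h : ∀ x, x.Sublist l → x.length + 1 = l.length → F x = F' x) : del F l = del F' l := by
  induction l generalizing F F' with
  | nil => simp [del]
  | cons a l ih =>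
    simp only [del]
    rw [h l (by simp) (by simp), ih (fun x hx h1 => h (a :: x) (by simpa using hx) (by simpa using h1))]

theorem del_Sp {β : Type*} (m : List β) (F : List α → List β → List β → V) (l) :
    del (fun x => Sp m (F x)) l = Sp m (fun u v => del (fun x => F x u v) l) := by
  induction m generalizing F with
  | nil => simp [Sp, del_zero]
  | cons a m ih => simp only [Sp, del_add, ih]

theorem del_swap {β : Type*} (F : List α → List β → V) (l m) :
    del (fun x => del (F x) m) l = del (fun y => del (fun x => F x y) l) m := by
  induction m generalizing F with
  | nil => simp [del, del_zero]
  | cons a m ih => simp only [del, del_sub, ih]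

theorem del_sign (k c : ℤ) (F : List α → V) (l) :
    del (fun x => pm (k * dm x + c) • F x) l = pm (k * (dm l - 1) + c) • del F l := by
  induction l generalizing F c with
  | nil => simp [del]
  | cons a l ih =>
    have h1 : ∀ x, k * dm (a :: x) + c = k * dm x + (k + c) := by
      intro x; rw [dm_cons]; ring
    have s2 : k * (dm (a :: l) - 1) + c = k * dm l + c := by rw [dm_cons]; ring
    have s3 : k * (dm l - 1) + (k + c) = k * dm l + c := by ring
    simp only [del, h1, ih, smul_sub, s2, s3]

theorem del_del (F : List α → V) (l) : del (del F) l = 0 := by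
  induction l generalizing F with
  | nil => simp [del]
  | cons a l ih =>
    simp only [del]
    have := ih (fun u => F (a :: u))
    rw [del_sub]
    have e : del (fun x => F x) l = del F l := rfl
    have e2 : del (fun x => del (fun u => F (a :: u)) x) l = 0 := this
    rw [e, e2]; simp

theorem del_coder (F : List α → List α → V) (l) :
    del (fun x => Sp x F) l =
      Sp l (fun x y => del (fun u => F u y) x + pm (dm x) • del (F x) y)
        - F [] l - pm (dm l) • F l [] := by
  induction l generalizing F with
  | nil => simp [del, Sp, dm, pm_neg, pm_one]
  | cons a l ih =>
    simp only [del, Sp, del_add, ih, Sp_add, Sp_sub, smul_sub, dm_cons, pm_add, pm_one]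
    have hd : pm (dm ([] : List α)) = -1 := by simp [dm, pm_neg, pm_one]
    simp only [hd, Sp_zsmul, mul_smul, neg_smul, smul_neg, one_smul, neg_neg, mul_neg, mul_one, Sp_neg]
    abel

end splits

section univ

variable (R : Type) [CommRing R]

/-- universal bisimplicial cochains -/
abbrev UM : Type := List ℕ → List ℕ → R

variable {R}

/-- total differential -/
def ud (f : UM R) : UM R := fun s t =>
  del (fun u => f u t) s + pm (dm s) • del (f s) t

/-- total cup product -/
def ucup (f g : UM R) : UM R := fun s t =>
  Sp s (fun s1 s2 => Sp t (fun t1 t2 => pm (dm t1 * dm s2) • (f s1 t1 * g s2 t2)))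

/-- homogeneous elements -/
def UHom (n : ℤ) : AddSubgroup (UM R) where
  carrier := {f | ∀ s t, ¬ (s ≠ [] ∧ t ≠ [] ∧ dm s + dm t = n) → f s t = 0}
  zero_mem' := by intro s t _; rfl
  add_mem' := by
    intro f g hf hg s t h
    simp [hf s t h, hg s t h]
  neg_mem' := by
    intro f hf s t h
    simp [hf s t h]

theorem mem_UHom {n : ℤ} {f : UM R} :
    f ∈ UHom n ↔ ∀ s t, ¬ (s ≠ [] ∧ t ≠ [] ∧ dm s + dm t = n) → f s t = 0 := Iff.rfl

theorem ud_add (f g : UM R) : ud (f + g) = ud f + ud g := by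
  funext s t
  have e : (f + g) s = fun y => f s y + g s y := rfl
  simp only [ud, Pi.add_apply, e, del_add, smul_add]
  abel

theorem ucup_add_left (f f' g : UM R) : ucup (f + f') g = ucup f g + ucup f' g := by
  funext s t
  simp only [ucup, Pi.add_apply, add_mul, smul_add, Sp_add]

theorem ucup_add_right (f g g' : UM R) : ucup f (g + g') = ucup f g + ucup f g' := by
  funext s t
  simp only [ucup, Pi.add_apply, mul_add, smul_add, Sp_add]

theorem ud_ud (f : UM R) : ud (ud f) = 0 := by
  funext s t
  have e : ud f s = fun t => del (fun u => f u t) s + pm (dm s) • del (f s) t := rfl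
  have h1 := del_sign 1 0 (fun u => del (f u) t) s
  simp only [one_mul, add_zero] at h1
  rw [ud, e]
  simp only [ud, del_add, del_zsmul, h1]
  have z1 : del (fun u => del (fun u => f u t) u) s = 0 := del_del _ _
  have z2 : del (fun u => del (f s) u) t = 0 := del_del _ _
  rw [z1, z2, del_swap]
  simp [pm_sub, pm_one]

theorem ucup_assoc (f g h : UM R) : ucup (ucup f g) h = ucup f (ucup g h) := by
  funext s t
  have e1 : ucup (ucup f g) h s t = Sp s (fun x s3 => Sp x (fun s1 s2 =>
      Sp t (fun y t3 => Sp y (fun t1 t2 =>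
        pm ((dm t1 + dm t2) * dm s3 + dm t1 * dm s2) • (f s1 t1 * g s2 t2 * h s3 t3))))) := by
    refine Sp_congr (fun x s3 _ _ _ _ _ => ?_)
    rw [Sp_swap]
    refine Sp_congr (fun y t3 _ _ _ _ hy => ?_)
    have := fun F => Sp_map (AddMonoidHom.mulRight (h s3 t3)) x F
    simp only [AddMonoidHom.coe_mulRight] at this
    rw [ucup, this, ← Sp_zsmul]
    refine Sp_congr (fun s1 s2 _ _ _ _ _ => ?_)
    have := fun F => Sp_map (AddMonoidHom.mulRight (h s3 t3)) y F
    simp only [AddMonoidHom.coe_mulRight] at this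
    rw [this, ← Sp_zsmul]
    refine Sp_congr (fun t1 t2 _ _ _ _ hh => ?_)
    rw [smul_mul_assoc, smul_smul, ← pm_add]
    congr 3
    simp only [dm] at *
    congr 1; linarith
  have e2 : ucup f (ucup g h) s t = Sp s (fun s1 x => Sp x (fun s2 s3 =>
      Sp t (fun t1 y => Sp y (fun t2 t3 =>
        pm ((dm t1 + dm t2) * dm s3 + dm t1 * dm s2) • (f s1 t1 * g s2 t2 * h s3 t3))))) := by
    refine Sp_congr (fun s1 x _ _ _ _ hx => ?_)
    rw [Sp_swap]
    refine Sp_congr (fun t1 y _ _ _ _ hy => ?_)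
    have := fun F => Sp_map (AddMonoidHom.mulLeft (f s1 t1)) x F
    simp only [AddMonoidHom.coe_mulLeft] at this
    rw [ucup, this, ← Sp_zsmul]
    refine Sp_congr (fun s2 s3 _ _ _ _ hx => ?_)
    have := fun F => Sp_map (AddMonoidHom.mulLeft (f s1 t1)) y F
    simp only [AddMonoidHom.coe_mulLeft] at this
    rw [this, ← Sp_zsmul]
    refine Sp_congr (fun t2 t3 _ _ _ _ hh => ?_)
    rw [mul_smul_comm, smul_smul, ← pm_add, mul_assoc]
    congr 2
    have : dm x = dm s2 + dm s3 := by simp only [dm] at *; linarith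
    rw [this]; ring
  rw [e1, e2, Sp_coassoc]
  refine Sp_congr (fun _ _ _ _ _ _ _ => Sp_congr (fun _ _ _ _ _ _ _ => ?_))
  rw [Sp_coassoc]

theorem UHom_nil_left {n : ℤ} {f : UM R} (hf : f ∈ UHom n) (t) : f [] t = 0 :=
  hf [] t (by simp)

theorem UHom_nil_right {n : ℤ} {f : UM R} (hf : f ∈ UHom n) (s) : f s [] = 0 :=
  hf s [] (by simp)

theorem ud_ucup {i j : ℤ} {f g : UM R} (hf : f ∈ UHom i) (hg : g ∈ UHom j) :
    ud (ucup f g) = ucup (ud f) g + pm i • ucup f (ud g) := by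
  funext s t
  have e1 : del (fun u => ucup f g u t) s = Sp s (fun s1 s2 => Sp t (fun t1 t2 =>
      pm (dm t1 * dm s2) • (del (fun u => f u t1) s1 * g s2 t2)
      + pm (dm s1) • pm (dm t1 * dm s2 - dm t1) • (f s1 t1 * del (fun u => g u t2) s2))) := by
    simp only [ucup]
    rw [del_coder]
    simp only [UHom_nil_left hf, UHom_nil_left hg, mul_zero, zero_mul, smul_zero, Sp_zero, sub_zero]
    refine Sp_congr (fun s1 s2 _ _ _ _ _ => ?_)
    rw [del_Sp, del_Sp, ← Sp_zsmul, ← Sp_add]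
    refine Sp_congr (fun t1 t2 _ _ _ _ _ => ?_)
    have h1 := del_map (AddMonoidHom.mulRight (g s2 t2)) (fun u => f u t1) s1
    have h2 := del_map (AddMonoidHom.mulLeft (f s1 t1)) (fun u => g u t2) s2
    simp only [AddMonoidHom.coe_mulLeft, AddMonoidHom.coe_mulRight] at h1 h2
    rw [del_zsmul, h1, h2]
    have h3 := del_sign (dm t1) 0 (fun u => f s1 t1 * g u t2) s2
    simp only [add_zero] at h3
    rw [h3, mul_sub, mul_one]
  have e2 : del (ucup f g s) t = Sp s (fun s1 s2 => Sp t (fun t1 t2 =>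
      pm (dm t1 * dm s2 - dm s2) • (del (f s1) t1 * g s2 t2)
      + pm (dm t1) • pm (dm t1 * dm s2) • (f s1 t1 * del (g s2) t2))) := by
    have e : ucup f g s = fun t => Sp s (fun s1 s2 => Sp t (fun t1 t2 =>
      pm (dm t1 * dm s2) • (f s1 t1 * g s2 t2))) := rfl
    rw [e, del_Sp]
    refine Sp_congr (fun s1 s2 _ _ _ _ _ => ?_)
    rw [del_coder]
    simp only [UHom_nil_right hf, UHom_nil_right hg, mul_zero, zero_mul, smul_zero, Sp_zero, sub_zero]
    refine Sp_congr (fun t1 t2 _ _ _ _ _ => ?_)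
    have h1 := del_map (AddMonoidHom.mulRight (g s2 t2)) (fun u => f s1 u) t1
    have h2 := del_map (AddMonoidHom.mulLeft (f s1 t1)) (g s2) t2
    simp only [AddMonoidHom.coe_mulLeft, AddMonoidHom.coe_mulRight] at h1 h2
    rw [del_zsmul, h2]
    have h3 := del_sign (dm s2) 0 (fun u => f s1 u * g s2 t2) t1
    simp only [add_zero] at h3
    have h4 : ∀ u : List ℕ, dm u * dm s2 = dm s2 * dm u := fun u => mul_comm _ _
    simp only [h4]
    rw [h3, ← h1, mul_sub, mul_one]
  rw [ud, e1, e2]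
  have e3 : (ucup (ud f) g + pm i • ucup f (ud g)) s t =
      ucup (ud f) g s t + pm i • ucup f (ud g) s t := rfl
  rw [e3, ucup, ucup, ← Sp_zsmul, ← Sp_zsmul, ← Sp_add, ← Sp_add]
  refine Sp_congr (fun s1 s2 _ _ _ _ hs => ?_)
  rw [← Sp_zsmul, ← Sp_zsmul, ← Sp_add, ← Sp_add]
  refine Sp_congr (fun t1 t2 h1 h2 _ _ ht => ?_)
  have hds : dm s = dm s1 + dm s2 := by simp only [dm] at *; linarith
  simp only [ud, hds, add_mul, mul_add, smul_add, smul_smul, smul_mul_assoc, mul_smul_comm, pm_add, pm_sub]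
  by_cases h : dm s1 + dm t1 = i
  · rw [← h, pm_add]
    rcases pm_cases (dm s1) with h1 | h1 <;> rcases pm_cases (dm s2) with h2 | h2 <;>
      rcases pm_cases (dm t1) with h3 | h3 <;> simp only [h1, h2, h3] <;> simp <;> abel
  · rw [hf s1 t1 (by tauto)]
    rcases pm_cases (dm s1) with h1 | h1 <;> rcases pm_cases (dm s2) with h2 | h2 <;>
       simp only [h1, h2] <;> simp

theorem ud_mem {i : ℤ} {f : UM R} (hf : f ∈ UHom i) : ud f ∈ UHom (i + 1) := by
  intro s t h
  rw [ud]
  have z1 : del (fun u => f u t) s = 0 := by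
    rw [← del_zero s]
    refine del_congr (fun x hx h1 => hf _ _ ?_)
    rintro ⟨h2, h3, h4⟩
    apply h
    refine ⟨?_, h3, ?_⟩
    · rintro rfl; simp at h1
    · simp only [dm] at *; omega
  have z2 : del (f s) t = 0 := by
    rw [← del_zero t]
    refine del_congr (fun x hx h1 => hf _ _ ?_)
    rintro ⟨h2, h3, h4⟩
    apply h
    refine ⟨h2, ?_, ?_⟩
    · rintro rfl; simp at h1
    · simp only [dm] at *; omega
  rw [z1, z2]; simp

theorem ucup_mem {i j : ℤ} {f g : UM R} (hf : f ∈ UHom i) (hg : g ∈ UHom j) :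
    ucup f g ∈ UHom (i + j) := by
  intro s t h
  rw [ucup, ← Sp_zero s]
  refine Sp_congr (fun s1 s2 a1 a2 a3 a4 hs => ?_)
  rw [← Sp_zero t]
  refine Sp_congr (fun t1 t2 b1 b2 b3 b4 ht => ?_)
  by_cases h1 : dm s1 + dm t1 = i
  · by_cases h2 : dm s2 + dm t2 = j
    · exfalso; apply h
      refine ⟨?_, ?_, ?_⟩
      · rintro rfl; exact a1 (by simpa using a3)
      · rintro rfl; exact b1 (by simpa using b3)
      · simp only [dm] at *; omega
    · rw [hg s2 t2 (by tauto)]; simp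
  · rw [hf s1 t1 (by tauto)]; simp

variable (R) in
/-- the universal graded differential algebra -/
def UG : GDA (UM R) where
  mul := AddMonoidHom.mk' (fun f => AddMonoidHom.mk' (ucup f) (ucup_add_right f))
    (fun f g => by ext h : 1; exact ucup_add_left f g h)
  d := AddMonoidHom.mk' ud ud_add
  Hom := UHom
  mul_mem := ucup_mem
  d_mem := ud_mem
  dd := fun _ => ud_ud _
  leib := ud_ucup
  assoc := fun _ _ _ => ucup_assoc _ _ _

@[simp] theorem UG_mul (f g : UM R) : (UG R).mul f g = ucup f g := rfl
@[simp] theorem UG_d (f : UM R) : (UG R).d f = ud f := rfl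
@[simp] theorem UG_Hom (n : ℤ) : (UG R).Hom n = UHom n := rfl

/-- the unit -/
def uone : UM R := fun s t => if s.length = 1 ∧ t.length = 1 then 1 else 0

theorem uone_mem : (uone : UM R) ∈ UHom 0 := by
  intro s t h
  rw [uone, if_neg]
  rintro ⟨h1, h2⟩
  apply h
  refine ⟨?_, ?_, ?_⟩
  · rintro rfl; simp at h1
  · rintro rfl; simp at h2
  · simp [dm, h1, h2]

theorem Sp_left {α V : Type*} [AddCommGroup V] (x : α) (s : List α) (F : List α → List α → V)
    (h : ∀ u v, u.length ≠ 1 → F u v = 0) : Sp (x :: s) F = F [x] (x :: s) := by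
  rw [Sp]
  have : Sp s (fun u v => F (x :: u) v) = Sp s (fun _ _ => 0) := by
    refine Sp_congr (fun u v hu _ _ _ _ => h _ _ ?_)
    simpa using hu
  rw [this, Sp_zero, add_zero]

theorem Sp_right {α V : Type*} [AddCommGroup V] (s : List α) (hs : s ≠ []) (F : List α → List α → V)
    (h : ∀ u v, v.length ≠ 1 → F u v = 0) : Sp s F = F s [s.getLast hs] := by
  induction s generalizing F with
  | nil => exact absurd rfl hs
  | cons x s ih =>
    cases s with
    | nil => simp [Sp]
    | cons y s =>
      rw [Sp, h _ _ (by simp), zero_add, ih (by simp) _ (fun u v hv => h _ _ hv)]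
      simp

theorem uone_ucup {n : ℤ} {f : UM R} (hf : f ∈ UHom n) : ucup uone f = f := by
  funext s t
  cases s with
  | nil => simp [ucup, Sp, UHom_nil_left hf]
  | cons x s =>
    cases t with
    | nil => simp [ucup, Sp, UHom_nil_right hf, Sp_zero]
    | cons y t =>
      rw [ucup, Sp_left, Sp_left]
      · simp [uone, dm, pm_zero]
      · intro u v hu
        simp [uone, hu]
      · intro u v hu
        simp [uone, hu, Sp_zero]

theorem ucup_uone {n : ℤ} {f : UM R} (hf : f ∈ UHom n) : ucup f uone = f := by
  funext s t
  by_cases hs : s = []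
  · subst hs; simp [ucup, Sp, UHom_nil_left hf]
  · by_cases ht : t = []
    · subst ht; simp [ucup, Sp, UHom_nil_right hf, Sp_zero]
    · rw [ucup, Sp_right s hs, Sp_right t ht]
      · simp [uone, dm, pm_zero]
      · intro u v hu
        simp [uone, hu]
      · intro u v hu
        simp [uone, hu, Sp_zero]

theorem ud_uone : ud (uone : UM R) = 0 := by
  have hm := ud_mem (uone_mem (R := R))
  funext s t
  by_cases h : s ≠ [] ∧ t ≠ [] ∧ dm s + dm t = 0 + 1
  · obtain ⟨h1, h2, h3⟩ := h
    match s, t, h1, h2 with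
    | [x], [y], _, _ => simp [dm] at h3
    | [x], [y, z], _, _ => simp [ud, del, uone]
    | [x, z], [y], _, _ => simp [ud, del, uone]
    | [x], y :: z :: w :: t, _, _ => simp [dm] at h3; omega
    | x :: z :: w :: t, [y], _, _ => simp [dm] at h3; omega
    | x :: z :: t, y :: w :: t', _, _ => simp [dm] at h3; omega
  · exact hm s t h

end univ
end MVH

end


noncomputable section
open scoped TensorProduct
set_option linter.unusedSectionVars false
set_option linter.unusedSimpArgs false
set_option linter.unusedVariables false
namespace MVH

section econstr

variable {R : Type} [CommRing R]

/-- contraction in one variable -/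
def h1 {V : Type*} [AddCommGroup V] (x : ℕ) (f : List ℕ → V) : List ℕ → V
  | [] => 0
  | z :: s => if z = x then 0 else f (x :: z :: s)

/-- contraction of universal cochains -/
def hs (x y : ℕ) (f : UM R) : UM R := fun s t =>
  h1 x (fun u => f u t) s + if s.length = 1 then h1 y (f [x]) t else 0

/-- tagged contraction -/
def hG (x y : ℕ) (a : ℤ × UM R) : ℤ × UM R := (a.1 - 1, hs x y a.2)

theorem h1_contract {V : Type*} [AddCommGroup V] (x : ℕ) (f : List ℕ → V) (s : List ℕ)
    (hs : s ≠ []) (h : x ∉ s ∨ ∃ r, s = x :: r ∧ x ∉ r) :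
    del (h1 x f) s + h1 x (del f) s = f s - if s.length = 1 then f [x] else 0 := by
  have key : ∀ (r : List ℕ) (g : List ℕ → V), x ∉ r → (∀ u, x ∉ u → u ≠ [] → g u = f (x :: u)) →
      g [] = 0 → r ≠ [] → del g r = del (fun u => f (x :: u)) r - if r.length = 1 then f [x] else 0 := by
    intro r g hx hg h0 hr
    match r, hr with
    | [z], _ => simp [del, h0]
    | z :: w :: r, _ =>
      have : del g (z :: w :: r) = del (fun u => f (x :: u)) (z :: w :: r) := by
        refine del_congr (fun u hu hl => hg u (fun h => hx (hu.subset h)) ?_)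
        rintro rfl; simp at hl
      rw [this]; simp
  rcases h with h | ⟨r, rfl, h⟩
  · cases s with
    | nil => exact absurd rfl hs
    | cons z s =>
      have hz : z ≠ x := by rintro rfl; simp at h
      rw [key (z :: s) (h1 x f) h _ rfl hs]
      · simp only [h1, hz, if_false]
        rw [show del f (x :: z :: s) = f (z :: s) - del (fun u => f (x :: u)) (z :: s) from rfl]
        abel
      · intro u hu hu0
        cases u with
        | nil => exact absurd rfl hu0
        | cons w u =>
          have : w ≠ x := by rintro rfl; simp at hu
          simp [h1, this]
  · have e : (fun u => h1 x f (x :: u)) = fun _ => 0 := by funext u; simp [h1]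
    rw [del, e, del_zero]
    cases r with
    | nil => simp [h1]
    | cons z r =>
      have hz : z ≠ x := by rintro rfl; simp at h
      simp [h1, hz]

theorem h1_zero {V : Type*} [AddCommGroup V] (x : ℕ) (s) : h1 x (fun _ => (0 : V)) s = 0 := by
  cases s <;> simp [h1]

theorem hs_mem {n : ℤ} {f : UM R} (hf : f ∈ UHom n) (x y) : hs x y f ∈ UHom (n - 1) := by
  intro s t h
  cases s with
  | nil => simp [hs, h1]
  | cons z s =>
    cases t with
    | nil => simp [hs, h1, UHom_nil_right hf]
    | cons w t =>
      simp only [hs, h1]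
      have e1 : f (x :: z :: s) (w :: t) = 0 := by
        apply hf
        rintro ⟨_, _, h3⟩
        apply h
        refine ⟨by simp, by simp, ?_⟩
        simp only [dm_cons] at *; linarith
      rw [e1, ite_self, zero_add]
      by_cases hs0 : s = []
      · subst hs0
        have e2 : f [x] (y :: w :: t) = 0 := by
          apply hf
          rintro ⟨_, _, h3⟩
          apply h
          refine ⟨by simp, by simp, ?_⟩
          simp only [dm_cons] at *; linarith
        rw [e2]; simp
      · rw [if_neg]
        simpa using hs0

theorem hs_hs (x y : ℕ) (f : UM R) : hs x y (hs x y f) = 0 := by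
  funext s t
  have e1 : h1 x (fun u => hs x y f u t) s = 0 := by
    cases s with
    | nil => rfl
    | cons z s => simp [h1, hs]
  have e2 : h1 y (hs x y f [x]) t = 0 := by
    cases t with
    | nil => rfl
    | cons z s => simp [h1, hs]
  rw [hs, e1, e2]; simp

theorem hs_uone (x y : ℕ) : hs x y (uone : UM R) = 0 := by
  funext s t
  have e1 : h1 x (fun u => uone u t) s = (0 : R) := by
    cases s with
    | nil => rfl
    | cons z s => simp [h1, uone]
  have e2 : h1 y (uone [x]) t = (0 : R) := by
    cases t with
    | nil => rfl
    | cons z s => simp [h1, uone]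
  rw [hs, e1, e2]; simp

theorem hs_contract (x y : ℕ) {n : ℤ} {f : UM R} (hf : f ∈ UHom n) (s t : List ℕ)
    (hs0 : x ∉ s ∨ ∃ r, s = x :: r ∧ x ∉ r) (ht0 : y ∉ t ∨ ∃ r, t = y :: r ∧ y ∉ r) :
    (ud (hs x y f) + hs x y (ud f)) s t = f s t - f [x] [y] * uone s t := by
  by_cases hs1 : s = []
  · subst hs1
    have a1 := UHom_nil_left (ud_mem (hs_mem hf x y)) t
    have a2 := UHom_nil_left (hs_mem (ud_mem hf) x y) t
    simp only [Pi.add_apply, a1, a2, UHom_nil_left hf, uone]; simp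
  by_cases ht1 : t = []
  · subst ht1
    have a1 := UHom_nil_right (ud_mem (hs_mem hf x y)) s
    have a2 := UHom_nil_right (hs_mem (ud_mem hf) x y) s
    simp only [Pi.add_apply, a1, a2, UHom_nil_right hf, uone]; simp
  have c1 := h1_contract x (fun u => f u t) s hs1 hs0
  have c2 := h1_contract y (f [x]) t ht1 ht0
  -- the four pieces of the left-hand side
  have p1 : del (fun u => hs x y f u t) s = del (h1 x (fun u => f u t)) s := by
    have : (fun u => hs x y f u t) = fun u => h1 x (fun u => f u t) u +
      (if u.length = 1 then h1 y (f [x]) t else 0) := rfl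
    rw [this, del_add]
    have z : del (fun u : List ℕ => if u.length = 1 then h1 y (f [x]) t else 0) s = 0 := by
      match s, hs1 with
      | [a], _ => simp [del]
      | [a, b], _ => simp [del]
      | a :: b :: c :: s, _ =>
        refine (del_congr (fun u _ hu => ?_)).trans (del_zero (a :: b :: c :: s))
        simp only [List.length_cons] at hu
        have hu' : ¬ u.length = 1 := by omega
        exact if_neg hu'
    rw [z, add_zero]
  have p2 : del (hs x y f s) t = h1 x (fun u => del (f u) t) s +
      if s.length = 1 then del (h1 y (f [x])) t else 0 := by
    have : hs x y f s = fun t => h1 x (fun u => f u t) s +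
      (if s.length = 1 then h1 y (f [x]) t else 0) := rfl
    rw [this, del_add]
    congr 1
    · cases s with
      | nil => simp [h1, del_zero]
      | cons z s =>
        by_cases hz : z = x
        · simp [h1, hz, del_zero]
        · simp [h1, hz]
    · split_ifs
      · rfl
      · exact del_zero t
  have p3 : h1 x (fun u => ud f u t) s = h1 x (del (fun u => f u t)) s
      - pm (dm s) • h1 x (fun u => del (f u) t) s := by
    cases s with
    | nil => simp [h1]
    | cons z s =>
      by_cases hz : z = x
      · simp [h1, hz]
      · simp only [h1, hz, if_false, ud, dm_cons, pm_add, pm_one]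
        simp [sub_eq_add_neg]
  have p4 : h1 y (ud f [x]) t = h1 y (del (f [x])) t := by
    cases t with
    | nil => rfl
    | cons z t =>
      by_cases hz : z = y
      · simp [h1, hz]
      · simp [h1, hz, ud, dm, pm_zero, del, UHom_nil_left hf]
  have e : (ud (hs x y f) + hs x y (ud f)) s t = (del (fun u => hs x y f u t) s +
    pm (dm s) • del (hs x y f s) t) + (h1 x (fun u => ud f u t) s +
      if s.length = 1 then h1 y (ud f [x]) t else 0) := rfl
  rw [e, p1, p2, p3, p4]
  by_cases hl : s.length = 1
  · simp only [hl, if_true, uone, true_and] at c1 ⊢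
    have : pm (dm s) = 1 := by simp [dm, hl, pm_zero]
    rw [this]
    have c1' : del (h1 x (fun u => f u t)) s = f s t - f [x] t - h1 x (del (fun u => f u t)) s := by
      rw [← c1]; abel
    have c2' : del (h1 y (f [x])) t = f [x] t - (if t.length = 1 then f [x] [y] else 0) -
        h1 y (del (f [x])) t := by rw [← c2]; abel
    rw [c1', c2']
    split_ifs <;> simp <;> abel
  · simp only [hl, if_false, uone, false_and, mul_zero, sub_zero, add_zero] at c1 ⊢
    rw [← c1]; abel

/-- the recursive solution operator -/
def Phi (Rr : ℤ × UM R → UM R) : ℤ × UM R → List ℕ → List ℕ → R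
  | a, x :: s, y :: t => Phi Rr (hG x y a) s (y :: t) + pm s.length • Phi Rr (hG x y a) (x :: s) t
      + Rr (hG x y a) (x :: s) (y :: t)
  | _, [], _ => 0
  | _, _ :: _, [] => 0
termination_by _ s t => s.length + t.length

theorem Phi_nil_left (Rr : ℤ × UM R → UM R) (a t) : Phi Rr a [] t = 0 := by rw [Phi]
theorem Phi_nil_right (Rr : ℤ × UM R → UM R) (a s) : Phi Rr a s [] = 0 := by
  cases s <;> rw [Phi]
theorem Phi_cons (Rr : ℤ × UM R → UM R) (a x s y t) : Phi Rr a (x :: s) (y :: t) =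
    Phi Rr (hG x y a) s (y :: t) + pm s.length • Phi Rr (hG x y a) (x :: s) t
      + Rr (hG x y a) (x :: s) (y :: t) := by rw [Phi]

/-- induction principle on pairs of lists -/
theorem pair_induction {P : List ℕ → List ℕ → Prop}
    (h0 : ∀ t, P [] t) (h0' : ∀ s, P s [])
    (hc : ∀ x s y t, P s (y :: t) → P (x :: s) t → P (x :: s) (y :: t)) : ∀ s t, P s t := by
  intro s
  induction s with
  | nil => exact h0
  | cons x s ih =>
    intro t
    induction t with
    | nil => exact h0' _
    | cons y t ih' => exact hc x s y t (ih _) ih'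

/-- the inhomogeneous part of the recursion -/
def RST (F : List (ℤ × UM R) → List (ℤ × UM R) → UM R) (l m : List (ℤ × UM R)) : UM R :=
  mrg (UG R) (fun x => F x m) l + pm (bd l) • mrg (UG R) (F l) m - cup1 (UG R) F F l m

/-- The twisting cochain, with fuel. -/
def EN : ℕ → List (ℤ × UM R) → List (ℤ × UM R) → UM R
  | _, [], [] => 0
  | _, [], [b] => b.2
  | _, [], _ :: _ :: _ => 0
  | _, [a], [] => a.2
  | _, _ :: _ :: _, [] => 0
  | 0, _ :: _, _ :: _ => 0
  | k + 1, a :: l, b :: m => Phi (fun a' => RST (EN k) (a' :: l) (b :: m)) a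

/-- one-sided values -/
def al : List (ℤ × UM R) → UM R
  | [b] => b.2
  | _ => 0

theorem EN_nil_left (k) (m : List (ℤ × UM R)) : EN k [] m = al m := by
  match m with
  | [] => simp [EN, al]
  | [b] => simp [EN, al]
  | _ :: _ :: _ => simp [EN, al]

theorem EN_nil_right (k) (m : List (ℤ × UM R)) : EN k m [] = al m := by
  match m with
  | [] => simp [EN, al]
  | [b] => simp [EN, al]
  | _ :: _ :: _ => simp [EN, al]

theorem EN_zero (a b : ℤ × UM R) (l m) : EN 0 (a :: l) (b :: m) = 0 := by
  simp [EN]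

theorem EN_succ (k) (a b : ℤ × UM R) (l m) :
    EN (k + 1) (a :: l) (b :: m) = Phi (fun a' => RST (EN k) (a' :: l) (b :: m)) a := by
  rw [EN]

/-- The twisting cochain. -/
def EE (l m : List (ℤ × UM R)) : UM R := EN (l.length + m.length) l m

theorem mrg_congr {V : Type*} [AddCommGroup V] {M : Type*} [AddCommGroup M] (𝒢 : GDA M)
    {F F' : List (ℤ × M) → V} (l : List (ℤ × M))
    (h : ∀ x, x.length + 1 = l.length → F x = F' x) : mrg 𝒢 F l = mrg 𝒢 F' l := by
  induction l generalizing F F' with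
  | nil => rfl
  | cons a l ih =>
    simp only [mrg]
    rw [ih (F := fun x => F (a :: x)) (F' := fun x => F' (a :: x)) (fun x hx => h _ (by simp [hx]))]
    cases l with
    | nil => rfl
    | cons b l => simp only [mh]; rw [h _ (by simp)]

theorem RST_congr {F F' : List (ℤ × UM R) → List (ℤ × UM R) → UM R} (l m : List (ℤ × UM R))
    (h0 : F [] [] = 0) (h0' : F' [] [] = 0)
    (h : ∀ l' m', l'.length + m'.length < l.length + m.length → F l' m' = F' l' m') :
    RST F l m = RST F' l m := by
  rw [RST, RST]
  congr 1
  · congr 1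
    · exact mrg_congr _ _ (fun x hx => h _ _ (by omega))
    · congr 1
      exact mrg_congr _ _ (fun x hx => h _ _ (by omega))
  · refine SS_congr (fun l1 l2 m1 m2 hl hm => ?_)
    have el : l1.length + l2.length = l.length := by rw [← hl]; simp
    have em : m1.length + m2.length = m.length := by rw [← hm]; simp
    by_cases c1 : l1.length + m1.length = 0
    · have : l1 = [] := List.eq_nil_of_length_eq_zero (by omega)
      have : m1 = [] := List.eq_nil_of_length_eq_zero (by omega)
      subst l1 m1
      rw [h0, h0']; simp
    · by_cases c2 : l2.length + m2.length = 0
      · have : l2 = [] := List.eq_nil_of_length_eq_zero (by omega)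
        have : m2 = [] := List.eq_nil_of_length_eq_zero (by omega)
        subst l2 m2
        rw [h0, h0', map_zero, map_zero]
      · rw [h l1 m1 (by omega), h l2 m2 (by omega)]

theorem EN_nil_nil (k) : EN k ([] : List (ℤ × UM R)) [] = 0 := by simp [EN]

theorem Phi_congr {Rr Rr' : ℤ × UM R → UM R} (h : ∀ a, Rr a = Rr' a) (a) : Phi Rr a = Phi Rr' a := by
  have : Rr = Rr' := funext h
  rw [this]

theorem EN_stable : ∀ (k k' : ℕ) (l m : List (ℤ × UM R)), l.length + m.length ≤ k →
    l.length + m.length ≤ k' → EN k l m = EN k' l m := by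
  intro k
  induction k with
  | zero =>
    intro k' l m h _
    have : l = [] := List.eq_nil_of_length_eq_zero (by omega)
    have : m = [] := List.eq_nil_of_length_eq_zero (by omega)
    subst l m
    rw [EN_nil_nil, EN_nil_nil]
  | succ k ih =>
    intro k' l m h h'
    cases l with
    | nil => rw [EN_nil_left, EN_nil_left]
    | cons a l =>
      cases m with
      | nil => rw [EN_nil_right, EN_nil_right]
      | cons b m =>
        cases k' with
        | zero => simp at h'
        | succ k' =>
          rw [EN_succ, EN_succ]
          refine Phi_congr (fun a' => ?_) a
          refine RST_congr _ _ (EN_nil_nil _) (EN_nil_nil _) (fun l' m' hl => ?_)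
          simp at hl h h'
          exact ih k' l' m' (by omega) (by omega)

theorem EE_nil_left (m : List (ℤ × UM R)) : EE [] m = al m := EN_nil_left _ _
theorem EE_nil_right (m : List (ℤ × UM R)) : EE m [] = al m := EN_nil_right _ _
theorem EE_nil_nil : EE ([] : List (ℤ × UM R)) [] = 0 := EN_nil_nil _

theorem EE_cons (a b : ℤ × UM R) (l m) :
    EE (a :: l) (b :: m) = Phi (fun a' => RST EE (a' :: l) (b :: m)) a := by
  rw [EE, show (a :: l).length + (b :: m).length = (l.length + m.length + 1) + 1 by simp; omega,
    EN_succ]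
  refine Phi_congr (fun a' => ?_) a
  refine RST_congr _ _ (EN_nil_nil _) (EN_nil_nil _) (fun l' m' hl => ?_)
  simp at hl
  exact EN_stable _ _ _ _ (by omega) (by omega)

theorem EE_eq_EN (l m : List (ℤ × UM R)) : EE l m = EN (l.length + m.length) l m := rfl

end econstr
end MVH

end


noncomputable section
open scoped TensorProduct
set_option linter.unusedSectionVars false
set_option linter.unusedSimpArgs false
set_option linter.unusedVariables false
namespace MVH

section multilin

variable {R : Type} [CommRing R] {M : Type*} [AddCommGroup M] [Module R M] (𝒢 : GDA M)
variable {V : Type*} [AddCommGroup V] [Module R V]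

/-- linear compatibility of a graded differential algebra -/
structure RLin (R : Type) [CommRing R] {M : Type*} [AddCommGroup M] [Module R M] (𝒢 : GDA M) :
    Prop where
  smul_mul : ∀ (r : R) a b, 𝒢.mul (r • a) b = r • 𝒢.mul a b
  mul_smul : ∀ (r : R) a b, 𝒢.mul a (r • b) = r • 𝒢.mul a b
  d_smul : ∀ (r : R) a, 𝒢.d (r • a) = r • 𝒢.d a

/-- `l''` is the linear combination of `l` and `l'` in one entry -/
inductive Lin3 (r s : R) : List (ℤ × M) → List (ℤ × M) → List (ℤ × M) → Prop
  | head (n : ℤ) (a b : M) (l : List (ℤ × M)) :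
      Lin3 r s ((n, a) :: l) ((n, b) :: l) ((n, r • a + s • b) :: l)
  | tail (g : ℤ × M) {l l' l'' : List (ℤ × M)} : Lin3 r s l l' l'' →
      Lin3 r s (g :: l) (g :: l') (g :: l'')

variable (R) in
/-- multilinearity with fixed tags -/
def ML (F : List (ℤ × M) → V) : Prop :=
  ∀ (r s : R) (l l' l'' : List (ℤ × M)), Lin3 r s l l' l'' → F l'' = r • F l + s • F l'

theorem Lin3.bd_eq {r s : R} {l l' l'' : List (ℤ × M)} (h : Lin3 r s l l' l'') :
    bd l = bd l'' ∧ bd l' = bd l'' := by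
  induction h with
  | head => simp
  | tail g _ ih => simp [ih.1, ih.2]

theorem Lin3.append {r s : R} (x : List (ℤ × M)) (n : ℤ) (a b : M) (l) :
    Lin3 r s (x ++ (n, a) :: l) (x ++ (n, b) :: l) (x ++ (n, r • a + s • b) :: l) := by
  induction x with
  | nil => exact Lin3.head n a b l
  | cons g x ih => exact Lin3.tail g ih

theorem ML.cons {F : List (ℤ × M) → V} (h : ML R F) (g) : ML R (fun x => F (g :: x)) :=
  fun r s l l' l'' hl => h r s _ _ _ (Lin3.tail g hl)

theorem ML.MA {F : List (ℤ × M) → V} (h : ML R F) : MA F := by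
  intro l1 l2 n a b
  have := h 1 1 _ _ _ (Lin3.append l1 n a b l2)
  simpa using this

theorem ML.head {F : List (ℤ × M) → V} (h : ML R F) (r s : R) (n a b l) :
    F ((n, r • a + s • b) :: l) = r • F ((n, a) :: l) + s • F ((n, b) :: l) :=
  h r s _ _ _ (Lin3.head n a b l)

theorem ML.sign {F : List (ℤ × M) → V} (h : ML R F) (φ : ℤ → ℤ) :
    ML R (fun x => pm (φ (bd x)) • F x) := by
  intro r s l l' l'' hl
  obtain ⟨h1, h2⟩ := hl.bd_eq
  simp only [h1, h2, h r s _ _ _ hl, smul_add]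
  rw [smul_comm, smul_comm (pm _) s]

theorem ML.zsmul {F : List (ℤ × M) → V} (h : ML R F) (c : ℤ) : ML R (fun x => c • F x) := by
  intro r s l l' l'' hl
  simp only [h r s _ _ _ hl, smul_add]
  rw [smul_comm, smul_comm c s]

theorem ML.add {F F' : List (ℤ × M) → V} (h : ML R F) (h' : ML R F') :
    ML R (fun x => F x + F' x) := by
  intro r s l l' l'' hl
  simp only [h r s _ _ _ hl, h' r s _ _ _ hl, smul_add]; abel

theorem ML.sub {F F' : List (ℤ × M) → V} (h : ML R F) (h' : ML R F') :
    ML R (fun x => F x - F' x) := by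
  intro r s l l' l'' hl
  simp only [h r s _ _ _ hl, h' r s _ _ _ hl, smul_sub]; abel

theorem ML.map {W : Type*} [AddCommGroup W] [Module R W] {F : List (ℤ × M) → V} (h : ML R F)
    (φ : V →ₗ[R] W) : ML R (fun x => φ (F x)) := by
  intro r s l l' l'' hl
  simp only [h r s _ _ _ hl, map_add, map_smul]

theorem S_lin (r s : R) (l : List (ℤ × M)) (K K' : List (ℤ × M) → List (ℤ × M) → V) :
    S l (fun x y => r • K x y + s • K' x y) = r • S l K + s • S l K' := by
  have e1 : S l (fun x y => r • K x y) = r • S l K :=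
    (S_map (DistribSMul.toAddMonoidHom V r) l K).symm
  have e2 : S l (fun x y => s • K' x y) = s • S l K' :=
    (S_map (DistribSMul.toAddMonoidHom V s) l K').symm
  rw [S_add, e1, e2]

theorem mh_lin (r s : R) (K K' : List (ℤ × M) → V) (a l) :
    mh 𝒢 (fun x => r • K x + s • K' x) a l = r • mh 𝒢 K a l + s • mh 𝒢 K' a l := by
  cases l <;> simp [mh]

theorem mrg_lin (r s : R) (l : List (ℤ × M)) (K K' : List (ℤ × M) → V) :
    mrg 𝒢 (fun x => r • K x + s • K' x) l = r • mrg 𝒢 K l + s • mrg 𝒢 K' l := by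
  induction l generalizing K K' with
  | nil => simp [mrg]
  | cons a l ih =>
    simp only [mrg, ih, mh_lin, smul_add]
    rw [smul_comm _ r, smul_comm _ s, smul_comm (pm _) r (mh _ _ _ _), smul_comm (pm _) s (mh _ _ _ _)]
    abel

theorem dint_lin (r s : R) (l : List (ℤ × M)) (K K' : List (ℤ × M) → V) :
    dint 𝒢 (fun x => r • K x + s • K' x) l = r • dint 𝒢 K l + s • dint 𝒢 K' l := by
  induction l generalizing K K' with
  | nil => simp [dint]
  | cons a l ih =>
    simp only [dint, ih, smul_add, smul_neg, neg_add]
    rw [smul_comm _ r, smul_comm _ s]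
    abel

theorem ML_S {K : List (ℤ × M) → List (ℤ × M) → List (ℤ × M) → V} {m : List (ℤ × M)}
    (h : ∀ u v, ML R (fun x => K x u v)) : ML R (fun x => S m (K x)) := by
  intro r s l l' l'' hl
  have : K l'' = fun u v => r • K l u v + s • K l' u v := by
    funext u v; exact h u v r s _ _ _ hl
  simp only [this, S_lin]

theorem ML_mrg {K : List (ℤ × M) → List (ℤ × M) → V} {m : List (ℤ × M)}
    (h : ∀ y, ML R (fun x => K x y)) : ML R (fun x => mrg 𝒢 (K x) m) := by
  intro r s l l' l'' hl
  have : K l'' = fun u => r • K l u + s • K l' u := by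
    funext u; exact h u r s _ _ _ hl
  simp only [this, mrg_lin]

theorem ML_dint {K : List (ℤ × M) → List (ℤ × M) → V} {m : List (ℤ × M)}
    (h : ∀ y, ML R (fun x => K x y)) : ML R (fun x => dint 𝒢 (K x) m) := by
  intro r s l l' l'' hl
  have : K l'' = fun u => r • K l u + s • K l' u := by
    funext u; exact h u r s _ _ _ hl
  simp only [this, dint_lin]

theorem S_ML {K : List (ℤ × M) → List (ℤ × M) → V}
    (h1 : ∀ y, ML R (fun x => K x y)) (h2 : ∀ x, ML R (K x)) : ML R (fun l => S l K) := by
  intro r s l l' l'' hl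
  induction hl generalizing K with
  | head n a b l =>
    simp only [S]
    have e : (fun x y => K ((n, r • a + s • b) :: x) y) =
        fun x y => r • K ((n, a) :: x) y + s • K ((n, b) :: x) y := by
      funext x y; exact (h1 y).head r s n a b x
    rw [(h2 []).head, e, S_lin]
    simp only [smul_add]; abel
  | tail g hl ih =>
    simp only [S]
    have e := ih (K := fun x y => K (g :: x) y) (fun y => (h1 y).cons g) (fun x => h2 _)
    simp only at e
    rw [h2 [] r s _ _ _ (Lin3.tail g hl), e]
    simp only [smul_add]; abel

theorem mh_ML (𝓁 : RLin R 𝒢) {F : List (ℤ × M) → V} (h : ML R F) (g : ℤ × M) :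
    ML R (mh 𝒢 F g) := by
  intro r s l l' l'' hl
  cases hl with
  | head n a b l =>
    simp only [mh, mG, map_add, 𝓁.mul_smul]
    exact h.head _ _ _ _ _ _
  | tail g' hl => exact h _ _ _ _ _ (Lin3.tail _ hl)

theorem mrg_ML (𝓁 : RLin R 𝒢) {F : List (ℤ × M) → V} (h : ML R F) : ML R (mrg 𝒢 F) := by
  intro r s l l' l'' hl
  induction hl generalizing F with
  | head n a b l =>
    simp only [mrg]
    have e : (fun x => F ((n, r • a + s • b) :: x)) =
        fun x => r • F ((n, a) :: x) + s • F ((n, b) :: x) := by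
      funext x; exact h.head r s n a b x
    have e2 : mh 𝒢 F (n, r • a + s • b) l = r • mh 𝒢 F (n, a) l + s • mh 𝒢 F (n, b) l := by
      cases l with
      | nil => simp [mh]
      | cons c l =>
        simp only [mh, mG, map_add, AddMonoidHom.add_apply, 𝓁.smul_mul]
        exact h.head _ _ _ _ _ _
    rw [e, mrg_lin, e2]
    simp only [smul_add]
    rw [smul_comm _ r, smul_comm _ s, smul_comm (pm _) r (mh _ _ _ _), smul_comm (pm _) s (mh _ _ _ _)]
    abel
  | tail g hl ih =>
    simp only [mrg]
    rw [ih (h.cons g), mh_ML 𝒢 𝓁 h g r s _ _ _ hl]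
    simp only [smul_add]
    rw [smul_comm _ r, smul_comm _ s, smul_comm (pm _) r (mh _ _ _ _), smul_comm (pm _) s (mh _ _ _ _)]
    abel

theorem dint_ML (𝓁 : RLin R 𝒢) {F : List (ℤ × M) → V} (h : ML R F) : ML R (dint 𝒢 F) := by
  intro r s l l' l'' hl
  induction hl generalizing F with
  | head n a b l =>
    simp only [dint]
    have e : (fun x => F ((n, r • a + s • b) :: x)) =
        fun x => r • F ((n, a) :: x) + s • F ((n, b) :: x) := by
      funext x; exact h.head r s n a b x
    have e2 : F (dG 𝒢 (n, r • a + s • b) :: l) = r • F (dG 𝒢 (n, a) :: l)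
        + s • F (dG 𝒢 (n, b) :: l) := by
      simp only [dG, map_add, 𝓁.d_smul]
      exact h.head _ _ _ _ _ _
    rw [e, dint_lin, e2]
    simp only [smul_add, smul_neg, neg_add]
    rw [smul_comm _ r, smul_comm _ s]
    abel
  | tail g hl ih =>
    simp only [dint]
    have e := h r s _ _ _ (Lin3.tail (dG 𝒢 g) hl)
    rw [ih (h.cons g), e]
    simp only [smul_add, smul_neg, neg_add]
    rw [smul_comm _ r, smul_comm _ s]
    abel

theorem D1_ML (𝓁 : RLin R 𝒢) {F : List (ℤ × M) → V} (h : ML R F) : ML R (D1 𝒢 F) := by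
  have : D1 𝒢 F = fun l => dint 𝒢 F l + mrg 𝒢 F l := by funext l; exact D1_eq 𝒢 F l
  rw [this]
  exact (dint_ML 𝒢 𝓁 h).add (mrg_ML 𝒢 𝓁 h)

theorem ML_D1 {K : List (ℤ × M) → List (ℤ × M) → V} {m : List (ℤ × M)}
    (h : ∀ y, ML R (fun x => K x y)) : ML R (fun x => D1 𝒢 (K x) m) := by
  have : (fun x => D1 𝒢 (K x) m) = fun l => dint 𝒢 (K l) m + mrg 𝒢 (K l) m := by
    funext l; exact D1_eq 𝒢 (K l) m
  rw [this]
  exact (ML_dint 𝒢 h).add (ML_mrg 𝒢 h)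

theorem ML.mul_left (𝓁 : RLin R 𝒢) {F : List (ℤ × M) → M} (h : ML R F) (b : M) :
    ML R (fun x => 𝒢.mul (F x) b) := by
  intro r s l l' l'' hl
  simp only [h r s _ _ _ hl, map_add, AddMonoidHom.add_apply, 𝓁.smul_mul]

theorem ML.mul_right (𝓁 : RLin R 𝒢) {F : List (ℤ × M) → M} (h : ML R F) (b : M) :
    ML R (fun x => 𝒢.mul b (F x)) := by
  intro r s l l' l'' hl
  simp only [h r s _ _ _ hl, map_add, 𝓁.mul_smul]

theorem cup1_ML_left (𝓁 : RLin R 𝒢) {f g : List (ℤ × M) → List (ℤ × M) → M}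
    (hf : ∀ y, ML R (fun x => f x y)) (hg : ∀ y, ML R (fun x => g x y)) (m) :
    ML R (fun l => cup1 𝒢 f g l m) := by
  refine S_ML (fun y => ?_) (fun x => ?_)
  · refine ML_S (fun u v => ?_)
    exact (((hf u).mul_left 𝒢 𝓁 _).sign (fun t => t + bd u + bd y * bd u))
  · refine ML_S (fun u v => ?_)
    exact (((hg v).mul_right 𝒢 𝓁 _).sign (fun t => bd x + bd u + t * bd u))

theorem cup1_ML_right (𝓁 : RLin R 𝒢) {f g : List (ℤ × M) → List (ℤ × M) → M}
    (hf : ∀ x, ML R (f x)) (hg : ∀ x, ML R (g x)) (l) :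
    ML R (cup1 𝒢 f g l) := by
  have : cup1 𝒢 f g l = fun m => S m (fun m1 m2 => S l (fun l1 l2 =>
      pm (bd l1 + bd m1 + bd l2 * bd m1) • 𝒢.mul (f l1 m1) (g l2 m2))) := by
    funext m
    rw [cup1, SS, S_swap]
  rw [this]
  refine S_ML (fun y => ?_) (fun x => ?_)
  · refine ML_S (fun u v => ?_)
    exact (((hf u).mul_left 𝒢 𝓁 _).sign (fun t => bd u + t + bd v * t))
  · refine ML_S (fun u v => ?_)
    exact (((hg v).mul_right 𝒢 𝓁 _).zsmul (pm (bd u + bd x + bd v * bd x)))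

end multilin

section emul

variable {R : Type} [CommRing R]

theorem Sp_smul {α V : Type*} [AddCommGroup V] [Module R V] (r : R) (l : List α)
    (F : List α → List α → V) : Sp l (fun x y => r • F x y) = r • Sp l F :=
  (Sp_map (DistribSMul.toAddMonoidHom V r) l F).symm

theorem del_smul {α V : Type*} [AddCommGroup V] [Module R V] (r : R) (l : List α)
    (F : List α → V) : del (fun x => r • F x) l = r • del F l :=
  (del_map (DistribSMul.toAddMonoidHom V r) F l).symm

theorem UG_lin : RLin R (UG R) where
  smul_mul := by
    intro r a b
    funext s t
    simp only [UG_mul, Pi.smul_apply, ucup, ← Sp_smul]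
    refine Sp_congr (fun _ _ _ _ _ _ _ => Sp_congr (fun _ _ _ _ _ _ _ => ?_))
    rw [smul_mul_assoc, smul_comm]
  mul_smul := by
    intro r a b
    funext s t
    simp only [UG_mul, Pi.smul_apply, ucup, ← Sp_smul]
    refine Sp_congr (fun _ _ _ _ _ _ _ => Sp_congr (fun _ _ _ _ _ _ _ => ?_))
    rw [mul_smul_comm, smul_comm]
  d_smul := by
    intro r a
    funext s t
    have e : (r • a) s = fun t => r • a s t := rfl
    simp only [UG_d, Pi.smul_apply, ud, e, del_smul, smul_add]
    rw [smul_comm]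

theorem RST_ML_left {F : List (ℤ × UM R) → List (ℤ × UM R) → UM R}
    (h1 : ∀ y, ML R (fun x => F x y)) (m) : ML R (fun l => RST F l m) :=
  ((mrg_ML _ UG_lin (h1 m)).add ((ML_mrg _ h1).sign (fun t => t))).sub
    (cup1_ML_left _ UG_lin h1 h1 m)

theorem RST_ML_right {F : List (ℤ × UM R) → List (ℤ × UM R) → UM R}
    (h2 : ∀ x, ML R (F x)) (l) : ML R (RST F l) :=
  ((ML_mrg (UG R) (K := fun m x => F x m) (m := l) h2).add
    ((mrg_ML _ UG_lin (h2 l)).zsmul (pm (bd l)))).sub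
    (cup1_ML_right _ UG_lin h2 h2 l)

theorem h1_lin (r r' : R) (x : ℕ) (f g : List ℕ → R) (s) :
    h1 x (fun u => r * f u + r' * g u) s = r * h1 x f s + r' * h1 x g s := by
  cases s with
  | nil => simp [h1]
  | cons z s => simp only [h1]; split_ifs <;> simp

theorem hs_lin (r r' : R) (x y : ℕ) (f g : UM R) :
    hs x y (r • f + r' • g) = r • hs x y f + r' • hs x y g := by
  funext s t
  have e : (r • f + r' • g) [x] = fun u => r * f [x] u + r' * g [x] u := rfl
  simp only [hs, Pi.add_apply, Pi.smul_apply, e, h1_lin, smul_eq_mul]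
  split_ifs <;> ring

theorem Phi_lin {Rr : ℤ × UM R → UM R} (r r' : R)
    (h : ∀ n a b, Rr (n, r • a + r' • b) = r • Rr (n, a) + r' • Rr (n, b)) (s t) (n a b) :
    Phi Rr (n, r • a + r' • b) s t = r * Phi Rr (n, a) s t + r' * Phi Rr (n, b) s t := by
  revert n a b
  refine pair_induction (P := fun s t => ∀ n a b, Phi Rr (n, r • a + r' • b) s t =
    r * Phi Rr (n, a) s t + r' * Phi Rr (n, b) s t) ?_ ?_ ?_ s t
  · intro t n a b; simp [Phi_nil_left]
  · intro s n a b; simp [Phi_nil_right]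
  · intro x s y t i1 i2 n a b
    simp only [Phi_cons, hG, hs_lin, i1, i2, h, smul_add, zsmul_eq_mul, Pi.add_apply, Pi.smul_apply, smul_eq_mul]
    ring

theorem Phi_lin2 {Rr Rr' Rr'' : ℤ × UM R → UM R} (r r' : R)
    (h : ∀ a, Rr'' a = r • Rr a + r' • Rr' a) (s t) (a) :
    Phi Rr'' a s t = r * Phi Rr a s t + r' * Phi Rr' a s t := by
  revert a
  refine pair_induction (P := fun s t => ∀ a, Phi Rr'' a s t =
    r * Phi Rr a s t + r' * Phi Rr' a s t) ?_ ?_ ?_ s t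
  · intro t a; simp [Phi_nil_left]
  · intro s a; simp [Phi_nil_right]
  · intro x s y t i1 i2 a
    simp only [Phi_cons, i1, i2, h, smul_add, zsmul_eq_mul, Pi.add_apply, Pi.smul_apply, smul_eq_mul]
    ring

theorem al_ML : ML R (al : List (ℤ × UM R) → UM R) := by
  intro r s l l' l'' hl
  cases hl with
  | head n a b l => cases l <;> simp [al]
  | tail g hl => cases hl <;> simp [al]

theorem EN_ML (k : ℕ) : (∀ y : List (ℤ × UM R), ML R (fun x => EN k x y)) ∧
    (∀ x : List (ℤ × UM R), ML R (EN k x)) := by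
  induction k with
  | zero =>
    constructor
    · intro y r s l l' l'' hl
      cases y with
      | nil => simp only [EN_nil_right]; exact al_ML _ _ _ _ _ hl
      | cons b y => cases hl <;> simp [EN_zero]
    · intro x r s l l' l'' hl
      cases x with
      | nil => simp only [EN_nil_left]; exact al_ML _ _ _ _ _ hl
      | cons b y => cases hl <;> simp [EN_zero]
  | succ k ih =>
    constructor
    · intro y r s l l' l'' hl
      cases y with
      | nil => simp only [EN_nil_right]; exact al_ML _ _ _ _ _ hl
      | cons b y =>
        have hR := RST_ML_left ih.1 (b :: y)
        cases hl with
        | head n a b l =>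
          simp only [EN_succ]
          funext u v
          refine Phi_lin r s (fun n a b => ?_) u v n a b
          exact hR.head r s n a b l
        | tail g hl =>
          simp only [EN_succ]
          funext u v
          refine Phi_lin2 r s (fun a => ?_) u v g
          exact hR r s _ _ _ (Lin3.tail a hl)
    · intro x r s l l' l'' hl
      cases x with
      | nil => simp only [EN_nil_left]; exact al_ML _ _ _ _ _ hl
      | cons b y =>
        have hR := fun a => RST_ML_right ih.2 (a :: y)
        cases hl with
        | head n a' b' l =>
          simp only [EN_succ]
          funext u v
          exact Phi_lin2 r s (fun a => (hR a).head r s n a' b' l) u v b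
        | tail g hl =>
          simp only [EN_succ]
          funext u v
          exact Phi_lin2 r s (fun a => hR a r s _ _ _ (Lin3.tail _ hl)) u v b

theorem Lin3.length_eq {M : Type*} [AddCommGroup M] [Module R M] {r s : R}
    {l l' l'' : List (ℤ × M)} (h : Lin3 r s l l' l'') :
    l.length = l''.length ∧ l'.length = l''.length := by
  induction h with
  | head => simp
  | tail g _ ih => simp [ih.1, ih.2]

theorem EE_ML_left (y : List (ℤ × UM R)) : ML R (fun x => EE x y) := by
  intro r s l l' l'' hl
  obtain ⟨e1, e2⟩ := hl.length_eq
  simp only [EE, e1, e2]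
  exact (EN_ML _).1 y r s _ _ _ hl

theorem EE_ML_right (x : List (ℤ × UM R)) : ML R (EE x) := by
  intro r s l l' l'' hl
  obtain ⟨e1, e2⟩ := hl.length_eq
  simp only [EE, e1, e2]
  exact (EN_ML _).2 x r s _ _ _ hl

end emul
end MVH

end


noncomputable section
open scoped TensorProduct
set_option linter.unusedSectionVars false
set_option linter.unusedSimpArgs false
set_option linter.unusedVariables false
namespace MVH

section param

variable {M : Type*} [AddCommGroup M] {M' : Type*} [AddCommGroup M'] {𝒢 : GDA M} {𝒢' : GDA M'}
variable {V : Type*} [AddCommGroup V] {W : Type*} [AddCommGroup W]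

/-- a graded relation compatible with the operations -/
structure GRel (𝒢 : GDA M) (𝒢' : GDA M') where
  Q : ℤ → AddSubgroup (M × M')
  mul : ∀ {i j a a' b b'}, (a, a') ∈ Q i → (b, b') ∈ Q j →
    (𝒢.mul a b, 𝒢'.mul a' b') ∈ Q (i + j)
  d : ∀ {i a a'}, (a, a') ∈ Q i → (𝒢.d a, 𝒢'.d a') ∈ Q (i + 1)

/-- related words -/
def GRel.RL (ρ : GRel 𝒢 𝒢') : List (ℤ × M) → List (ℤ × M') → Prop :=
  List.Forall₂ (fun a a' => a.1 = a'.1 ∧ (a.2, a'.2) ∈ ρ.Q a.1)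

theorem GRel.RL.bd_eq {ρ : GRel 𝒢 𝒢'} {l l'} (h : ρ.RL l l') : bd l = bd l' := by
  induction h with
  | nil => rfl
  | cons h _ ih => simp [ih, h.1]

theorem pair_zsmul_mem {P : AddSubgroup (V × W)} {v : V} {w : W} (h : (v, w) ∈ P) (c : ℤ) :
    (c • v, c • w) ∈ P := by
  have := P.zsmul_mem h c
  simpa using this

theorem pair_add_mem {P : AddSubgroup (V × W)} {v v' : V} {w w' : W} (h : (v, w) ∈ P)
    (h' : (v', w') ∈ P) : (v + v', w + w') ∈ P := by
  have := P.add_mem h h'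
  simpa using this

theorem pair_sub_mem {P : AddSubgroup (V × W)} {v v' : V} {w w' : W} (h : (v, w) ∈ P)
    (h' : (v', w') ∈ P) : (v - v', w - w') ∈ P := by
  have := P.sub_mem h h'
  simpa using this

theorem pair_neg_mem {P : AddSubgroup (V × W)} {v : V} {w : W} (h : (v, w) ∈ P) :
    (-v, -w) ∈ P := by
  have := P.neg_mem h
  simpa using this

theorem S_rel (ρ : GRel 𝒢 𝒢') (P : AddSubgroup (V × W)) {l l'} (h : ρ.RL l l')
    {F : List (ℤ × M) → List (ℤ × M) → V} {F' : List (ℤ × M') → List (ℤ × M') → W}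
    (hF : ∀ x x' y y', ρ.RL x x' → ρ.RL y y' → x ++ y = l → (F x y, F' x' y') ∈ P) :
    (S l F, S l' F') ∈ P := by
  induction h generalizing F F' with
  | nil => exact hF [] [] [] [] .nil .nil rfl
  | cons h h2 ih =>
    refine pair_add_mem (hF _ _ _ _ .nil (.cons h h2) rfl) (ih ?_)
    intro x x' y y' hx hy hxy
    exact hF _ _ _ _ (.cons h hx) hy (by simp [hxy])

theorem mh_rel (ρ : GRel 𝒢 𝒢') (P : AddSubgroup (V × W)) {l l'} (h : ρ.RL l l') {a a'}
    (ha : a.1 = a'.1 ∧ (a.2, a'.2) ∈ ρ.Q a.1)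
    {F : List (ℤ × M) → V} {F' : List (ℤ × M') → W}
    (hF : ∀ x x', ρ.RL x x' → bd x = bd (a :: l) + 1 → x.length + 1 = (a :: l).length →
      (F x, F' x') ∈ P) :
    (mh 𝒢 F a l, mh 𝒢' F' a' l') ∈ P := by
  cases h with
  | nil => exact P.zero_mem
  | cons h h2 =>
    refine hF _ _ (.cons ⟨?_, ?_⟩ h2) ?_ ?_
    · simp [mG, ha.1, h.1]
    · exact ρ.mul ha.2 h.2
    · simp [mG]; ring
    · simp

theorem mrg_rel (ρ : GRel 𝒢 𝒢') (P : AddSubgroup (V × W)) {l l'} (h : ρ.RL l l')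
    {F : List (ℤ × M) → V} {F' : List (ℤ × M') → W}
    (hF : ∀ x x', ρ.RL x x' → bd x = bd l + 1 → x.length + 1 = l.length → (F x, F' x') ∈ P) :
    (mrg 𝒢 F l, mrg 𝒢' F' l') ∈ P := by
  induction h generalizing F F' with
  | nil => exact P.zero_mem
  | cons h h2 ih =>
    simp only [mrg, ← h.1]
    refine pair_add_mem (pair_zsmul_mem (ih ?_) _) (pair_zsmul_mem (mh_rel ρ P h2 h hF) _)
    intro x x' hx hb hl
    refine hF _ _ (.cons h hx) ?_ ?_
    · simp [hb]; ring
    · simp [hl]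

theorem dint_rel (ρ : GRel 𝒢 𝒢') (P : AddSubgroup (V × W)) {l l'} (h : ρ.RL l l')
    {F : List (ℤ × M) → V} {F' : List (ℤ × M') → W}
    (hF : ∀ x x', ρ.RL x x' → bd x = bd l + 1 → x.length = l.length → (F x, F' x') ∈ P) :
    (dint 𝒢 F l, dint 𝒢' F' l') ∈ P := by
  induction h generalizing F F' with
  | nil => exact P.zero_mem
  | cons h h2 ih =>
    simp only [dint, ← h.1]
    refine pair_add_mem (pair_neg_mem (hF _ _ (.cons ⟨?_, ρ.d h.2⟩ h2) ?_ ?_))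
      (pair_zsmul_mem (ih ?_) _)
    · simp [dG, h.1]
    · simp [dG]; ring
    · simp
    intro x x' hx hb hl
    refine hF _ _ (.cons h hx) ?_ ?_
    · simp [hb]; ring
    · simp [hl]

theorem D1_rel (ρ : GRel 𝒢 𝒢') (P : AddSubgroup (V × W)) {l l'} (h : ρ.RL l l')
    {F : List (ℤ × M) → V} {F' : List (ℤ × M') → W}
    (hF : ∀ x x', ρ.RL x x' → bd x = bd l + 1 → (F x, F' x') ∈ P) :
    (D1 𝒢 F l, D1 𝒢' F' l') ∈ P := by
  rw [D1_eq, D1_eq]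
  exact pair_add_mem (dint_rel ρ P h (fun x x' a b c => hF x x' a b))
    (mrg_rel ρ P h (fun x x' a b c => hF x x' a b))

theorem cup1_rel (ρ : GRel 𝒢 𝒢') {l l' m m'} (h : ρ.RL l l') (hm : ρ.RL m m')
    {f : List (ℤ × M) → List (ℤ × M) → M} {f' : List (ℤ × M') → List (ℤ × M') → M'}
    (hF : ∀ x x' y y', ρ.RL x x' → ρ.RL y y' → (f x y, f' x' y') ∈ ρ.Q (bd x + bd y + 1)) :
    (cup1 𝒢 f f l m, cup1 𝒢' f' f' l' m') ∈ ρ.Q (bd l + bd m + 2) := by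
  refine S_rel ρ _ h (fun x x' y y' hx hy hxy => S_rel ρ _ hm (fun u u' v v' hu hv huv => ?_))
  simp only [← hx.bd_eq, ← hy.bd_eq, ← hu.bd_eq]
  refine pair_zsmul_mem ?_ _
  have := ρ.mul (hF x x' u u' hx hu) (hF y y' v v' hy hv)
  rw [← hxy, ← huv, bd_append, bd_append]
  convert this using 2; ring

theorem DD_rel (ρ : GRel 𝒢 𝒢') {l l' m m'} (h : ρ.RL l l') (hm : ρ.RL m m')
    {f : List (ℤ × M) → List (ℤ × M) → M} {f' : List (ℤ × M') → List (ℤ × M') → M'}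
    (hF : ∀ x x' y y', ρ.RL x x' → ρ.RL y y' → (f x y, f' x' y') ∈ ρ.Q (bd x + bd y + 1)) :
    (DD 𝒢 f l m, DD 𝒢' f' l' m') ∈ ρ.Q (bd l + bd m + 2) := by
  simp only [DD, ← h.bd_eq]
  refine pair_add_mem (D1_rel ρ _ h ?_) (pair_zsmul_mem (D1_rel ρ _ hm ?_) _)
  · intro x x' hx hb
    have := hF x x' m m' hx hm
    rw [hb] at this
    convert this using 2; ring
  · intro x x' hx hb
    have := hF l l' x x' h hx
    rw [hb] at this
    convert this using 2; ring

theorem Th_rel (ρ : GRel 𝒢 𝒢') {l l' m m'} (h : ρ.RL l l') (hm : ρ.RL m m')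
    {f : List (ℤ × M) → List (ℤ × M) → M} {f' : List (ℤ × M') → List (ℤ × M') → M'}
    (hF : ∀ x x' y y', ρ.RL x x' → ρ.RL y y' → (f x y, f' x' y') ∈ ρ.Q (bd x + bd y + 1)) :
    (Th 𝒢 f l m, Th 𝒢' f' l' m') ∈ ρ.Q (bd l + bd m + 2) := by
  refine pair_sub_mem (pair_add_mem ?_ (DD_rel ρ h hm hF)) (cup1_rel ρ h hm hF)
  have := ρ.d (hF _ _ _ _ h hm)
  convert this using 2; ring

theorem RST_rel {R R' : Type} [CommRing R] [CommRing R'] (ρ : GRel (UG R) (UG R')) {l l' m m'}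
    (h : ρ.RL l l') (hm : ρ.RL m m')
    {f : List (ℤ × UM R) → List (ℤ × UM R) → UM R}
    {f' : List (ℤ × UM R') → List (ℤ × UM R') → UM R'}
    (hF : ∀ x x' y y', ρ.RL x x' → ρ.RL y y' → (f x y, f' x' y') ∈ ρ.Q (bd x + bd y + 1)) :
    (RST f l m, RST f' l' m') ∈ ρ.Q (bd l + bd m + 2) := by
  simp only [RST, ← h.bd_eq]
  refine pair_sub_mem (pair_add_mem (mrg_rel ρ _ h ?_) (pair_zsmul_mem (mrg_rel ρ _ hm ?_) _))
    (cup1_rel ρ h hm hF)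
  · intro x x' hx hb _
    have := hF x x' m m' hx hm
    rw [hb] at this
    convert this using 2; ring
  · intro x x' hx hb _
    have := hF l l' x x' h hx
    rw [hb] at this
    convert this using 2; ring

end param

section degree
variable {R : Type} [CommRing R]

/-- the relation of being homogeneous -/
def hrel {M : Type*} [AddCommGroup M] (𝒢 : GDA M) : GRel 𝒢 𝒢 where
  Q n := (𝒢.Hom n).prod ⊤
  mul := by
    intro i j a a' b b' h h'
    exact ⟨𝒢.mul_mem h.1 h'.1, trivial⟩
  d := by
    intro i a a' h
    exact ⟨𝒢.d_mem h.1, trivial⟩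

theorem hrel_of {M : Type*} [AddCommGroup M] {𝒢 : GDA M} {l : List (ℤ × M)} (h : HomL 𝒢 l) :
    (hrel 𝒢).RL l l := by
  rw [GRel.RL, List.forall₂_same]
  intro x hx
  exact ⟨rfl, h x hx, trivial⟩

theorem HomL_of {M : Type*} [AddCommGroup M] {𝒢 : GDA M} {l l' : List (ℤ × M)}
    (h : (hrel 𝒢).RL l l') : HomL 𝒢 l := by
  induction h with
  | nil => intro x hx; simp at hx
  | cons h _ ih =>
    intro x hx
    rcases List.mem_cons.1 hx with rfl | hx
    · exact h.2.1
    · exact ih x hx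

theorem al_mem {l : List (ℤ × UM R)} (h : HomL (UG R) l) : al l ∈ UHom (R := R) (bd l + 1) := by
  match l with
  | [] => exact AddSubgroup.zero_mem _
  | [b] =>
    have := h b (by simp)
    simpa [al] using this
  | _ :: _ :: _ => exact AddSubgroup.zero_mem _

theorem Phi_deg {Rr : ℤ × UM R → UM R} {c : ℤ} (h : ∀ a, a.2 ∈ UHom a.1 → Rr a ∈ UHom (a.1 + c))
    {s t : List ℕ} (a : ℤ × UM R) (ha : a.2 ∈ UHom a.1)
    (hst : ¬ (s ≠ [] ∧ t ≠ [] ∧ dm s + dm t = a.1 + c - 1)) : Phi Rr a s t = 0 := by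
  revert a
  refine pair_induction (P := fun s t => ∀ a : ℤ × UM R, a.2 ∈ UHom a.1 →
    (¬ (s ≠ [] ∧ t ≠ [] ∧ dm s + dm t = a.1 + c - 1)) → Phi Rr a s t = 0) ?_ ?_ ?_ s t
  · intro t a _ _; exact Phi_nil_left _ _ _
  · intro t a _ _; exact Phi_nil_right _ _ _
  · intro x s y t i1 i2 a ha hst
    have hne : ¬ (dm (x :: s) + dm (y :: t) = a.1 + c - 1) := fun h => hst ⟨by simp, by simp, h⟩
    have hm := hs_mem ha x y
    rw [Phi_cons, i1 (hG x y a) hm, i2 (hG x y a) hm, h (hG x y a) hm]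
    · simp
    · rintro ⟨_, _, h3⟩; apply hne; simp only [hG] at *; linarith
    · rintro ⟨_, _, h3⟩; apply hne; simp only [hG, dm_cons] at *; linarith
    · rintro ⟨_, _, h3⟩; apply hne; simp only [hG, dm_cons] at *; linarith

theorem EN_mem (k : ℕ) : ∀ l m : List (ℤ × UM R), HomL (UG R) l → HomL (UG R) m →
    EN k l m ∈ UHom (R := R) (bd l + bd m + 1) := by
  induction k with
  | zero =>
    intro l m hl hm
    cases l with
    | nil => rw [EN_nil_left]; simpa using al_mem hm
    | cons a l =>
      cases m with
      | nil => rw [EN_nil_right]; simpa using al_mem hl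
      | cons b m => rw [EN_zero]; exact AddSubgroup.zero_mem _
  | succ k ih =>
    intro l m hl hm
    cases l with
    | nil => rw [EN_nil_left]; simpa using al_mem hm
    | cons a l =>
      cases m with
      | nil => rw [EN_nil_right]; simpa using al_mem hl
      | cons b m =>
        rw [EN_succ]
        intro s t hst
        refine Phi_deg (c := bd l + bd (b :: m) + 1) ?_ a (hl a (by simp)) ?_
        · intro a' ha'
          have hl' : HomL (UG R) (a' :: l) := by
            intro x hx
            rcases List.mem_cons.1 hx with rfl | hx
            · exact ha'
            · exact hl x (by simp [hx])
          have := RST_rel (hrel (UG R)) (hrel_of hl') (hrel_of hm) (f := EN k) (f' := EN k)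
            (fun x x' y y' hx hy => ⟨ih x y (HomL_of hx) (HomL_of hy), trivial⟩)
          have h2 : RST (EN k) (a' :: l) (b :: m) ∈ UHom (bd (a' :: l) + bd (b :: m) + 2) := this.1
          have e : bd (a' :: l) + bd (b :: m) + 2 = a'.1 + (bd l + bd (b :: m) + 1) := by
            simp only [bd_cons]; ring
          rwa [e] at h2
        · rintro ⟨q1, q2, q3⟩
          exact hst ⟨q1, q2, by rw [q3]; simp only [bd_cons]; ring⟩

theorem EE_mem {l m : List (ℤ × UM R)} (hl : HomL (UG R) l) (hm : HomL (UG R) m) :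
    EE l m ∈ UHom (R := R) (bd l + bd m + 1) := EN_mem _ _ _ hl hm

end degree
end MVH

end


noncomputable section
open scoped TensorProduct
set_option linter.unusedSectionVars false
set_option linter.unusedSimpArgs false
set_option linter.unusedVariables false
namespace MVH

section local_
variable {R : Type} [CommRing R] {V : Type*} [AddCommGroup V]

theorem Sp_relabel (θ : ℕ → ℕ) (s : List ℕ) (F : List ℕ → List ℕ → V) :
    Sp (s.map θ) F = Sp s (fun x y => F (x.map θ) (y.map θ)) := by
  induction s generalizing F with
  | nil => rfl
  | cons x s ih => simp only [List.map_cons, Sp, ih, List.map_nil]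

theorem del_relabel (θ : ℕ → ℕ) (s : List ℕ) (F : List ℕ → V) :
    del F (s.map θ) = del (fun x => F (x.map θ)) s := by
  induction s generalizing F with
  | nil => rfl
  | cons x s ih => simp only [List.map_cons, del, ih]

theorem dm_map (θ : ℕ → ℕ) (s : List ℕ) : dm (s.map θ) = dm s := by simp [dm]

/-- local agreement of cochains under relabelling -/
def Loc (θ θ' : ℕ → ℕ) (s t : List ℕ) (f f' : UM R) : Prop :=
  ∀ s' t', s'.Sublist s → t'.Sublist t → f s' t' = f' (s'.map θ) (t'.map θ')

theorem Loc.ucup {θ θ' s t} {f f' g g' : UM R} (h : Loc θ θ' s t f f') (h' : Loc θ θ' s t g g') :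
    Loc θ θ' s t (ucup f g) (ucup f' g') := by
  intro s' t' hs ht
  simp only [MVH.ucup, Sp_relabel, dm_map]
  refine Sp_congr (fun x y _ _ hx hy _ => Sp_congr (fun u v _ _ hu hv _ => ?_))
  rw [h x u (hx.trans hs) (hu.trans ht), h' y v (hy.trans hs) (hv.trans ht)]

theorem Loc.ud {θ θ' s t} {f f' : UM R} (h : Loc θ θ' s t f f') :
    Loc θ θ' s t (ud f) (ud f') := by
  intro s' t' hs ht
  simp only [MVH.ud, del_relabel, dm_map]
  congr 1
  · exact del_congr (fun x hx _ => h x t' (hx.trans hs) ht)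
  · congr 1
    exact del_congr (fun x hx _ => h s' x hs (hx.trans ht))

theorem Loc.mono {θ θ' s t s1 t1} {f f' : UM R} (h : Loc θ θ' s t f f') (hs : s1.Sublist s)
    (ht : t1.Sublist t) : Loc θ θ' s1 t1 f f' :=
  fun s' t' h1 h2 => h s' t' (h1.trans hs) (h2.trans ht)

/-- local agreement as a graded relation -/
def locrel (R : Type) [CommRing R] (θ θ' : ℕ → ℕ) (s t : List ℕ) : GRel (UG R) (UG R) where
  Q _ := { carrier := {p | Loc θ θ' s t p.1 p.2}
           zero_mem' := fun _ _ _ _ => rfl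
           add_mem' := by
            intro a b ha hb s' t' h1 h2
            simp only [Prod.fst_add, Prod.snd_add, Pi.add_apply, ha s' t' h1 h2, hb s' t' h1 h2]
           neg_mem' := by
            intro a ha s' t' h1 h2
            simp only [Prod.fst_neg, Prod.snd_neg, Pi.neg_apply, ha s' t' h1 h2] }
  mul := fun h h' => Loc.ucup h h'
  d := fun h => Loc.ud h

theorem locrel_mem {θ θ' s t n} {f f' : UM R} :
    (f, f') ∈ (locrel R θ θ' s t).Q n ↔ Loc θ θ' s t f f' := Iff.rfl

theorem Loc.hs {θ θ' x y s t} {f f' : UM R} (h : Loc θ θ' (x :: s) (y :: t) f f')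
    (hθ : ∀ z ∈ x :: s, θ z = θ x → z = x) (hθ' : ∀ z ∈ y :: t, θ' z = θ' y → z = y) :
    Loc θ θ' (x :: s) (y :: t) (hs x y f) (hs (θ x) (θ' y) f') := by
  have sub : ∀ (x z : ℕ) (s s' : List ℕ), z ≠ x → (z :: s').Sublist (x :: s) →
      (x :: z :: s').Sublist (x :: s) := by
    intro x z s s' hz h
    cases h with
    | cons _ h => exact h.cons_cons _
    | cons_cons _ h => exact absurd rfl hz
  intro s' t' hs ht
  simp only [MVH.hs, List.length_map]
  congr 1
  · cases s' with
    | nil => rfl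
    | cons z s' =>
      simp only [h1, List.map_cons]
      by_cases hz : z = x
      · simp [hz]
      · have : ¬ θ z = θ x := fun e => hz (hθ z (hs.subset (by simp)) e)
        simp only [hz, this, if_false]
        exact h _ _ (sub x z s s' hz hs) ht
  · congr 1
    cases t' with
    | nil => rfl
    | cons z t' =>
      simp only [h1, List.map_cons]
      by_cases hz : z = y
      · simp [hz]
      · have : ¬ θ' z = θ' y := fun e => hz (hθ' z (ht.subset (by simp)) e)
        simp only [hz, this, if_false]
        exact h _ _ (List.Sublist.cons_cons x (List.nil_sublist s)) (sub y z t t' hz ht)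

theorem locrel_mono {θ θ' s t s1 t1} (hs : s1.Sublist s) (ht : t1.Sublist t) {l l'}
    (h : (locrel R θ θ' s t).RL l l') : (locrel R θ θ' s1 t1).RL l l' :=
  List.Forall₂.imp (fun a b h => ⟨h.1, h.2.mono hs ht⟩) h

theorem Phi_loc {θ θ'} {Rr Rr' : ℤ × UM R → UM R} {s t : List ℕ}
    (hi : Set.InjOn θ {z | z ∈ s}) (hi' : Set.InjOn θ' {z | z ∈ t})
    (h : ∀ s' t', s'.Sublist s → t'.Sublist t → ∀ n a a', Loc θ θ' s' t' a a' →
      Rr (n, a) s' t' = Rr' (n, a') (s'.map θ) (t'.map θ')) (n : ℤ) (a a' : UM R)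
    (ha : Loc θ θ' s t a a') :
    Phi Rr (n, a) s t = Phi Rr' (n, a') (s.map θ) (t.map θ') := by
  revert n a a' hi hi' h
  refine pair_induction (P := fun s t => Set.InjOn θ {z | z ∈ s} → Set.InjOn θ' {z | z ∈ t} →
    (∀ s' t', s'.Sublist s → t'.Sublist t → ∀ n a a', Loc θ θ' s' t' a a' →
      Rr (n, a) s' t' = Rr' (n, a') (s'.map θ) (t'.map θ')) → ∀ n a a', Loc θ θ' s t a a' →
    Phi Rr (n, a) s t = Phi Rr' (n, a') (s.map θ) (t.map θ')) ?_ ?_ ?_ s t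
  · intros; simp [Phi_nil_left]
  · intros; simp [Phi_nil_right]
  · intro x s y t i1 i2 hi hi' h n a a' ha
    have hh : Loc θ θ' (x :: s) (y :: t) (hs x y a) (hs (θ x) (θ' y) a') :=
      ha.hs (fun z hz e => hi hz (by simp) e) (fun z hz e => hi' hz (by simp) e)
    have sx : s.Sublist (x :: s) := List.sublist_cons_self x s
    have sy : t.Sublist (y :: t) := List.sublist_cons_self y t
    simp only [List.map_cons, Phi_cons, hG, List.length_map]
    congr 1
    · congr 1
      · exact i1 (hi.mono sx.subset) hi' (fun s' t' h1 h2 => h s' t' (h1.trans sx) h2) _ _ _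
          (hh.mono sx (List.Sublist.refl _))
      · congr 1
        exact i2 hi (hi'.mono sy.subset) (fun s' t' h1 h2 => h s' t' h1 (h2.trans sy)) _ _ _
          (hh.mono (List.Sublist.refl _) sy)
    · exact h _ _ (List.Sublist.refl _) (List.Sublist.refl _) _ _ _ hh

theorem al_loc {θ θ' s t} {l l' : List (ℤ × UM R)} (h : (locrel R θ θ' s t).RL l l') :
    Loc θ θ' s t (al l) (al l') := by
  cases h with
  | nil => exact fun _ _ _ _ => rfl
  | cons h h2 =>
    cases h2 with
    | nil => exact h.2
    | cons => exact fun _ _ _ _ => rfl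

theorem EN_loc (k : ℕ) : ∀ (θ θ' : ℕ → ℕ) (s t : List ℕ), Set.InjOn θ {z | z ∈ s} →
    Set.InjOn θ' {z | z ∈ t} → ∀ l l' m m' : List (ℤ × UM R), (locrel R θ θ' s t).RL l l' →
    (locrel R θ θ' s t).RL m m' → Loc θ θ' s t (EN k l m) (EN k l' m') := by
  induction k with
  | zero =>
    intro θ θ' s t hi hi' l l' m m' hl hm
    cases hl with
    | nil => rw [EN_nil_left, EN_nil_left]; exact al_loc hm
    | cons h1 h2 =>
      cases hm with
      | nil => rw [EN_nil_right, EN_nil_right]; exact al_loc (.cons h1 h2)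
      | cons h3 h4 => rw [EN_zero, EN_zero]; exact fun _ _ _ _ => rfl
  | succ k ih =>
    intro θ θ' s t hi hi' l l' m m' hl hm
    cases hl with
    | nil => rw [EN_nil_left, EN_nil_left]; exact al_loc hm
    | @cons a a' l l' h1 h2 =>
      cases hm with
      | nil => rw [EN_nil_right, EN_nil_right]; exact al_loc (.cons h1 h2)
      | @cons b b' m m' h3 h4 =>
        intro s1 t1 hs1 ht1
        rw [EN_succ, EN_succ]
        have ea : a = (a.1, a.2) := rfl
        have ea' : a' = (a.1, a'.2) := by rw [h1.1]
        rw [ea, ea']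
        refine Phi_loc (hi.mono hs1.subset) (hi'.mono ht1.subset) ?_ _ _ _ (h1.2.mono hs1 ht1)
        intro s2 t2 hs2 ht2 n c c' hc
        have q1 := hs2.trans hs1
        have q2 := ht2.trans ht1
        have := RST_rel (locrel R θ θ' s2 t2) (l := (n, c) :: l) (l' := (n, c') :: l')
          (m := b :: m) (m' := b' :: m') (f := EN k) (f' := EN k)
          (.cons ⟨rfl, hc⟩ (locrel_mono q1 q2 h2)) (locrel_mono q1 q2 (.cons h3 h4))
          (fun x x' y y' hx hy => ih θ θ' s2 t2 (hi.mono q1.subset) (hi'.mono q2.subset) _ _ _ _ hx hy)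
        exact this _ _ (List.Sublist.refl _) (List.Sublist.refl _)

theorem EE_loc {θ θ' : ℕ → ℕ} {s t : List ℕ} (hi : Set.InjOn θ {z | z ∈ s})
    (hi' : Set.InjOn θ' {z | z ∈ t}) {l l' m m' : List (ℤ × UM R)}
    (hl : (locrel R θ θ' s t).RL l l')
    (hm : (locrel R θ θ' s t).RL m m') : Loc θ θ' s t (EE l m) (EE l' m') := by
  have e1 := List.Forall₂.length_eq hl
  have e2 := List.Forall₂.length_eq hm
  rw [EE, EE, e1, e2]
  exact EN_loc _ _ _ _ _ hi hi' _ _ _ _ hl hm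

theorem Th_loc {θ θ' : ℕ → ℕ} {s t : List ℕ} (hi : Set.InjOn θ {z | z ∈ s})
    (hi' : Set.InjOn θ' {z | z ∈ t}) {l l' m m' : List (ℤ × UM R)}
    (hl : (locrel R θ θ' s t).RL l l')
    (hm : (locrel R θ θ' s t).RL m m') : Loc θ θ' s t (Th (UG R) EE l m) (Th (UG R) EE l' m') :=
  Th_rel (locrel R θ θ' s t) hl hm (fun x x' y y' hx hy => EE_loc hi hi' hx hy)

end local_
end MVH

end


noncomputable section
open scoped TensorProduct
set_option linter.unusedSectionVars false
set_option linter.unusedSimpArgs false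
set_option linter.unusedVariables false
namespace MVH

section unit_
variable {R : Type} [CommRing R] {V : Type*} [AddCommGroup V]

theorem S_left {M : Type*} [AddCommGroup M] {l : List (ℤ × M)}
    {K : List (ℤ × M) → List (ℤ × M) → V}
    (h : ∀ x y, x ++ y = l → x ≠ [] → K x y = 0) : S l K = K [] l := by
  cases l with
  | nil => rfl
  | cons a l =>
    simp only [S]
    have : S l (fun x y => K (a :: x) y) = S l (fun _ _ => 0) :=
      S_congr (fun x y hxy => h _ _ (by simp [hxy]) (by simp))
    rw [this, S_zero, add_zero]

theorem S_right {M : Type*} [AddCommGroup M] {l : List (ℤ × M)}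
    {K : List (ℤ × M) → List (ℤ × M) → V}
    (h : ∀ x y, x ++ y = l → y ≠ [] → K x y = 0) : S l K = K l [] := by
  induction l generalizing K with
  | nil => rfl
  | cons a l ih =>
    simp only [S]
    rw [h [] (a :: l) rfl (by simp), zero_add]
    exact ih (K := fun x y => K (a :: x) y) (fun x y hxy => h _ _ (by simp [hxy]))

theorem S_unit {M : Type*} [AddCommGroup M] (u : ℤ × M) (l1 l2 : List (ℤ × M))
    {K : List (ℤ × M) → List (ℤ × M) → V}
    (h : ∀ x y, x ++ y = l1 ++ u :: l2 → (u ∈ x → x ≠ [u] → K x y = 0) ∧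
      (u ∈ y → y ≠ [u] → K x y = 0)) :
    S (l1 ++ u :: l2) K = (if l1 = [] then K [u] l2 else 0) + if l2 = [] then K l1 [u] else 0 := by
  induction l1 generalizing K with
  | nil =>
    simp only [List.nil_append, S, if_true]
    have e : S l2 (fun x y => K (u :: x) y) = K [u] l2 := by
      refine S_left (K := fun x y => K (u :: x) y) (fun x y hxy hx => ?_)
      exact (h (u :: x) y (by simp [hxy])).1 (by simp) (by simp [hx])
    rw [e]
    by_cases h2 : l2 = []
    · subst h2; simp [add_comm]
    · rw [(h [] (u :: l2) rfl).2 (by simp) (by simp [h2])]; simp [h2]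
  | cons a l1 ih =>
    simp only [List.cons_append, S]
    rw [(h [] (a :: (l1 ++ u :: l2)) rfl).2 (by simp) (by simp)]
    rw [ih (K := fun x y => K (a :: x) y) (fun x y hxy => ⟨fun hu hx => ?_, fun hu hy => ?_⟩)]
    · have e : (if l1 = [] then K (a :: [u]) l2 else 0) = 0 := by
        split_ifs with h1
        · subst h1
          exact (h [a, u] l2 (by simp)).1 (by simp) (by simp)
        · rfl
      rw [e]; simp
    · exact (h (a :: x) y (by simp [hxy])).1 (by simp [hu]) (by
        rintro e
        have : x = [] := by simpa using (List.cons.inj e).2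
        simp [this] at hu)
    · exact (h (a :: x) y (by simp [hxy])).2 hu hy

/-- the tagged unit -/
def ut : ℤ × UM R := (0, uone)

theorem mG_ut_left {b : ℤ × UM R} (hb : b.2 ∈ UHom b.1) : mG (UG R) ut b = b := by
  have := uone_ucup hb
  simp only [mG, ut, UG_mul, zero_add, this]

theorem mG_ut_right {b : ℤ × UM R} (hb : b.2 ∈ UHom b.1) : mG (UG R) b ut = b := by
  have := ucup_uone hb
  simp only [mG, ut, UG_mul, add_zero, this]

theorem HomL.of_append {M : Type*} [AddCommGroup M] {𝒢 : GDA M} {l m : List (ℤ × M)}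
    (h : HomL 𝒢 (l ++ m)) : HomL 𝒢 l ∧ HomL 𝒢 m :=
  ⟨fun g hg => h g (by simp [hg]), fun g hg => h g (by simp [hg])⟩

theorem HomL.of_cons {M : Type*} [AddCommGroup M] {𝒢 : GDA M} {a} {l : List (ℤ × M)}
    (h : HomL 𝒢 (a :: l)) : a.2 ∈ 𝒢.Hom a.1 ∧ HomL 𝒢 l :=
  ⟨h a (by simp), fun g hg => h g (by simp [hg])⟩

theorem HomL.mk_cons {M : Type*} [AddCommGroup M] {𝒢 : GDA M} {a} {l : List (ℤ × M)}
    (ha : a.2 ∈ 𝒢.Hom a.1) (h : HomL 𝒢 l) : HomL 𝒢 (a :: l) := by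
  intro g hg
  rcases List.mem_cons.1 hg with rfl | hg
  · exact ha
  · exact h g hg

theorem HomL.mk_append {M : Type*} [AddCommGroup M] {𝒢 : GDA M} {l m : List (ℤ × M)}
    (ha : HomL 𝒢 l) (h : HomL 𝒢 m) : HomL 𝒢 (l ++ m) := by
  intro g hg
  rcases List.mem_append.1 hg with hg | hg
  · exact ha g hg
  · exact h g hg

theorem mrg_zero {M : Type*} [AddCommGroup M] (𝒢 : GDA M) (l : List (ℤ × M))
    {F : List (ℤ × M) → V}
    (h : ∀ x, x.length + 1 = l.length → x ≠ [] → HomL 𝒢 x → F x = 0) (hl : HomL 𝒢 l) :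
    mrg 𝒢 F l = 0 := by
  induction l generalizing F with
  | nil => rfl
  | cons a l ih =>
    simp only [mrg]
    rw [ih (F := fun x => F (a :: x)) (fun x hx _ hh => h _ (by simp [hx]) (by simp)
      (HomL.mk_cons hl.of_cons.1 hh)) hl.of_cons.2]
    cases l with
    | nil => simp [mh]
    | cons b l =>
      rw [mh, h]
      · simp
      · simp
      · simp
      · exact HomL.mk_cons (𝒢.mul_mem hl.of_cons.1 hl.of_cons.2.of_cons.1) hl.of_cons.2.of_cons.2

theorem mrg_unit (l1 l2 : List (ℤ × UM R)) {G : List (ℤ × UM R) → V}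
    (hl : HomL (UG R) (l1 ++ ut :: l2))
    (h : ∀ x, HomL (UG R) x → ut ∈ x → G x = 0) :
    mrg (UG R) G (l1 ++ ut :: l2) =
      (if l1 = [] then 0 else pm (bd l1) • G (l1 ++ l2)) -
      if l2 = [] then 0 else pm (bd l1) • G (l1 ++ l2) := by
  induction l1 generalizing G with
  | nil =>
    simp only [List.nil_append, if_true, mrg, bd_nil, pm_zero, one_smul, zero_sub]
    rw [mrg_zero (UG R) (F := fun x => G (ut :: x)) l2
      (fun x _ _ hx => h _ (HomL.mk_cons uone_mem hx) (by simp)) (HomL.of_cons hl).2]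
    have p : pm ((ut : ℤ × UM R).1 - 1) = -1 := by simp [ut, pm_neg, pm_one]
    rw [p]
    cases l2 with
    | nil => simp [mh]
    | cons b l2 =>
      rw [mh, mG_ut_left ((HomL.of_cons hl).2.of_cons.1)]; simp
  | cons a l1 ih =>
    simp only [List.cons_append, mrg]
    have hl' : HomL (UG R) (a :: (l1 ++ ut :: l2)) := hl
    rw [ih (G := fun x => G (a :: x)) hl'.of_cons.2 (fun x hx hu => h _
      (HomL.mk_cons hl'.of_cons.1 hx) (by simp [hu]))]
    cases l1 with
    | nil =>
      simp only [List.nil_append, mh, if_true, bd_nil, pm_zero, bd_cons]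
      rw [mG_ut_right hl'.of_cons.1]
      split_ifs <;> simp_all
    | cons b l1 =>
      simp only [List.cons_append, mh]
      rw [h (mG (UG R) a b :: (l1 ++ ut :: l2)) (HomL.mk_cons
        ((UG R).mul_mem hl'.of_cons.1 hl'.of_cons.2.of_cons.1) hl'.of_cons.2.of_cons.2) (by simp)]
      split_ifs <;> simp_all [pm_add, smul_smul, mul_assoc]

/-- a normalized family -/
structure NF (F : List (ℤ × UM R) → List (ℤ × UM R) → UM R) : Prop where
  nil : F [] [] = 0
  left : F [ut] [] = uone
  right : F [] [ut] = uone
  mem : ∀ l m, HomL (UG R) l → HomL (UG R) m → F l m ∈ UHom (R := R) (bd l + bd m + 1)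
  van : ∀ l m, HomL (UG R) l → HomL (UG R) m → 1 < l.length + m.length → (ut ∈ l ∨ ut ∈ m) →
    F l m = 0

theorem len_of_ne {α : Type*} {u : α} {x : List α} (hu : u ∈ x) (hx : x ≠ [u]) : 1 < x.length := by
  match x with
  | [] => simp at hu
  | [a] => simp at hu; subst hu; simp at hx
  | _ :: _ :: _ => simp

theorem RST_unit_left {F : List (ℤ × UM R) → List (ℤ × UM R) → UM R} (hF : NF F)
    {l m : List (ℤ × UM R)} (hl : HomL (UG R) l) (hm : HomL (UG R) m) (hm0 : m ≠ [])
    (hu : ut ∈ l) : RST F l m = 0 := by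
  obtain ⟨l1, l2, rfl⟩ := List.append_of_mem hu
  have hl1 := hl.of_append.1
  have hl2 := hl.of_append.2.of_cons.2
  have hml : 0 < m.length := List.length_pos_iff.2 hm0
  have e1 := mrg_unit l1 l2 (G := fun x => F x m) hl (fun x hx hu => hF.van x m hx hm
    (by have := List.length_pos_of_mem hu; omega) (Or.inl hu))
  have e2 : mrg (UG R) (F (l1 ++ ut :: l2)) m = 0 := by
    refine mrg_zero _ _ (fun x _ hx hh => hF.van _ _ hl hh ?_ (Or.inl hu)) hm
    have := List.length_pos_iff.2 hx
    simp; omega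
  have e3 : cup1 (UG R) F F (l1 ++ ut :: l2) m =
      (if l1 = [] then - F l2 m else 0) + if l2 = [] then pm (bd l1) • F l1 m else 0 := by
    rw [cup1, SS, S_unit]
    · congr 1
      · split_ifs
        · rw [S_left]
          · rw [hF.left, UG_mul, uone_ucup (hF.mem _ _ hl2 hm)]
            simp [ut, pm_neg, pm_one]
          · intro x y hxy hx
            rw [hF.van [ut] x (by rintro g hg; simp at hg; subst hg; exact uone_mem)
              (HomL.of_append (hxy ▸ hm)).1 (by have := List.length_pos_iff.2 hx; simp; omega)
              (Or.inl (by simp))]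
            simp
        · rfl
      · split_ifs
        · rw [S_right]
          · rw [hF.left, UG_mul, ucup_uone (hF.mem _ _ hl1 hm)]
            have : pm (bd l1 + bd m + bd [(ut : ℤ × UM R)] * bd m) = pm (bd l1) := by
              simp [ut, add_assoc]
            rw [this]
          · intro x y hxy hx
            rw [hF.van [ut] y (by rintro g hg; simp at hg; subst hg; exact uone_mem)
              (HomL.of_append (hxy ▸ hm)).2 (by have := List.length_pos_iff.2 hx; simp; omega)
              (Or.inl (by simp))]
            rw [map_zero, smul_zero]
        · rfl
    · intro x y hxy
      have hh : HomL (UG R) (x ++ y) := hxy ▸ hl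
      refine ⟨fun hux hx => ?_, fun huy hy => ?_⟩
      · refine (S_congr (F' := fun _ _ => 0) (fun u v huv => ?_)).trans (S_zero _)
        rw [hF.van x u hh.of_append.1 (HomL.of_append (huv ▸ hm)).1
          (by have := len_of_ne hux hx; omega) (Or.inl hux)]
        simp
      · refine (S_congr (F' := fun _ _ => 0) (fun u v huv => ?_)).trans (S_zero _)
        rw [hF.van y v hh.of_append.2 (HomL.of_append (huv ▸ hm)).2
          (by have := len_of_ne huy hy; omega) (Or.inl huy)]
        rw [map_zero, smul_zero]
  rw [RST, e1, e2, e3]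
  by_cases c1 : l1 = [] <;> by_cases c2 : l2 = [] <;> simp [c1, c2, pm_zero]

theorem RST_unit_right {F : List (ℤ × UM R) → List (ℤ × UM R) → UM R} (hF : NF F)
    {l m : List (ℤ × UM R)} (hl : HomL (UG R) l) (hm : HomL (UG R) m) (hl0 : l ≠ [])
    (hu : ut ∈ m) : RST F l m = 0 := by
  obtain ⟨m1, m2, rfl⟩ := List.append_of_mem hu
  have hm1 := hm.of_append.1
  have hm2 := hm.of_append.2.of_cons.2
  have hll : 0 < l.length := List.length_pos_iff.2 hl0
  have e1 := mrg_unit m1 m2 (G := F l) hm (fun x hx hu => hF.van l x hl hx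
    (by have := List.length_pos_of_mem hu; omega) (Or.inr hu))
  have e2 : mrg (UG R) (fun x => F x (m1 ++ ut :: m2)) l = 0 := by
    refine mrg_zero _ _ (fun x _ hx hh => hF.van _ _ hh hm ?_ (Or.inr hu)) hl
    have := List.length_pos_iff.2 hx
    simp; omega
  have e3 : cup1 (UG R) F F l (m1 ++ ut :: m2) =
      (if m1 = [] then - (pm (bd l) • F l m2) else 0) +
        if m2 = [] then pm (bd l + bd m1) • F l m1 else 0 := by
    rw [cup1, SS, S_swap, S_unit]
    · congr 1
      · split_ifs
        · rw [S_left]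
          · rw [hF.right, UG_mul, uone_ucup (hF.mem _ _ hl hm2)]
            simp [ut, pm_neg, pm_one, pm_add]
          · intro x y hxy hx
            rw [hF.van x [ut] (HomL.of_append (hxy ▸ hl)).1
              (by rintro g hg; simp at hg; subst hg; exact uone_mem)
              (by have := List.length_pos_iff.2 hx; simp; omega)
              (Or.inr (by simp))]
            simp
        · rfl
      · split_ifs
        · rw [S_right]
          · rw [hF.right, UG_mul, ucup_uone (hF.mem _ _ hl hm1)]
            simp
          · intro x y hxy hx
            rw [hF.van y [ut] (HomL.of_append (hxy ▸ hl)).2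
              (by rintro g hg; simp at hg; subst hg; exact uone_mem)
              (by have := List.length_pos_iff.2 hx; simp; omega)
              (Or.inr (by simp))]
            rw [map_zero, smul_zero]
        · rfl
    · intro x y hxy
      have hh : HomL (UG R) (x ++ y) := hxy ▸ hm
      refine ⟨fun hux hx => ?_, fun huy hy => ?_⟩
      · refine (S_congr (F' := fun _ _ => 0) (fun u v huv => ?_)).trans (S_zero _)
        rw [hF.van u x (HomL.of_append (huv ▸ hl)).1 hh.of_append.1
          (by have := len_of_ne hux hx; omega) (Or.inr hux)]
        simp
      · refine (S_congr (F' := fun _ _ => 0) (fun u v huv => ?_)).trans (S_zero _)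
        rw [hF.van v y (HomL.of_append (huv ▸ hl)).2 hh.of_append.2
          (by have := len_of_ne huy hy; omega) (Or.inr huy)]
        rw [map_zero, smul_zero]
  rw [RST, e1, e2, e3]
  by_cases c1 : m1 = [] <;> by_cases c2 : m2 = [] <;> simp [c1, c2, pm_zero, pm_add, mul_smul]

theorem Phi_zero {Rr : ℤ × UM R → UM R} (h : ∀ n, Rr (n, 0) = 0) (n s t) : Phi Rr (n, 0) s t = 0 := by
  revert n
  refine pair_induction (P := fun s t => ∀ n, Phi Rr (n, 0) s t = 0) ?_ ?_ ?_ s t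
  · intros; simp [Phi_nil_left]
  · intros; simp [Phi_nil_right]
  · intro x s y t i1 i2 n
    have e : hs x y (0 : UM R) = 0 := by simpa using hs_lin (0 : R) 0 x y 0 0
    simp [Phi_cons, hG, e, i1, i2, h]

theorem Phi_zero' {Rr : ℤ × UM R → UM R} (h : ∀ a, a.2 ∈ UHom a.1 → Rr a = 0) (a : ℤ × UM R)
    (ha : a.2 ∈ UHom a.1) (s t) : Phi Rr a s t = 0 := by
  revert a
  refine pair_induction (P := fun s t => ∀ a : ℤ × UM R, a.2 ∈ UHom a.1 → Phi Rr a s t = 0)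
    ?_ ?_ ?_ s t
  · intros; simp [Phi_nil_left]
  · intros; simp [Phi_nil_right]
  · intro x s y t i1 i2 a ha
    have hm := hs_mem ha x y
    rw [Phi_cons, i1 (hG x y a) hm, i2 (hG x y a) hm, h (hG x y a) hm]
    simp

theorem ML.zero_head {V : Type*} [AddCommGroup V] [Module R V]
    {F : List (ℤ × UM R) → V} (h : ML R F) (n l) : F ((n, 0) :: l) = 0 := by
  simpa using h.head 0 0 n 0 0 l

theorem al_van {l : List (ℤ × UM R)} (h : 1 < l.length) : al l = 0 := by
  match l with
  | _ :: _ :: _ => rfl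

theorem EN_NF (k : ℕ) : NF (EN k : List (ℤ × UM R) → List (ℤ × UM R) → UM R) := by
  induction k with
  | zero =>
    refine ⟨EN_nil_nil _, by rw [EN_nil_right]; rfl, by rw [EN_nil_left]; rfl, EN_mem 0, ?_⟩
    intro l m hl hm hlen hu
    cases l with
    | nil => rw [EN_nil_left]; exact al_van (by simpa using hlen)
    | cons a l =>
      cases m with
      | nil => rw [EN_nil_right]; exact al_van (by simpa using hlen)
      | cons b m => rw [EN_zero]
  | succ k ih =>
    refine ⟨EN_nil_nil _, by rw [EN_nil_right]; rfl, by rw [EN_nil_left]; rfl, EN_mem _, ?_⟩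
    intro l m hl hm hlen hu
    cases l with
    | nil => rw [EN_nil_left]; exact al_van (by simpa using hlen)
    | cons a l =>
      cases m with
      | nil => rw [EN_nil_right]; exact al_van (by simpa using hlen)
      | cons b m =>
        rw [EN_succ]
        funext s t
        by_cases ha : a = ut
        · subst ha
          cases s with
          | nil => rw [Phi_nil_left]; rfl
          | cons x s =>
            cases t with
            | nil => rw [Phi_nil_right]; rfl
            | cons y t =>
              have e : hG x y (ut : ℤ × UM R) = (-1, 0) := by simp [hG, ut, hs_uone]
              have hz : ∀ n, RST (EN k) ((n, 0) :: l) (b :: m) = 0 := fun n =>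
                (RST_ML_left (EN_ML k).1 (b :: m)).zero_head n l
              rw [Phi_cons, e, Phi_zero (Rr := fun a' => RST (EN k) (a' :: l) (b :: m)) hz,
                Phi_zero (Rr := fun a' => RST (EN k) (a' :: l) (b :: m)) hz, hz]
              simp
        · refine Phi_zero' (fun a' ha' => ?_) a hl.of_cons.1 s t
          rcases hu with hu | hu
          · have hu' : ut ∈ l := by
              rcases List.mem_cons.1 hu with h | h
              · exact absurd h.symm ha
              · exact h
            exact RST_unit_left ih (HomL.mk_cons ha' hl.of_cons.2) hm (by simp) (by simp [hu'])
          · exact RST_unit_right ih (HomL.mk_cons ha' hl.of_cons.2) hm (by simp) hu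

theorem EE_van {l m : List (ℤ × UM R)} (hl : HomL (UG R) l) (hm : HomL (UG R) m)
    (h : 1 < l.length + m.length) (hu : ut ∈ l ∨ ut ∈ m) : EE l m = 0 :=
  (EN_NF _).van l m hl hm h hu

theorem EE_NF : NF (EE : List (ℤ × UM R) → List (ℤ × UM R) → UM R) :=
  ⟨EE_nil_nil, by rw [EE_nil_right]; rfl, by rw [EE_nil_left]; rfl,
    fun _ _ hl hm => EE_mem hl hm, fun _ _ hl hm h hu => EE_van hl hm h hu⟩

end unit_
end MVH

end


noncomputable section
open scoped TensorProduct
set_option linter.unusedSectionVars false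
set_option linter.unusedSimpArgs false
set_option linter.unusedVariables false
namespace MVH

section incl
variable {M : Type*} [AddCommGroup M] {𝒢 : GDA M} {V : Type*} [AddCommGroup V]

theorem mrg_in (H : AddSubgroup V) {l : List (ℤ × M)} (hl : HomL 𝒢 l) {F : List (ℤ × M) → V}
    (h : ∀ x, HomL 𝒢 x → x.length + 1 = l.length → F x ∈ H) : mrg 𝒢 F l ∈ H :=
  (mrg_rel (hrel 𝒢) (H.prod (⊤ : AddSubgroup V)) (hrel_of hl) (F := F) (F' := F)
    (fun x x' hx _ hlen => ⟨h x (HomL_of hx) hlen, trivial⟩)).1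

theorem dint_in (H : AddSubgroup V) {l : List (ℤ × M)} (hl : HomL 𝒢 l) {F : List (ℤ × M) → V}
    (h : ∀ x, HomL 𝒢 x → x.length = l.length → F x ∈ H) : dint 𝒢 F l ∈ H :=
  (dint_rel (hrel 𝒢) (H.prod (⊤ : AddSubgroup V)) (hrel_of hl) (F := F) (F' := F)
    (fun x x' hx _ hlen => ⟨h x (HomL_of hx) hlen, trivial⟩)).1

theorem S_in (H : AddSubgroup V) {l : List (ℤ × M)} {F : List (ℤ × M) → List (ℤ × M) → V}
    (h : ∀ x y, x ++ y = l → F x y ∈ H) : S l F ∈ H := by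
  induction l generalizing F with
  | nil => exact h [] [] rfl
  | cons a l ih =>
    exact H.add_mem (h _ _ rfl) (ih (fun x y hxy => h _ _ (by simp [hxy])))

theorem dint_congr {F F' : List (ℤ × M) → V} (l : List (ℤ × M))
    (h : ∀ x, x.length = l.length → F x = F' x) : dint 𝒢 F l = dint 𝒢 F' l := by
  induction l generalizing F F' with
  | nil => rfl
  | cons a l ih =>
    simp only [dint]
    rw [ih (F := fun x => F (a :: x)) (F' := fun x => F' (a :: x)) (fun x hx => h _ (by simp [hx])),
      h _ (by simp)]

theorem dint_zero' (l : List (ℤ × M)) : dint 𝒢 (fun _ => (0 : V)) l = 0 := by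
  induction l with
  | nil => rfl
  | cons a l ih => simp [dint, ih]

theorem mrg_zero' (l : List (ℤ × M)) : mrg 𝒢 (fun _ => (0 : V)) l = 0 := by
  induction l with
  | nil => rfl
  | cons a l ih => simp only [mrg, ih]; cases l <;> simp [mh]

end incl

section main_
variable {R : Type} [CommRing R]

/-- The one-sided twisting equation. -/
theorem al_twist (m : List (ℤ × UM R)) :
    ud (al m) + D1 (UG R) al m - S m (fun m1 m2 => pm (bd m1) • ucup (al m1) (al m2)) = 0 := by
  have z1 : ∀ f : UM R, ucup 0 f = 0 := fun f => by
    have := (UG R).mul.map_zero; exact DFunLike.congr_fun this f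
  have z2 : ∀ f : UM R, ucup f 0 = 0 := fun f => ((UG R).mul f).map_zero
  have z3 : ud (0 : UM R) = 0 := (UG R).d.map_zero
  match m with
  | [] => simp [al, S, D1, z1, z3]
  | [a] => simp [al, S, D1, mh, z1, z2, dG]
  | [a, b] =>
    simp [al, S, D1, mh, z1, z2, z3, dG, mG]
  | a :: b :: c :: m =>
    have e1 : D1 (UG R) al (a :: b :: c :: m) = 0 := by
      rw [D1_eq]
      have q1 : dint (UG R) al (a :: b :: c :: m) = 0 :=
        (dint_congr _ (fun x hx => al_van (by simp [hx]))).trans (dint_zero' _)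
      have q2 : mrg (UG R) al (a :: b :: c :: m) = 0 :=
        (mrg_congr (UG R) _ (fun x hx => al_van (by simp at hx; omega))).trans (mrg_zero' _)
      rw [q1, q2, add_zero]
    have e2 : S (a :: b :: c :: m) (fun m1 m2 => pm (bd m1) • ucup (al m1) (al m2)) = 0 := by
      refine (S_congr (F' := fun _ _ => 0) (fun x y hxy => ?_)).trans (S_zero _)
      have hlen : x.length + y.length = m.length + 3 := by
        rw [← List.length_append, hxy]; simp
      by_cases hx : 1 < x.length
      · rw [al_van hx, z1, smul_zero]
      · rw [al_van (l := y) (by omega), z2, smul_zero]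
    rw [e1, e2]
    simp [al, z3]

theorem Th_nil_left (m : List (ℤ × UM R)) : Th (UG R) EE [] m = 0 := by
  have e : (EE [] : List (ℤ × UM R) → UM R) = al := funext EE_nil_left
  have := al_twist m
  rw [← this]
  simp [Th, DD, D1, cup1, SS, S, e, pm_zero]

theorem Th_nil_right (l : List (ℤ × UM R)) : Th (UG R) EE l [] = 0 := by
  have e : (fun x => EE x [] : List (ℤ × UM R) → UM R) = al := funext EE_nil_right
  have := al_twist l
  rw [← this]
  simp [Th, DD, D1, cup1, SS, S, EE_nil_right, pm_zero]

theorem Th_ML_left (m : List (ℤ × UM R)) : ML R (fun l => Th (UG R) EE l m) := by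
  have hd : ML R (fun l => (UG R).d (EE l m)) := by
    intro r s l l' l'' hl
    simp only [EE_ML_left m r s _ _ _ hl, map_add, UG_lin.d_smul]
  refine (hd.add ?_).sub (cup1_ML_left _ UG_lin EE_ML_left EE_ML_left m)
  exact (D1_ML _ UG_lin (EE_ML_left m)).add ((ML_D1 _ EE_ML_left).sign (fun t => t))

theorem Th_eq (L M : List (ℤ × UM R)) : Th (UG R) EE L M = ud (EE L M) +
    dint (UG R) (fun x => EE x M) L + pm (bd L) • dint (UG R) (EE L) M + RST EE L M := by
  simp only [Th, DD, D1_eq, RST, UG_d, smul_add]; abel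

theorem Th_unit {l m : List (ℤ × UM R)} (hl : HomL (UG R) l) (hm : HomL (UG R) m) (hm0 : m ≠ []) :
    Th (UG R) EE (ut :: l) m = 0 := by
  have hml : 0 < m.length := List.length_pos_iff.2 hm0
  have hul : HomL (UG R) (ut :: l) := HomL.mk_cons uone_mem hl
  rw [Th_eq, RST_unit_left EE_NF hul hm hm0 (by simp),
    EE_van hul hm (by simp; omega) (Or.inl (by simp))]
  have e1 : dint (UG R) (EE (ut :: l)) m ∈ (⊥ : AddSubgroup (UM R)) :=
    dint_in _ hm (fun x hx hlen => EE_van hul hx (by simp; omega) (Or.inl (by simp)))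
  have e2 : dint (UG R) (fun x => EE (ut :: x) m) l ∈ (⊥ : AddSubgroup (UM R)) :=
    dint_in _ hl (fun x hx hlen => EE_van (HomL.mk_cons uone_mem hx) hm (by simp; omega)
      (Or.inl (by simp)))
  have e3 : dG (UG R) (ut : ℤ × UM R) = (0 + 1, 0) := by simp [dG, ut, ud_uone]
  rw [AddSubgroup.mem_bot.1 e1]
  simp only [dint, AddSubgroup.mem_bot.1 e2, e3]
  have e4 := (EE_ML_left m).zero_head (0 + 1) l
  rw [e4]
  have z3 : ud (0 : UM R) = 0 := (UG R).d.map_zero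
  simp [z3]

theorem EE_hs_van (x y : ℕ) (a b : ℤ × UM R) (l m) (s t) :
    EE (hG x y a :: l) (b :: m) (x :: s) (y :: t) = 0 := by
  have hz : ∀ n, RST EE ((n, (0 : UM R)) :: l) (b :: m) = 0 := fun n =>
    (RST_ML_left EE_ML_left (b :: m)).zero_head n l
  have e : hG x y (hG x y a) = (a.1 - 1 - 1, 0) := by simp [hG, hs_hs]
  rw [EE_cons, Phi_cons, e, Phi_zero (Rr := fun a' => RST EE (a' :: l) (b :: m)) hz,
    Phi_zero (Rr := fun a' => RST EE (a' :: l) (b :: m)) hz, hz]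
  simp

/-- cochains vanishing on a cell -/
def cker (R : Type) [CommRing R] (s t : List ℕ) : AddSubgroup (UM R) where
  carrier := {f | f s t = 0}
  zero_mem' := rfl
  add_mem' := by intro a b ha hb; show a s t + b s t = 0; rw [ha, hb, add_zero]
  neg_mem' := by intro a ha; show - a s t = 0; rw [ha, neg_zero]

theorem mem_cker {s t} {f : UM R} : f ∈ cker R s t ↔ f s t = 0 := Iff.rfl

/-- local decomposition of the first entry -/
theorem decomp_loc {x y : ℕ} {σ τ : List ℕ} (hs0 : (x :: σ).Nodup) (ht0 : (y :: τ).Nodup)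
    {n : ℤ} {a : UM R} (ha : a ∈ UHom n) :
    Loc id id (x :: σ) (y :: τ) a (ud (hs x y a) + (hs x y (ud a) + a [x] [y] • uone)) := by
  have key : ∀ (x : ℕ) (σ s' : List ℕ), (x :: σ).Nodup → s'.Sublist (x :: σ) →
      x ∉ s' ∨ ∃ r, s' = x :: r ∧ x ∉ r := by
    intro x σ s' hn hs
    have hx : x ∉ σ := (List.nodup_cons.1 hn).1
    cases hs with
    | cons _ h => exact Or.inl (fun h' => hx (h.subset h'))
    | cons_cons _ h => exact Or.inr ⟨_, rfl, fun h' => hx (h.subset h')⟩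
  intro s' t' hs ht
  have c := hs_contract x y ha s' t' (key _ _ _ hs0 hs) (key _ _ _ ht0 ht)
  simp only [List.map_id, Pi.add_apply, Pi.smul_apply, smul_eq_mul] at c ⊢
  rw [← add_assoc, c]; ring

theorem locrel_refl (s t) (l : List (ℤ × UM R)) : (locrel R id id s t).RL l l := by
  rw [GRel.RL, List.forall₂_same]
  intro x hx
  refine ⟨rfl, fun s' t' _ _ => by simp⟩

/-- transfer along the local decomposition -/
theorem decomp_eval {x y : ℕ} {σ τ : List ℕ} (hs0 : (x :: σ).Nodup) (ht0 : (y :: τ).Nodup)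
    {a : ℤ × UM R} (ha : a.2 ∈ UHom a.1)
    {G : List (ℤ × UM R) → UM R} (hG' : ML R G)
    (hloc : ∀ l l', (locrel R id id (x :: σ) (y :: τ)).RL l l' →
      Loc id id (x :: σ) (y :: τ) (G l) (G l')) (l) (hu : G (ut :: l) = 0) :
    G (a :: l) (x :: σ) (y :: τ) = G (dG (UG R) (hG x y a) :: l) (x :: σ) (y :: τ) +
      G (hG x y (dG (UG R) a) :: l) (x :: σ) (y :: τ) := by
  have h1 := hloc (a :: l) ((a.1, ud (hs x y a.2) + (hs x y (ud a.2) + a.2 [x] [y] • uone)) :: l)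
    (.cons ⟨rfl, decomp_loc hs0 ht0 ha⟩ (locrel_refl _ _ l)) _ _ (List.Sublist.refl _)
    (List.Sublist.refl _)
  simp only [List.map_id] at h1
  have h2 := hG'.head 1 1 a.1 (ud (hs x y a.2)) (hs x y (ud a.2) + a.2 [x] [y] • uone) l
  have h3 := hG'.head 1 (a.2 [x] [y]) a.1 (hs x y (ud a.2)) uone l
  simp only [one_smul] at h2 h3
  have h4 : a.2 [x] [y] • G ((a.1, uone) :: l) = 0 := by
    by_cases h0 : a.1 = 0
    · rw [h0]; rw [ut] at hu; rw [hu, smul_zero]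
    · have : a.2 [x] [y] = 0 := by
        apply ha
        rintro ⟨_, _, h3⟩
        exact h0 (by simpa [dm] using h3.symm)
      rw [this, zero_smul]
  rw [h1, h2, h3, h4, add_zero]
  have e1 : dG (UG R) (hG x y a) = (a.1, ud (hs x y a.2)) := by simp [dG, hG]
  have e2 : hG x y (dG (UG R) a) = (a.1, hs x y (ud a.2)) := by simp [dG, hG]
  rw [e1, e2]; rfl

theorem injOn_id (s : List ℕ) : Set.InjOn (id : ℕ → ℕ) {z | z ∈ s} := fun _ _ _ _ h => h

theorem EE_dh {x y : ℕ} {σ τ : List ℕ} (hs0 : (x :: σ).Nodup) (ht0 : (y :: τ).Nodup)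
    {a b : ℤ × UM R} {l m} (hl : HomL (UG R) (a :: l)) (hm : HomL (UG R) (b :: m)) :
    EE (dG (UG R) (hG x y a) :: l) (b :: m) (x :: σ) (y :: τ) =
      EE (a :: l) (b :: m) (x :: σ) (y :: τ) := by
  have := decomp_eval hs0 ht0 hl.of_cons.1 (EE_ML_left (b :: m))
    (fun l l' h => EE_loc (injOn_id _) (injOn_id _) h (locrel_refl _ _ _)) l
    (EE_van (HomL.mk_cons uone_mem hl.of_cons.2) hm (by simp; omega) (Or.inl (by simp)))
  rw [this, EE_hs_van, add_zero]

theorem claim1 {x y : ℕ} {σ τ : List ℕ} (hs0 : (x :: σ).Nodup) (ht0 : (y :: τ).Nodup)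
    {a b : ℤ × UM R} {l m} (hl : HomL (UG R) (a :: l)) (hm : HomL (UG R) (b :: m)) :
    Th (UG R) EE (hG x y a :: l) (b :: m) (x :: σ) (y :: τ) = 0 := by
  have hl' : HomL (UG R) (hG x y a :: l) := HomL.mk_cons (hs_mem hl.of_cons.1 x y) hl.of_cons.2
  rw [Th_eq]
  have d1 : dint (UG R) (fun z => EE (hG x y a :: z) (b :: m)) l ∈ cker R (x :: σ) (y :: τ) :=
    dint_in _ hl.of_cons.2 (fun z _ _ => EE_hs_van _ _ _ _ _ _ _ _)
  have d2 : dint (UG R) (EE (hG x y a :: l)) (b :: m) ∈ cker R (x :: σ) (y :: τ) := by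
    refine dint_in _ hm (fun z _ hz => ?_)
    cases z with
    | nil => simp at hz
    | cons c z => exact EE_hs_van _ _ _ _ _ _ _ _
  rw [mem_cker] at d1 d2
  have e1 : ud (EE (hG x y a :: l) (b :: m)) (x :: σ) (y :: τ) =
      EE (hG x y a :: l) (b :: m) σ (y :: τ) +
        pm σ.length • EE (hG x y a :: l) (b :: m) (x :: σ) τ := by
    have q1 : (fun u => EE (hG x y a :: l) (b :: m) (x :: u) (y :: τ)) = fun _ => 0 :=
      funext fun u => EE_hs_van _ _ _ _ _ _ _ _
    have q2 : (fun u => EE (hG x y a :: l) (b :: m) (x :: σ) (y :: u)) = fun _ => 0 :=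
      funext fun u => EE_hs_van _ _ _ _ _ _ _ _
    rw [ud, del, q1, del_zero, del, q2, del_zero, sub_zero, sub_zero]
    congr 2
    simp [dm]
  have e2 : EE (a :: l) (b :: m) (x :: σ) (y :: τ) =
      EE (hG x y a :: l) (b :: m) σ (y :: τ) +
        pm σ.length • EE (hG x y a :: l) (b :: m) (x :: σ) τ +
        RST EE (hG x y a :: l) (b :: m) (x :: σ) (y :: τ) := by
    rw [EE_cons, Phi_cons, EE_cons]
  have e3 : dint (UG R) (fun x' => EE x' (b :: m)) (hG x y a :: l) =
      - EE (dG (UG R) (hG x y a) :: l) (b :: m) +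
        pm ((hG x y a).1 - 1) • dint (UG R) (fun z => EE (hG x y a :: z) (b :: m)) l := rfl
  rw [e3]
  simp only [Pi.add_apply, Pi.smul_apply, Pi.neg_apply, d1, d2, e1, EE_dh hs0 ht0 hl hm, e2]
  simp
  ring

theorem ucup_cell_left {f g : UM R} {s t} (h : ∀ s' t', s'.Sublist s → t'.Sublist t → f s' t' = 0) :
    ucup f g s t = 0 := by
  rw [ucup]
  refine (Sp_congr (F' := fun _ _ => 0) (fun a b _ _ ha hb _ => ?_)).trans (Sp_zero _)
  refine (Sp_congr (F' := fun _ _ => 0) (fun c d _ _ hc hd _ => ?_)).trans (Sp_zero _)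
  rw [h a c ha hc]; simp

theorem ucup_cell_right {f g : UM R} {s t} (h : ∀ s' t', s'.Sublist s → t'.Sublist t → g s' t' = 0) :
    ucup f g s t = 0 := by
  rw [ucup]
  refine (Sp_congr (F' := fun _ _ => 0) (fun a b _ _ ha hb _ => ?_)).trans (Sp_zero _)
  refine (Sp_congr (F' := fun _ _ => 0) (fun c d _ _ hc hd _ => ?_)).trans (Sp_zero _)
  rw [h b d hb hd]; simp

theorem ucup_zero_left (g : UM R) : ucup 0 g = 0 := by
  funext s t; exact ucup_cell_left (fun _ _ _ _ => rfl)

theorem ucup_zero_right (g : UM R) : ucup g 0 = 0 := by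
  funext s t; exact ucup_cell_right (fun _ _ _ _ => rfl)

theorem Th_mem {l m : List (ℤ × UM R)} (hl : HomL (UG R) l) (hm : HomL (UG R) m) :
    Th (UG R) EE l m ∈ UHom (R := R) (bd l + bd m + 2) :=
  (Th_rel (f := EE) (f' := EE) (hrel (UG R)) (hrel_of hl) (hrel_of hm)
    (fun x x' y y' hx hy => ⟨EE_mem (HomL_of hx) (HomL_of hy), trivial⟩)).1

theorem claim2 {x y : ℕ} {σ τ : List ℕ} (hs0 : (x :: σ).Nodup) (ht0 : (y :: τ).Nodup)
    {a b : ℤ × UM R} {l m} (hl : HomL (UG R) (a :: l)) (hm : HomL (UG R) (b :: m))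
    (ihN : ∀ l' m', HomL (UG R) l' → HomL (UG R) m' →
      l'.length + m'.length < (a :: l).length + (b :: m).length →
      ∀ s t : List ℕ, s.Nodup → t.Nodup → Th (UG R) EE l' m' s t = 0)
    (ihc : ∀ s t : List ℕ, s.Nodup → t.Nodup →
      s.length + t.length < (x :: σ).length + (y :: τ).length →
      Th (UG R) EE (hG x y a :: l) (b :: m) s t = 0) :
    Th (UG R) EE (dG (UG R) (hG x y a) :: l) (b :: m) (x :: σ) (y :: τ) = 0 := by
  have hl' : HomL (UG R) (hG x y a :: l) := HomL.mk_cons (hs_mem hl.of_cons.1 x y) hl.of_cons.2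
  have B := bianchi (UG R) (f := EE) (fun m => (EE_ML_left m).MA) (fun l => (EE_ML_right l).MA)
    (fun l m hl hm => EE_mem hl hm) (l := hG x y a :: l) (m := b :: m) hl' hm
  have B' := congrFun (congrFun B (x :: σ)) (y :: τ)
  -- the differential
  have t1 : (UG R).d (Th (UG R) EE (hG x y a :: l) (b :: m)) (x :: σ) (y :: τ) = 0 := by
    rw [UG_d, ud]
    rw [del_congr (F' := fun _ => 0), del_zero, del_congr (F' := fun _ => 0), del_zero]
    · simp
    · intro u hu hlen
      exact ihc _ _ hs0 (hu.nodup ht0) (by simp at *; omega)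
    · intro u hu hlen
      exact ihc _ _ (hu.nodup hs0) ht0 (by simp at *; omega)
  have c0 : cup0 (UG R) EE (Th (UG R) EE) (hG x y a :: l) (b :: m) ∈ cker R (x :: σ) (y :: τ) := by
    refine S_in _ (fun l1 l2 h12 => S_in _ (fun m1 m2 hm12 => ?_))
    refine AddSubgroup.zsmul_mem _ ?_ _
    by_cases c : l1.length + m1.length = 0
    · have : l1 = [] := List.eq_nil_of_length_eq_zero (by omega)
      have : m1 = [] := List.eq_nil_of_length_eq_zero (by omega)
      subst l1 m1
      rw [EE_nil_nil, map_zero]; exact AddSubgroup.zero_mem _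
    · rw [mem_cker, UG_mul]
      refine ucup_cell_right (fun s' t' h1 h2 => ihN _ _ (HomL.of_append (h12 ▸ hl')).2
        (HomL.of_append (hm12 ▸ hm)).2 ?_ _ _ (h1.nodup hs0) (h2.nodup ht0))
      have q1 := congrArg List.length h12
      have q2 := congrArg List.length hm12
      simp at q1 q2 ⊢; omega
  have c1 : cup1 (UG R) (Th (UG R) EE) EE (hG x y a :: l) (b :: m) ∈ cker R (x :: σ) (y :: τ) := by
    refine S_in _ (fun l1 l2 h12 => S_in _ (fun m1 m2 hm12 => ?_))
    refine AddSubgroup.zsmul_mem _ ?_ _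
    by_cases c : l2.length + m2.length = 0
    · have : l2 = [] := List.eq_nil_of_length_eq_zero (by omega)
      have : m2 = [] := List.eq_nil_of_length_eq_zero (by omega)
      subst l2 m2
      rw [EE_nil_nil, map_zero]; exact AddSubgroup.zero_mem _
    · rw [mem_cker, UG_mul]
      refine ucup_cell_left (fun s' t' h1 h2 => ihN _ _ (HomL.of_append (h12 ▸ hl')).1
        (HomL.of_append (hm12 ▸ hm)).1 ?_ _ _ (h1.nodup hs0) (h2.nodup ht0))
      have q1 := congrArg List.length h12
      have q2 := congrArg List.length hm12
      simp at q1 q2 ⊢; omega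
  have m1 : mrg (UG R) (fun z => Th (UG R) EE z (b :: m)) (hG x y a :: l) ∈
      cker R (x :: σ) (y :: τ) :=
    mrg_in _ hl' (fun z hz hlen => ihN _ _ hz hm (by simp at *; omega) _ _ hs0 ht0)
  have m2 : mrg (UG R) (Th (UG R) EE (hG x y a :: l)) (b :: m) ∈
      cker R (x :: σ) (y :: τ) :=
    mrg_in _ hm (fun z hz hlen => ihN _ _ hl' hz (by simp at *; omega) _ _ hs0 ht0)
  have d1 : dint (UG R) (fun z => Th (UG R) EE (hG x y a :: z) (b :: m)) l ∈
      cker R (x :: σ) (y :: τ) :=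
    dint_in _ hl.of_cons.2 (fun z hz _ => claim1 hs0 ht0 (HomL.mk_cons hl.of_cons.1 hz) hm)
  have d2 : dint (UG R) (Th (UG R) EE (hG x y a :: l)) (b :: m) ∈ cker R (x :: σ) (y :: τ) := by
    refine dint_in _ hm (fun z hz hlen => ?_)
    cases z with
    | nil => simp at hlen
    | cons c z => exact claim1 hs0 ht0 hl hz
  rw [mem_cker] at c0 c1 m1 m2 d1 d2
  have e3 : dint (UG R) (fun z => Th (UG R) EE z (b :: m)) (hG x y a :: l) =
      - Th (UG R) EE (dG (UG R) (hG x y a) :: l) (b :: m) +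
        pm ((hG x y a).1 - 1) • dint (UG R) (fun z => Th (UG R) EE (hG x y a :: z) (b :: m)) l := rfl
  simp only [Pi.sub_apply, t1, c0, c1, DD, D1_eq, e3, Pi.add_apply, Pi.smul_apply, Pi.neg_apply,
    m1, m2, d1, d2] at B'
  simpa using B'

theorem Th_zero : ∀ (N : ℕ) (l m : List (ℤ × UM R)), HomL (UG R) l → HomL (UG R) m →
    l.length + m.length = N → ∀ s t : List ℕ, s.Nodup → t.Nodup → Th (UG R) EE l m s t = 0 := by
  intro N
  induction N using Nat.strong_induction_on with
  | _ N ihN =>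
  have main : ∀ (n : ℕ) (l m : List (ℤ × UM R)), HomL (UG R) l → HomL (UG R) m →
      l.length + m.length = N → ∀ s t : List ℕ, s.Nodup → t.Nodup → s.length + t.length = n →
      Th (UG R) EE l m s t = 0 := by
    intro n
    induction n using Nat.strong_induction_on with
    | _ n ihn =>
    intro l m hl hm hN s t hs ht hn
    cases l with
    | nil => rw [Th_nil_left]; rfl
    | cons a l =>
    cases m with
    | nil => rw [Th_nil_right]; rfl
    | cons b m =>
    cases s with
    | nil => exact UHom_nil_left (Th_mem hl hm) _
    | cons x σ =>
    cases t with
    | nil => exact UHom_nil_right (Th_mem hl hm) _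
    | cons y τ =>
    have e := decomp_eval hs ht hl.of_cons.1 (Th_ML_left (b :: m))
      (fun l l' h => Th_loc (injOn_id _) (injOn_id _) h (locrel_refl _ _ _)) l
      (Th_unit hl.of_cons.2 hm (by simp))
    rw [e, claim1 hs ht (HomL.mk_cons ((UG R).d_mem hl.of_cons.1) hl.of_cons.2) hm, add_zero]
    refine claim2 hs ht hl hm ?_ ?_
    · intro l' m' hl' hm' hlen
      exact ihN _ (by omega) l' m' hl' hm' rfl
    · intro s t hs' ht' hlen
      exact ihn _ (by omega) _ _ (HomL.mk_cons (a := hG x y a) (hs_mem hl.of_cons.1 x y) hl.of_cons.2) hm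
        (by simpa using hN) s t hs' ht' rfl
  intro l m hl hm hN s t hs ht
  exact main _ l m hl hm hN s t hs ht rfl

theorem ucup_vertex (f g : UM R) (x y : ℕ) : ucup f g [x] [y] = f [x] [y] * g [x] [y] := by
  simp [ucup, Sp, dm, pm_zero]

theorem hs_vertex (f : UM R) (x y : ℕ) : hs x y f [x] [y] = 0 := by
  simp [hs, h1]

theorem EE_vertex_aux : ∀ (n : ℕ) (l m : List (ℤ × UM R)), HomL (UG R) l → HomL (UG R) m →
    1 < l.length + m.length → l.length + m.length = n → ∀ (x y : ℕ), EE l m [x] [y] = 0 := by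
  intro n
  induction n using Nat.strong_induction_on with
  | _ n ih =>
  intro l m hl hm h hn x y
  cases l with
  | nil => rw [EE_nil_left, al_van (by simpa using h)]; rfl
  | cons a l =>
  cases m with
  | nil => rw [EE_nil_right, al_van (by simpa using h)]; rfl
  | cons b m =>
  rw [EE_cons, Phi_cons, Phi_nil_left, Phi_nil_right, smul_zero, zero_add, zero_add]
  have hl' : HomL (UG R) (hG x y a :: l) := HomL.mk_cons (hs_mem hl.of_cons.1 x y) hl.of_cons.2
  have hn' : l.length + 1 + (m.length + 1) = n := by simpa using hn
  have m1 : mrg (UG R) (fun z => EE z (b :: m)) (hG x y a :: l) ∈ cker R [x] [y] := by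
    cases l with
    | nil => simp [mrg, mh, mem_cker]
    | cons c l =>
      refine mrg_in _ hl' (fun z hz hlen => ?_)
      have q : z.length = l.length + 1 := by simpa using hlen
      exact ih _ (by simp at hn' ⊢; omega) z (b :: m) hz hm (by simp; omega) rfl x y
  have m2 : mrg (UG R) (EE (hG x y a :: l)) (b :: m) ∈ cker R [x] [y] := by
    cases m with
    | nil => simp [mrg, mh, mem_cker]
    | cons c m =>
      refine mrg_in _ hm (fun z hz hlen => ?_)
      have q : z.length = m.length + 1 := by simpa using hlen
      exact ih _ (by simp at hn' ⊢; omega) (hG x y a :: l) z hl' hz (by simp; omega) rfl x y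
  have c1 : cup1 (UG R) EE EE (hG x y a :: l) (b :: m) ∈ cker R [x] [y] := by
    refine S_in _ (fun l1 l2 h12 => S_in _ (fun m1 m2 hm12 => ?_))
    refine AddSubgroup.zsmul_mem _ ?_ _
    rw [mem_cker, UG_mul, ucup_vertex]
    have q1 : l1.length + l2.length = l.length + 1 := by
      rw [← List.length_append, h12]; simp
    have q2 : m1.length + m2.length = m.length + 1 := by
      rw [← List.length_append, hm12]; simp
    have hh := HomL.of_append (h12 ▸ hl')
    have hk := HomL.of_append (hm12 ▸ hm)
    by_cases c0 : l1.length + m1.length = 0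
    · have : l1 = [] := List.eq_nil_of_length_eq_zero (by omega)
      have : m1 = [] := List.eq_nil_of_length_eq_zero (by omega)
      subst l1 m1
      rw [EE_nil_nil]; simp
    by_cases c1 : l2.length + m2.length = 0
    · have : l2 = [] := List.eq_nil_of_length_eq_zero (by omega)
      have : m2 = [] := List.eq_nil_of_length_eq_zero (by omega)
      subst l2 m2
      rw [EE_nil_nil]; simp
    by_cases c2 : 1 < l1.length + m1.length
    · rw [ih _ (by omega) l1 m1 hh.1 hk.1 c2 rfl, zero_mul]
    by_cases c3 : 1 < l2.length + m2.length
    · rw [ih _ (by omega) l2 m2 hh.2 hk.2 c3 rfl, mul_zero]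
    by_cases c4 : l1.length = 0
    · have : l1 = [] := List.eq_nil_of_length_eq_zero (by omega)
      have : m2 = [] := List.eq_nil_of_length_eq_zero (by omega)
      have : l = [] := List.eq_nil_of_length_eq_zero (by omega)
      subst l1 m2 l
      rw [show l2 = [hG x y a] by simpa using h12, EE_nil_right [hG x y a]]
      simp [al, hG, hs_vertex]
    · have : l2 = [] := List.eq_nil_of_length_eq_zero (by omega)
      have : m1 = [] := List.eq_nil_of_length_eq_zero (by omega)
      have : l = [] := List.eq_nil_of_length_eq_zero (by omega)
      subst l2 m1 l
      rw [show l1 = [hG x y a] by simpa using h12, EE_nil_right [hG x y a]]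
      simp [al, hG, hs_vertex]
  rw [mem_cker] at m1 m2 c1
  simp only [RST, Pi.add_apply, Pi.sub_apply, Pi.smul_apply, m1, m2, c1]
  simp

/-- vanishing at vertices -/
theorem EE_vertex {l m : List (ℤ × UM R)} (hl : HomL (UG R) l) (hm : HomL (UG R) m)
    (h : 1 < l.length + m.length) (x y : ℕ) : EE l m [x] [y] = 0 :=
  EE_vertex_aux _ l m hl hm h rfl x y

end main_
end MVH

end


noncomputable section
open scoped TensorProduct
set_option linter.unusedSectionVars false
set_option linter.unusedSimpArgs false
set_option linter.unusedVariables false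
namespace MVH

section lin
variable {R : Type} [CommRing R] {C : Type} [AddCommGroup C] [Module R C]
variable {V : Type} [AddCommGroup V] [Module R V]

/-- the module of multilinear functions on tagged words -/
def MLmod (R : Type) [CommRing R] (C : Type) [AddCommGroup C] [Module R C]
    (V : Type) [AddCommGroup V] [Module R V] : Submodule R (List (ℤ × C) → V) where
  carrier := {F | ML R F}
  zero_mem' := by intro r s l l' l'' h; simp
  add_mem' := fun h h' => h.add h'
  smul_mem' := by
    intro c F h
    have := ML.map (R := R) (F := F) (φ := (c • LinearMap.id : V →ₗ[R] V)) h
    exact this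

/-- prefixing by a tagged element -/
def act0 (n : ℤ) : C →ₗ[R] Module.End R (MLmod R C V) where
  toFun a :=
    { toFun := fun F => ⟨fun w => F.1 ((n, a) :: w), F.2.cons (n, a)⟩
      map_add' := fun F G => rfl
      map_smul' := fun c F => rfl }
  map_add' a b := by
    ext F w
    have := F.2.head 1 1 n a b w
    simpa using this
  map_smul' c a := by
    ext F w
    have := F.2.head c 0 n a 0 w
    simpa using this

/-- plain words of the tensor algebra -/
def tw_ (R : Type) [CommRing R] {C : Type} [AddCommGroup C] [Module R C] (l : List C) :
    TensorAlgebra R C := (l.map (TensorAlgebra.ι R)).prod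

theorem tw_cons (a : C) (l : List C) : tw_ R (a :: l) = TensorAlgebra.ι R a * tw_ R l := by
  simp [tw_]

theorem tw_nil : tw_ R ([] : List C) = 1 := rfl

theorem lin_core {W : Type} [AddCommGroup W] [Module R W] (act : C →ₗ[R] Module.End R W) (w : W)
    (ev : W →ₗ[R] V) : ∃ φ : TensorAlgebra R C →ₗ[R] V,
      ∀ l : List C, φ (tw_ R l) = ev (l.foldl (fun w a => act a w) w) := by
  let L : TensorAlgebra R C →ₐ[R] (Module.End R W)ᵐᵒᵖ :=
    TensorAlgebra.lift R ((MulOpposite.opLinearEquiv R).toLinearMap ∘ₗ act)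
  let φ : TensorAlgebra R C →ₗ[R] V :=
    ev ∘ₗ (LinearMap.applyₗ w) ∘ₗ (MulOpposite.opLinearEquiv R).symm.toLinearMap ∘ₗ L.toLinearMap
  have key : ∀ (l : List C) (w : W), (MulOpposite.unop (L (tw_ R l))) w =
      l.foldl (fun w a => act a w) w := by
    intro l
    induction l with
    | nil => intro w; simp [tw_nil]
    | cons a l ih =>
      intro w
      rw [tw_cons, map_mul, MulOpposite.unop_mul, Module.End.mul_apply, ih]
      simp [L]
  exact ⟨φ, fun l => congrArg ev (key l w)⟩

theorem exists_lin0 {F : List (ℤ × C) → V} (hF : ML R F) : ∃ φ : TensorAlgebra R C →ₗ[R] V,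
    ∀ l : List C, φ (tw_ R l) = F (l.map (fun a => (0, a))) := by
  obtain ⟨φ, h⟩ := lin_core (act0 (R := R) (C := C) (V := V) 0) ⟨F, hF⟩
    ((LinearMap.proj []) ∘ₗ (MLmod R C V).subtype)
  refine ⟨φ, fun l => (h l).trans ?_⟩
  have key : ∀ (l : List C) (F : MLmod R C V) (w : List (ℤ × C)),
      (l.foldl (fun w a => act0 (R := R) (V := V) 0 a w) F).1 w =
        F.1 (l.map (fun a => ((0 : ℤ), a)) ++ w) := by
    intro l
    induction l with
    | nil => intro F w; rfl
    | cons a l ih => intro F w; simp only [List.foldl_cons, ih]; rfl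
  simpa using key l ⟨F, hF⟩ []

theorem exists_lin {gr : ℤ → Submodule R C} (hgr : DirectSum.IsInternal gr)
    {F : List (ℤ × C) → V} (hF : ML R F) : ∃ φ : TensorAlgebra R C →ₗ[R] V,
    ∀ l : List (ℤ × C), (∀ g ∈ l, g.2 ∈ gr g.1) → φ (tw_ R (l.map Prod.snd)) = F l := by
  let e := LinearEquiv.ofBijective (DirectSum.coeLinearMap gr) hgr
  let act : C →ₗ[R] Module.End R (MLmod R C V) :=
    (DirectSum.toModule R ℤ (Module.End R (MLmod R C V))
      (fun n => act0 (R := R) (V := V) n ∘ₗ (gr n).subtype)) ∘ₗ e.symm.toLinearMap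
  have hact : ∀ (n : ℤ) (a : C), a ∈ gr n → act a = act0 n a := by
    intro n a ha
    have : e.symm a = DirectSum.lof R ℤ (fun i => gr i) n ⟨a, ha⟩ := by
      rw [LinearEquiv.symm_apply_eq]
      show a = DirectSum.coeLinearMap gr _
      rw [DirectSum.coeLinearMap_lof]
    simp [act, this]
  obtain ⟨φ, h⟩ := lin_core act ⟨F, hF⟩ ((LinearMap.proj []) ∘ₗ (MLmod R C V).subtype)
  refine ⟨φ, fun l hl => (h _).trans ?_⟩
  have key : ∀ (l : List (ℤ × C)), (∀ g ∈ l, g.2 ∈ gr g.1) →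
      ∀ (F : MLmod R C V) (w : List (ℤ × C)),
      ((l.map Prod.snd).foldl (fun w a => act a w) F).1 w = F.1 (l ++ w) := by
    intro l
    induction l with
    | nil => intro _ F w; rfl
    | cons a l ih =>
      intro hl F w
      simp only [List.map_cons, List.foldl_cons]
      rw [ih (fun g hg => hl g (by simp [hg])), hact a.1 a.2 (hl a (by simp))]; rfl
  simpa using key l hl ⟨F, hF⟩ []

/-- every word is a combination of homogeneous ones of the same shape -/
theorem tw_mem_span {gr : ℤ → Submodule R C} (hgr : DirectSum.IsInternal gr) {u : C}
    (hu : u ∈ gr 0) (l : List C) :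
    tw_ R l ∈ Submodule.span R {x | ∃ l' : List (ℤ × C), (∀ g ∈ l', g.2 ∈ gr g.1) ∧
      l'.length = l.length ∧ (u ∈ l → ((0 : ℤ), u) ∈ l') ∧ x = tw_ R (l'.map Prod.snd)} := by
  induction l with
  | nil => exact Submodule.subset_span ⟨[], by simp, rfl, by simp, rfl⟩
  | cons a l ih =>
    have ha : a ∈ Submodule.span R {b : C | ∃ n, b ∈ gr n ∧ (a = u → n = 0 ∧ b = u)} := by
      by_cases hau : a = u
      · subst hau; exact Submodule.subset_span ⟨0, hu, fun _ => ⟨rfl, rfl⟩⟩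
      · have : a ∈ iSup gr := by
          rw [hgr.submodule_iSup_eq_top]; trivial
        have h2 : iSup gr ≤ Submodule.span R
            {b : C | ∃ n, b ∈ gr n ∧ (a = u → n = 0 ∧ b = u)} :=
          iSup_le (fun n b hb => Submodule.subset_span ⟨n, hb, fun h => absurd h hau⟩)
        exact h2 this
    have ha' := Submodule.mem_map_of_mem (f := TensorAlgebra.ι R) ha
    rw [Submodule.map_span] at ha'
    have hm := Submodule.mul_mem_mul ha' ih
    rw [Submodule.span_mul_span] at hm
    rw [tw_cons]
    refine Submodule.span_mono ?_ hm
    rintro _ ⟨_, ⟨b, ⟨n, hb, hbu⟩, rfl⟩, _, ⟨l', h1, h2, h3, rfl⟩, rfl⟩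
    refine ⟨(n, b) :: l', ?_, by simp [h2], ?_, by simp [tw_cons]⟩
    · intro g hg
      rcases List.mem_cons.1 hg with rfl | hg
      · exact hb
      · exact h1 g hg
    · intro hmem
      rcases List.mem_cons.1 hmem with h | h
      · obtain ⟨rfl, rfl⟩ := hbu h.symm; simp
      · exact List.mem_cons_of_mem _ (h3 h)

theorem span_tw : (Submodule.span R (Set.range (fun l : List C => tw_ R l)) :
    Submodule R (TensorAlgebra R C)) = ⊤ := by
  rw [eq_top_iff]
  rintro x -
  induction x using TensorAlgebra.induction with
  | algebraMap r =>
    rw [Algebra.algebraMap_eq_smul_one]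
    exact Submodule.smul_mem _ _ (Submodule.subset_span ⟨[], rfl⟩)
  | ι a => exact Submodule.subset_span ⟨[a], by simp [tw_]⟩
  | mul a b ha hb =>
    have := Submodule.mul_mem_mul ha hb
    rw [Submodule.span_mul_span] at this
    refine Submodule.span_mono ?_ this
    rintro _ ⟨_, ⟨l, rfl⟩, _, ⟨m, rfl⟩, rfl⟩
    exact ⟨l ++ m, by simp [tw_]⟩
  | add a b ha hb => exact Submodule.add_mem _ ha hb

theorem tw_ext {gr : ℤ → Submodule R C} (hgr : DirectSum.IsInternal gr)
    {φ ψ : TensorAlgebra R C →ₗ[R] V}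
    (h : ∀ l : List (ℤ × C), (∀ g ∈ l, g.2 ∈ gr g.1) →
      φ (tw_ R (l.map Prod.snd)) = ψ (tw_ R (l.map Prod.snd))) : φ = ψ := by
  refine LinearMap.ext_on_range (v := fun l : List C => tw_ R l) span_tw (fun l => ?_)
  have := tw_mem_span hgr (Submodule.zero_mem _ : (0 : C) ∈ gr 0) l
  refine LinearMap.eqOn_span (f := φ) (g := ψ) ?_ this
  rintro _ ⟨l', h1, _, _, rfl⟩
  exact h l' h1

theorem exists_lin2 {gr : ℤ → Submodule R C} (hgr : DirectSum.IsInternal gr)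
    {F : List (ℤ × C) → List (ℤ × C) → V} (h1 : ∀ m, ML R (fun l => F l m))
    (h2 : ∀ l, ML R (F l)) :
    ∃ φ : TensorAlgebra R C ⊗[R] TensorAlgebra R C →ₗ[R] V,
    ∀ l m : List (ℤ × C), (∀ g ∈ l, g.2 ∈ gr g.1) → (∀ g ∈ m, g.2 ∈ gr g.1) →
      φ (tw_ R (l.map Prod.snd) ⊗ₜ tw_ R (m.map Prod.snd)) = F l m := by
  choose K hK using fun l => exists_lin hgr (h2 l)
  have hML : ML R K := by
    intro r s l l' l'' hl
    refine tw_ext hgr (fun m hm => ?_)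
    simp only [LinearMap.add_apply, LinearMap.smul_apply, hK _ m hm]
    exact h1 m r s _ _ _ hl
  obtain ⟨Φ, hΦ⟩ := exists_lin hgr hML
  refine ⟨TensorProduct.lift Φ, fun l m hl hm => ?_⟩
  rw [TensorProduct.lift.tmul, hΦ l hl, hK l m hm]

theorem tw_ext2 {gr : ℤ → Submodule R C} (hgr : DirectSum.IsInternal gr)
    {φ ψ : TensorAlgebra R C ⊗[R] TensorAlgebra R C →ₗ[R] V}
    (h : ∀ l m : List (ℤ × C), (∀ g ∈ l, g.2 ∈ gr g.1) → (∀ g ∈ m, g.2 ∈ gr g.1) →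
      φ (tw_ R (l.map Prod.snd) ⊗ₜ tw_ R (m.map Prod.snd)) =
      ψ (tw_ R (l.map Prod.snd) ⊗ₜ tw_ R (m.map Prod.snd))) : φ = ψ := by
  refine TensorProduct.ext (tw_ext hgr (fun l hl => tw_ext hgr (fun m hm => ?_)))
  exact h l m hl hm

theorem span_van {T : Type} [AddCommGroup T] [Module R T] (ψ : T →ₗ[R] V) {S : Set T} {x : T}
    (hx : x ∈ Submodule.span R S) (h : ∀ x ∈ S, ψ x = 0) : ψ x = 0 := by
  have : Submodule.span R S ≤ LinearMap.ker ψ := Submodule.span_le.2 h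
  exact this hx

/-- a bilinear property on homogeneous words extends -/
theorem tw_van2 {gr : ℤ → Submodule R C} (hgr : DirectSum.IsInternal gr) {u : C}
    (hu : u ∈ gr 0) (φ : TensorAlgebra R C ⊗[R] TensorAlgebra R C →ₗ[R] V) (l m : List C)
    (h : ∀ l' m' : List (ℤ × C), (∀ g ∈ l', g.2 ∈ gr g.1) → (∀ g ∈ m', g.2 ∈ gr g.1) →
      l'.length = l.length → m'.length = m.length → (u ∈ l → ((0 : ℤ), u) ∈ l') →
      (u ∈ m → ((0 : ℤ), u) ∈ m') →
      φ (tw_ R (l'.map Prod.snd) ⊗ₜ tw_ R (m'.map Prod.snd)) = 0) :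
    φ (tw_ R l ⊗ₜ tw_ R m) = 0 := by
  have k1 : ∀ l' : List (ℤ × C), (∀ g ∈ l', g.2 ∈ gr g.1) → l'.length = l.length →
      (u ∈ l → ((0 : ℤ), u) ∈ l') → φ (tw_ R (l'.map Prod.snd) ⊗ₜ tw_ R m) = 0 := by
    intro l' a b c
    refine span_van (TensorProduct.curry φ (tw_ R (l'.map Prod.snd))) (tw_mem_span hgr hu m) ?_
    rintro _ ⟨m', x1, x2, x3, rfl⟩
    exact h l' m' a x1 b x2 c x3
  refine span_van ((TensorProduct.curry φ).flip (tw_ R m)) (tw_mem_span hgr hu l) ?_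
  rintro _ ⟨l', x1, x2, x3, rfl⟩
  exact k1 l' x1 x2 x3

end lin
end MVH

end


noncomputable section
open scoped TensorProduct
set_option linter.unusedSectionVars false
set_option linter.unusedSimpArgs false
set_option linter.unusedVariables false
namespace MVH

section sums
variable {M : Type*} [AddCommGroup M] (𝒢 : GDA M)
variable {V : Type*} [AddCommGroup V]

theorem S_sum (l : List (ℤ × M)) (F : List (ℤ × M) → List (ℤ × M) → V) :
    S l F = ∑ i ∈ Finset.range (l.length + 1), F (l.take i) (l.drop i) := by
  induction l generalizing F with
  | nil => simp [S]
  | cons a l ih =>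
    rw [List.length_cons, Finset.sum_range_succ', S, ih, add_comm]
    simp

theorem dint_sum (l : List (ℤ × M)) (F : List (ℤ × M) → V) :
    dint 𝒢 F l = - ∑ i ∈ Finset.range l.length,
      pm (bd (l.take i)) • F (l.set i (dG 𝒢 (l.getD i 0))) := by
  induction l generalizing F with
  | nil => simp [dint]
  | cons a l ih =>
    rw [List.length_cons, Finset.sum_range_succ', dint, ih, neg_add, add_comm]
    simp [pm_zero, pm_add, Finset.smul_sum, mul_smul]

theorem mrg_sum (l : List (ℤ × M)) (F : List (ℤ × M) → V) :
    mrg 𝒢 F l = ∑ i ∈ Finset.range (l.length - 1),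
      pm (bd (l.take (i + 1))) •
        F (l.take i ++ mG 𝒢 (l.getD i 0) (l.getD (i + 1) 0) :: l.drop (i + 2)) := by
  induction l generalizing F with
  | nil => simp [mrg]
  | cons a l ih =>
    cases l with
    | nil => simp [mrg, mh]
    | cons b l =>
      rw [List.length_cons, Nat.add_sub_cancel, List.length_cons, Finset.sum_range_succ', mrg, ih]
      simp [pm_zero, pm_add, Finset.smul_sum, mul_smul, mh]

end sums

section bardata
variable {R : Type} [CommRing R] (A : DGAlgebra R)

/-- the graded differential algebra underlying a dg algebra -/
def AG : GDA A.carrier where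
  mul := AddMonoidHom.mul
  d := A.d.toAddMonoidHom
  Hom n := (A.grading n).toAddSubgroup
  mul_mem := fun ha hb => A.mul_mem ha hb
  d_mem := fun ha => A.d_mem ha
  dd := fun _ => A.d_sq _
  leib := fun ha _ => A.leibniz ha
  assoc := fun _ _ _ => mul_assoc _ _ _

@[simp] theorem AG_mul (a b) : (AG A).mul a b = a * b := rfl
@[simp] theorem AG_d (a) : (AG A).d a = A.d a := rfl
theorem AG_Hom (n a) : a ∈ (AG A).Hom n ↔ a ∈ A.grading n := Iff.rfl

theorem AG_lin : RLin R (AG A) where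
  smul_mul r a b := by simp
  mul_smul r a b := by simp
  d_smul r a := by simp

theorem word_eq (l : List A.carrier) : A.word l = tw_ R l := rfl

theorem bdeg_map (L : List (ℤ × A.carrier)) : bdeg (L.map Prod.fst) = bd L := by
  induction L with
  | nil => rfl
  | cons a l ih =>
    rw [bd_cons, ← ih]; simp [bdeg]

theorem homog_tag {l : List A.carrier} {ds : List ℤ} (h : A.Homog l ds) :
    ∃ L : List (ℤ × A.carrier), HomL (AG A) L ∧ L.map Prod.snd = l ∧ L.map Prod.fst = ds := by
  induction l generalizing ds with
  | nil =>
    have := h.1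
    cases ds with
    | nil => exact ⟨[], HomL_nil _, rfl, rfl⟩
    | cons => simp at this
  | cons a l ih =>
    cases ds with
    | nil => have := h.1; simp at this
    | cons n ds =>
      obtain ⟨L, h1, h2, h3⟩ := ih (ds := ds) ⟨by simpa using h.1, fun i => by simpa using h.2 (i + 1)⟩
      refine ⟨(n, a) :: L, (HomL_cons _).2 ⟨(AG_Hom A n a).2 (by simpa using h.2 0), h1⟩, by simp [h2], by simp [h3]⟩

theorem tw_ML : ML R (fun l : List (ℤ × A.carrier) => tw_ R (l.map Prod.snd)) := by
  intro r s l l' l'' h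
  induction h with
  | head n a b l => simp [tw_cons, add_mul]
  | tail g h ih => simp only [List.map_cons, tw_cons, ih, mul_add, mul_smul_comm]

theorem sndzero (l : List A.carrier) : (l.map (fun a => ((0 : ℤ), a))).map Prod.snd = l := by
  simp [Function.comp_def]

theorem exists_Δ : ∃ φ : A.Bar →ₗ[R] A.Bar ⊗[R] A.Bar, ∀ l : List A.carrier,
    φ (A.word l) = ∑ i ∈ Finset.range (l.length + 1),
      A.word (l.take i) ⊗ₜ[R] A.word (l.drop i) := by
  have : ML R (fun l : List (ℤ × A.carrier) => S l (fun x y =>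
      tw_ R (x.map Prod.snd) ⊗ₜ[R] tw_ R (y.map Prod.snd))) := by
    refine S_ML (fun y => ?_) (fun x => ?_)
    · exact (tw_ML A).map ((TensorProduct.mk R A.Bar A.Bar).flip (tw_ R (y.map Prod.snd)))
    · exact (tw_ML A).map ((TensorProduct.mk R A.Bar A.Bar) (tw_ R (x.map Prod.snd)))
  obtain ⟨φ, h⟩ := exists_lin0 this
  refine ⟨φ, fun l => (h l).trans ?_⟩
  rw [S_sum]
  simp [word_eq, ← List.map_take, ← List.map_drop, Function.comp_def]

theorem exists_dB : ∃ φ : A.Bar →ₗ[R] A.Bar, ∀ L : List (ℤ × A.carrier), HomL (AG A) L →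
    φ (tw_ R (L.map Prod.snd)) = D1 (AG A) (fun x => tw_ R (x.map Prod.snd)) L :=
  exists_lin A.grading_internal (D1_ML _ (AG_lin A) (tw_ML A))

theorem exists_sgnB : ∃ φ : A.Bar →ₗ[R] A.Bar, ∀ L : List (ℤ × A.carrier), HomL (AG A) L →
    φ (tw_ R (L.map Prod.snd)) = pm (bd L) • tw_ R (L.map Prod.snd) :=
  exists_lin A.grading_internal ((tw_ML A).sign id)

theorem exists_tw : ∃ φ : A.Bar ⊗[R] A.Bar →ₗ[R] A.Bar ⊗[R] A.Bar,
    ∀ L K : List (ℤ × A.carrier), HomL (AG A) L → HomL (AG A) K →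
    φ (tw_ R (L.map Prod.snd) ⊗ₜ tw_ R (K.map Prod.snd)) =
      pm (bd L * bd K) • (tw_ R (K.map Prod.snd) ⊗ₜ tw_ R (L.map Prod.snd)) := by
  refine exists_lin2 A.grading_internal (F := fun L K =>
    pm (bd L * bd K) • (tw_ R (K.map Prod.snd) ⊗ₜ tw_ R (L.map Prod.snd)))
    (fun K => ?_) (fun L => ?_)
  · exact ((tw_ML A).map ((TensorProduct.mk R A.Bar A.Bar) (tw_ R (K.map Prod.snd)))).sign
      (fun x => x * bd K)
  · exact ((tw_ML A).map ((TensorProduct.mk R A.Bar A.Bar).flip (tw_ R (L.map Prod.snd)))).sign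
      (fun x => bd L * x)

/-- projection to words of length one -/
def alA : List (ℤ × A.carrier) → A.carrier
  | [b] => b.2
  | _ => 0

theorem alA_ML : ML R (alA A) := by
  intro r s l l' l'' h
  cases h with
  | head n a b l => cases l <;> simp [alA]
  | tail g h => cases h <;> simp [alA]

theorem alA_ne {L : List (ℤ × A.carrier)} (h : L.length ≠ 1) : alA A L = 0 := by
  match L, h with
  | [], _ => rfl
  | [b], h => simp at h
  | _ :: _ :: _, _ => rfl

theorem exists_bd : ∃ BD : BarData A,
    (∀ L : List (ℤ × A.carrier), HomL (AG A) L →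
      BD.dB (tw_ R (L.map Prod.snd)) = D1 (AG A) (fun x => tw_ R (x.map Prod.snd)) L) ∧
    (∀ L : List (ℤ × A.carrier), HomL (AG A) L →
      BD.sgnB (tw_ R (L.map Prod.snd)) = pm (bd L) • tw_ R (L.map Prod.snd)) ∧
    (∀ L K : List (ℤ × A.carrier), HomL (AG A) L → HomL (AG A) K →
      BD.tw (tw_ R (L.map Prod.snd) ⊗ₜ tw_ R (K.map Prod.snd)) =
      pm (bd L * bd K) • (tw_ R (K.map Prod.snd) ⊗ₜ tw_ R (L.map Prod.snd))) ∧
    (∀ L : List (ℤ × A.carrier), BD.α (tw_ R (L.map Prod.snd)) = alA A L) ∧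
    (∀ L : List (ℤ × A.carrier), BD.Δ (tw_ R (L.map Prod.snd)) =
      S L (fun x y => tw_ R (x.map Prod.snd) ⊗ₜ[R] tw_ R (y.map Prod.snd))) := by
  obtain ⟨Δ, hΔ⟩ := exists_Δ A
  obtain ⟨dB, hdB⟩ := exists_dB A
  obtain ⟨sg, hsg⟩ := exists_sgnB A
  obtain ⟨tw, htw⟩ := exists_tw A
  obtain ⟨al, hal⟩ := exists_lin0 (alA_ML A)
  have hal1 : ∀ a : A.carrier, al (A.word [a]) = a := fun a => by
    rw [word_eq, hal]; rfl
  have hal2 : ∀ l : List A.carrier, l.length ≠ 1 → al (A.word l) = 0 := fun l h => by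
    rw [word_eq, hal, alA_ne]; simpa using h
  refine ⟨
    { Δ := Δ, Δ_word := hΔ, dB := dB, dB_word := ?_, sgnB := sg, sgnB_word := ?_, tw := tw
      tw_word := ?_, α := al, α_single := hal1, α_word := hal2
      εB := (TensorAlgebra.algebraMapInv (R := R) (M := A.carrier)).toLinearMap, εB_one := ?_
      εB_word := ?_ }, hdB, hsg, htw, ?_, ?_⟩
  · intro l ds h
    obtain ⟨L, h1, rfl, rfl⟩ := homog_tag A h
    have h0 : ∀ i, (L.map Prod.snd).getD i 0 = (L.getD i 0).2 := fun i =>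
      List.getD_map (f := Prod.snd) (d := (0 : ℤ × A.carrier)) ..
    rw [word_eq, hdB L h1, D1_eq, dint_sum, mrg_sum]
    simp [word_eq, List.map_set, ← List.map_take, ← List.map_drop, bdeg_map, h0, dG, mG,
      -List.getD_eq_getElem?_getD]
  · intro l ds h
    obtain ⟨L, h1, rfl, rfl⟩ := homog_tag A h
    rw [bdeg_map]; exact hsg L h1
  · intro l m ds es h h'
    obtain ⟨L, h1, rfl, rfl⟩ := homog_tag A h
    obtain ⟨K, h2, rfl, rfl⟩ := homog_tag A h'
    rw [bdeg_map, bdeg_map]; exact htw L K h1 h2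
  · simp
  · intro l hl
    cases l with
    | nil => exact absurd rfl hl
    | cons a l =>
      rw [word_eq, tw_cons]
      simp [TensorAlgebra.algebraMapInv]
  · intro L
    by_cases h : L.length = 1
    · obtain ⟨b, rfl⟩ := List.length_eq_one_iff.1 h
      exact hal1 b.2
    · rw [alA_ne A h]; exact hal2 _ (by simpa using h)
  · intro L
    rw [S_sum]
    refine (hΔ _).trans ?_
    simp [word_eq, ← List.map_take, ← List.map_drop]

end bardata
end MVH

end


noncomputable section
open scoped TensorProduct
set_option linter.unusedSectionVars false
set_option linter.unusedSimpArgs false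
set_option linter.unusedVariables false
namespace MVH

section prj
variable {R : Type} [CommRing R] (A : DGAlgebra R)

/-- homogeneous components -/
def prj (n : ℤ) : A.carrier →ₗ[R] A.grading n :=
  DirectSum.component R ℤ (fun i => A.grading i) n ∘ₗ
    (LinearEquiv.ofBijective (DirectSum.coeLinearMap A.grading) A.grading_internal).symm.toLinearMap

theorem prj_aux {n : ℤ} {a : A.carrier} (ha : a ∈ A.grading n) :
    (LinearEquiv.ofBijective (DirectSum.coeLinearMap A.grading) A.grading_internal).symm a =
      DirectSum.lof R ℤ (fun i => A.grading i) n ⟨a, ha⟩ := by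
  rw [LinearEquiv.symm_apply_eq]
  show a = DirectSum.coeLinearMap A.grading _
  rw [DirectSum.coeLinearMap_lof]

theorem prj_same {n : ℤ} {a : A.carrier} (ha : a ∈ A.grading n) : prj A n a = ⟨a, ha⟩ := by
  simp only [prj, LinearMap.comp_apply, LinearEquiv.coe_coe, prj_aux A ha]
  exact DirectSum.component.lof_self ..

theorem prj_ne {n m : ℤ} {a : A.carrier} (ha : a ∈ A.grading n) (h : n ≠ m) : prj A m a = 0 := by
  simp only [prj, LinearMap.comp_apply, LinearEquiv.coe_coe, prj_aux A ha]
  rw [DirectSum.component.of, dif_neg h]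

theorem prj_inj {a : A.carrier} (h : ∀ n, prj A n a = 0) : a = 0 := by
  have : (LinearEquiv.ofBijective (DirectSum.coeLinearMap A.grading) A.grading_internal).symm a = 0 := by
    refine DFinsupp.ext (fun n => ?_)
    exact h n
  simpa using this
end prj

section cells
open CategoryTheory
variable {R : Type} [CommRing R] {X : SSet.{0}} {I : Type} [LinearOrder I] {U : I → SubSSet X}

variable (X U) in
/-- bisimplices of the cover -/
structure Cell where
  P : ℕ
  Q : ℕ
  v : OrdTuple I Q
  x : InterSimp X U v.1 P

theorem Cell.ext2 {p q : ℕ} {v v' : OrdTuple I q} {x : InterSimp X U v.1 p}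
    {x' : InterSimp X U v'.1 p} (hv : v.1 = v'.1) (hx : x.1 = x'.1) :
    (⟨p, q, v, x⟩ : Cell X U) = ⟨p, q, v', x'⟩ := by
  obtain ⟨v, hv1⟩ := v
  obtain ⟨v', hv2⟩ := v'
  dsimp only at hv
  subst hv
  obtain ⟨x, h1⟩ := x
  obtain ⟨x', h2⟩ := x'
  dsimp only at hx
  subst hx
  rfl

/-- faces of cells -/
def faceH (z : Cell X U) {p q : ℕ} (f : SimplexCategory.mk p ⟶ SimplexCategory.mk z.P)
    (g : Fin (q + 1) → Fin (z.Q + 1)) (hg : StrictMono g) : Cell X U :=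
  ⟨p, q, ⟨fun i => z.v.1 (g i), fun a b h => z.v.2 (hg h)⟩,
    ⟨X.map f.op z.x.1, fun t => (U _).map_mem _ (z.x.2 (g t))⟩⟩

theorem hom_ext {p P : ℕ} {f f' : SimplexCategory.mk p ⟶ SimplexCategory.mk P}
    (h : ∀ i : Fin (p + 1), (f.toOrderHom i : ℕ) = f'.toOrderHom i) : f = f' := by
  apply SimplexCategory.Hom.ext
  apply OrderHom.ext
  funext i
  exact Fin.ext (h i)

theorem faceH_congr (z : Cell X U) {p q p' q' : ℕ}
    {f : SimplexCategory.mk p ⟶ SimplexCategory.mk z.P}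
    {g : Fin (q + 1) → Fin (z.Q + 1)} {hg : StrictMono g}
    {f' : SimplexCategory.mk p' ⟶ SimplexCategory.mk z.P}
    {g' : Fin (q' + 1) → Fin (z.Q + 1)} {hg' : StrictMono g'} (hp : p = p') (hq : q = q')
    (hf : ∀ (i : ℕ) (h : i < p + 1) (h' : i < p' + 1),
      (f.toOrderHom ⟨i, h⟩ : ℕ) = f'.toOrderHom ⟨i, h'⟩)
    (hgg : ∀ (i : ℕ) (h : i < q + 1) (h' : i < q' + 1), (g ⟨i, h⟩ : ℕ) = g' ⟨i, h'⟩) :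
    faceH z f g hg = faceH z f' g' hg' := by
  subst hp hq
  have h1 : f = f' := hom_ext (fun i => hf i.1 i.2 i.2)
  have h2 : g = g' := funext (fun i => Fin.ext (hgg i.1 i.2 i.2))
  subst h1 h2
  rfl

theorem faceH_faceH (z : Cell X U) {p q p' q' : ℕ}
    (f : SimplexCategory.mk p ⟶ SimplexCategory.mk z.P)
    (g : Fin (q + 1) → Fin (z.Q + 1)) (hg : StrictMono g)
    (f' : SimplexCategory.mk p' ⟶ SimplexCategory.mk p)
    (g' : Fin (q' + 1) → Fin (q + 1)) (hg' : StrictMono g') :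
    faceH (faceH z f g hg) f' g' hg' = faceH z (f' ≫ f) (g ∘ g') (hg.comp hg') := by
  refine Cell.ext2 rfl ?_
  simp [faceH]
  rfl

theorem faceH_id (z : Cell X U) {f : SimplexCategory.mk z.P ⟶ SimplexCategory.mk z.P}
    {g : Fin (z.Q + 1) → Fin (z.Q + 1)} {hg : StrictMono g}
    (hf : ∀ i, (f.toOrderHom i : ℕ) = i) (hgg : ∀ i, (g i : ℕ) = i) : faceH z f g hg = z := by
  have h1 : f = 𝟙 _ := hom_ext (fun i => by simpa using hf i)
  have h2 : g = id := funext (fun i => Fin.ext (hgg i))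
  subst h1 h2
  obtain ⟨P, Q, v, x⟩ := z
  refine Cell.ext2 rfl ?_
  simp

/-- valid sets of vertices -/
def good (N : ℕ) (σ : List ℕ) : Prop := σ ≠ [] ∧ σ.Sublist (List.range (N + 1))

theorem good.lt {N : ℕ} {σ : List ℕ} (h : good N σ) (i : Fin (σ.length - 1 + 1)) :
    σ.getD i 0 < N + 1 := by
  have h1 : i.1 < σ.length := by
    have := List.length_pos_iff.2 h.1
    have := i.2
    omega
  rw [List.getD_eq_getElem _ _ h1]
  exact List.mem_range.1 (h.2.subset (List.getElem_mem _))

theorem good.mono {N : ℕ} {σ : List ℕ} (h : good N σ) {i j : ℕ} (hij : i < j)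
    (hj : j < σ.length - 1 + 1) : σ.getD i 0 < σ.getD j 0 := by
  have h1 : j < σ.length := by
    have := List.length_pos_iff.2 h.1
    omega
  rw [List.getD_eq_getElem _ _ h1, List.getD_eq_getElem _ _ (by omega)]
  have := (List.pairwise_lt_range (n := N + 1)).sublist h.2
  exact List.pairwise_iff_getElem.1 this i j (by omega) h1 hij

/-- the map determined by a list of vertices -/
def vf {N : ℕ} (σ : List ℕ) (h : good N σ) : Fin (σ.length - 1 + 1) → Fin (N + 1) :=
  fun i => ⟨σ.getD i 0, h.lt i⟩

theorem vf_mono {N : ℕ} (σ : List ℕ) (h : good N σ) : StrictMono (vf σ h) :=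
  fun a b hab => Fin.mk_lt_mk.2 (h.mono hab b.2)

/-- the simplicial operator determined by a list of vertices -/
def vh {N : ℕ} (σ : List ℕ) (h : good N σ) :
    SimplexCategory.mk (σ.length - 1) ⟶ SimplexCategory.mk N :=
  SimplexCategory.mkHom ⟨vf σ h, (vf_mono σ h).monotone⟩

theorem vh_apply {N : ℕ} (σ : List ℕ) (h : good N σ) (i) :
    ((vh σ h).toOrderHom i : ℕ) = σ.getD i 0 := rfl

/-- face determined by lists of vertices -/
def face (z : Cell X U) (σ τ : List ℕ) (hσ : good z.P σ) (hτ : good z.Q τ) : Cell X U :=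
  faceH z (vh σ hσ) (vf τ hτ) (vf_mono τ hτ)

variable (T : MVTotStr R X U)

/-- evaluation at a cell -/
def ev (z : Cell X U) : T.Tot.carrier →ₗ[R] R :=
  LinearMap.proj (R := R) (φ := fun _ => R) z.x ∘ₗ LinearMap.proj z.v ∘ₗ
    LinearMap.proj (⟨(z.P, z.Q), rfl⟩ : MVIdx ((z.P : ℤ) + z.Q)) ∘ₗ
    (T.κ ((z.P : ℤ) + z.Q)).toLinearMap ∘ₗ prj T.Tot ((z.P : ℤ) + z.Q)

theorem ev_eq {n : ℤ} (α : T.Tot.grading n) (p q : ℕ) (h : (p : ℤ) + q = n)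
    (v : OrdTuple I q) (x : InterSimp X U v.1 p) :
    T.κ n α ⟨(p, q), h⟩ v x = ev T ⟨p, q, v, x⟩ α.1 := by
  subst h
  show _ = T.κ _ (prj T.Tot _ α.1) (⟨(p, q), rfl⟩ : MVIdx ((p : ℤ) + q)) v x
  rw [prj_same _ α.2]

theorem ev_ne {n : ℤ} {a : T.Tot.carrier} (ha : a ∈ T.Tot.grading n) (z : Cell X U)
    (h : (z.P : ℤ) + z.Q ≠ n) : ev T z a = 0 := by
  show T.κ _ (prj T.Tot _ a) (⟨(z.P, z.Q), rfl⟩ : MVIdx ((z.P : ℤ) + z.Q)) z.v z.x = 0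
  rw [prj_ne _ ha (Ne.symm h), map_zero]; rfl

theorem ev_inj {a : T.Tot.carrier} (h : ∀ z : Cell X U, ev T z a = 0) : a = 0 := by
  refine prj_inj _ (fun n => (T.κ n).injective ?_)
  rw [map_zero]
  funext ⟨⟨p, q⟩, hpq⟩ v x
  have hpq' : (p : ℤ) + q = n := hpq
  subst hpq'
  exact h ⟨p, q, v, x⟩

open Classical in
/-- restriction of a cochain to a cell -/
def zstar (z : Cell X U) (a : T.Tot.carrier) : UM R := fun σ τ =>
  if h : good z.P σ ∧ good z.Q τ then ev T (face z σ τ h.1 h.2) a else 0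

theorem zstar_pos (z : Cell X U) (a : T.Tot.carrier) {σ τ : List ℕ} (h1 : good z.P σ)
    (h2 : good z.Q τ) : zstar T z a σ τ = ev T (face z σ τ h1 h2) a := by
  rw [zstar, dif_pos ⟨h1, h2⟩]

theorem zstar_neg (z : Cell X U) (a : T.Tot.carrier) {σ τ : List ℕ}
    (h : ¬ (good z.P σ ∧ good z.Q τ)) : zstar T z a σ τ = 0 := by
  rw [zstar, dif_neg h]

theorem zstar_lin (z : Cell X U) (r s : R) (a b : T.Tot.carrier) :
    zstar T z (r • a + s • b) = r • zstar T z a + s • zstar T z b := by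
  funext σ τ
  by_cases h : good z.P σ ∧ good z.Q τ
  · simp [zstar_pos T z _ h.1 h.2]
  · simp [zstar_neg T z _ h]

theorem zstar_mem (z : Cell X U) {n : ℤ} {a : T.Tot.carrier} (ha : a ∈ T.Tot.grading n) :
    zstar T z a ∈ UHom n := by
  intro σ τ hst
  by_cases h : good z.P σ ∧ good z.Q τ
  · rw [zstar_pos T z _ h.1 h.2]
    refine ev_ne T ha _ (fun hh => hst ⟨h.1.1, h.2.1, ?_⟩)
    have h1 := List.length_pos_iff.2 h.1.1
    have h2 := List.length_pos_iff.2 h.2.1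
    simp only [face, faceH] at hh
    simp only [dm]
    omega
  · exact zstar_neg T z _ h

theorem good_range (N : ℕ) : good N (List.range (N + 1)) := ⟨by simp, List.Sublist.refl _⟩

theorem zstar_top (z : Cell X U) (a : T.Tot.carrier) :
    zstar T z a (List.range (z.P + 1)) (List.range (z.Q + 1)) = ev T z a := by
  rw [zstar_pos T z a (good_range _) (good_range _)]
  have e : face z _ _ (good_range z.P) (good_range z.Q) = z := by
    refine (faceH_congr z (p' := z.P) (q' := z.Q) (f' := 𝟙 _) (g' := id) (hg' := strictMono_id)
      ?_ ?_ ?_ ?_).trans (faceH_id z ?_ ?_)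
    · simp
    · simp
    · intro i h h'
      rw [vh_apply]
      simp [h']
    · intro i h h'
      simp [vf, h']
    · intro i; simp
    · intro i; simp
  rw [e]

end cells
end MVH

end


noncomputable section
open scoped TensorProduct
set_option linter.unusedSectionVars false
set_option linter.unusedSimpArgs false
set_option linter.unusedVariables false
namespace MVH

section sums2
variable {V : Type*} [AddCommGroup V] {α : Type*}

theorem del_sum (l : List α) (f : List α → V) :
    del f l = ∑ i ∈ Finset.range l.length, pm i • f (l.eraseIdx i) := by
  induction l generalizing f with
  | nil => simp [del]
  | cons a l ih =>
    rw [List.length_cons, Finset.sum_range_succ', del, ih, sub_eq_add_neg, add_comm]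
    simp [pm_zero, pm_add, pm_one, Finset.sum_neg_distrib]

theorem Sp_sum (l : List α) (F : List α → List α → V) :
    Sp l F = ∑ i ∈ Finset.range l.length, F (l.take (i + 1)) (l.drop i) := by
  induction l generalizing F with
  | nil => simp [Sp]
  | cons a l ih =>
    rw [List.length_cons, Finset.sum_range_succ', Sp, ih, add_comm]
    simp
end sums2

section cells
open CategoryTheory
variable {R : Type} [CommRing R] {X : SSet.{0}} {I : Type} [LinearOrder I] {U : I → SubSSet X}
variable (T : MVTotStr R X U)

theorem zstar_face (z : Cell X U) (a : T.Tot.carrier) {σ τ : List ℕ} (h1 : good z.P σ)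
    (h2 : good z.Q τ) {p q : ℕ} (hp : σ.length = p + 1) (hq : τ.length = q + 1)
    (f : SimplexCategory.mk p ⟶ SimplexCategory.mk z.P)
    (g : Fin (q + 1) → Fin (z.Q + 1)) (hg : StrictMono g)
    (hf : ∀ (i : ℕ) (h : i < p + 1), σ.getD i 0 = (f.toOrderHom ⟨i, h⟩ : ℕ))
    (hgg : ∀ (i : ℕ) (h : i < q + 1), τ.getD i 0 = (g ⟨i, h⟩ : ℕ)) :
    zstar T z a σ τ = ev T (faceH z f g hg) a := by
  rw [zstar_pos T z a h1 h2]
  have e : face z σ τ h1 h2 = faceH z f g hg := by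
    refine faceH_congr z ?_ ?_ ?_ ?_
    · omega
    · omega
    · intro i h h'
      rw [vh_apply]; exact hf i h'
    · intro i h h'
      exact hgg i h'
  rw [e]

theorem zstar_cell {P Q : ℕ} (v : OrdTuple I Q) (x : InterSimp X U v.1 P) (a : T.Tot.carrier)
    {σ τ : List ℕ} (h1 : good P σ) (h2 : good Q τ) {p q : ℕ} (hp : σ.length = p + 1)
    (hq : τ.length = q + 1)
    (f : SimplexCategory.mk p ⟶ SimplexCategory.mk P)
    (hf : ∀ (i : ℕ) (h : i < p + 1), σ.getD i 0 = (f.toOrderHom ⟨i, h⟩ : ℕ))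
    (v' : OrdTuple I q) (x' : InterSimp X U v'.1 p)
    (hv : ∀ (i : ℕ) (h : i < q + 1) (h' : τ.getD i 0 < Q + 1), v'.1 ⟨i, h⟩ = v.1 ⟨τ.getD i 0, h'⟩)
    (hx : x'.1 = X.map f.op x.1) :
    zstar T ⟨P, Q, v, x⟩ a σ τ = ev T ⟨p, q, v', x'⟩ a := by
  have hb : ∀ i : Fin (q + 1), τ.getD i 0 < Q + 1 := fun i => h2.lt ⟨i.1, by omega⟩
  have e := zstar_face T ⟨P, Q, v, x⟩ a h1 h2 hp hq f (fun i => ⟨τ.getD i 0, hb i⟩)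
    (fun i j hij => Fin.mk_lt_mk.2 (h2.mono hij (by omega))) hf (fun i h => rfl)
  rw [e]
  have e2 : faceH (⟨P, Q, v, x⟩ : Cell X U) f (fun i => ⟨τ.getD i 0, hb i⟩)
    (fun i j hij => Fin.mk_lt_mk.2 (h2.mono hij (by omega))) = ⟨p, q, v', x'⟩ :=
    Cell.ext2 (funext fun i => (hv i.1 i.2 (hb i)).symm) hx.symm
  rw [e2]

theorem getD_range {n i : ℕ} (h : i < n) : (List.range n).getD i 0 = i := by
  simp [h]

theorem getD_erase {n k i : ℕ} (h : i < n) (hk : k < n + 1) :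
    ((List.range (n + 1)).eraseIdx k).getD i 0 = if i < k then i else i + 1 := by
  rw [List.getD_eq_getElem _ _ (by rw [List.length_eraseIdx]; simp; split <;> omega)]
  rw [List.getElem_eraseIdx]
  split <;> simp

theorem succAbove_val {n : ℕ} (k : Fin (n + 1)) (i : Fin n) :
    (k.succAbove i : ℕ) = if i.1 < k.1 then i.1 else i.1 + 1 := by
  simp only [Fin.succAbove, Fin.lt_def, Fin.val_castSucc]
  split <;> simp

theorem good_erase {n k : ℕ} (hk : k < n + 2) : good (n + 1) ((List.range (n + 2)).eraseIdx k) := by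
  refine ⟨?_, List.eraseIdx_sublist _ _⟩
  rw [← List.length_pos_iff, List.length_eraseIdx]; simp; split <;> omega

theorem simpCast_rfl {a : ℕ} (h : a = a) (x : X.simplex a) : X.simpCast h x = x := rfl

theorem ev_d (z : Cell X U) {n : ℤ} {a : T.Tot.carrier} (ha : a ∈ T.Tot.grading n) :
    ev T z (T.Tot.d a) =
      ud (zstar T z a) (List.range (z.P + 1)) (List.range (z.Q + 1)) := by
  have hm := zstar_mem T z ha
  by_cases hn : (z.P : ℤ) + z.Q = n + 1
  swap
  · rw [ev_ne T (T.Tot.d_mem ha) z hn]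
    refine (ud_mem hm _ _ (fun h => hn ?_)).symm
    have := h.2.2
    simpa [dm] using this
  obtain ⟨P, Q, v, x⟩ := z
  have e := T.κ_d n ⟨a, ha⟩ P Q hn v x
  rw [ev_eq] at e
  refine e.trans ?_
  rw [ud]
  have hdm : dm (List.range (P + 1)) = (P : ℤ) := by simp [dm]
  rw [hdm]
  congr 1
  · rcases P with _ | P
    · rw [dif_neg (by omega)]
      simp [del, List.range_succ, UHom_nil_left hm]
    · rw [dif_pos (by omega), del_sum, List.length_range, Finset.sum_range]
      refine Finset.sum_congr rfl (fun i _ => ?_)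
      refine congrArg (fun y => pm (i : ℕ) • y) ((ev_eq T ⟨a, ha⟩ P Q ?_ _ _).trans ?_)
      · simp at hn; omega
      refine (zstar_cell T v x a (good_erase i.2) (good_range _) (p := P) (q := Q) ?_ ?_
        (SimplexCategory.δ i) ?_ v _ ?_ ?_).symm
      · rw [List.length_eraseIdx]; simp
      · simp
      · intro j hj
        rw [getD_erase hj i.2]
        exact (succAbove_val i ⟨j, hj⟩).symm
      · intro j hj h'
        exact congrArg v.1 (Fin.ext (getD_range hj).symm)
      · rfl
  · congr 1
    rcases Q with _ | Q
    · rw [dif_neg (by omega)]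
      simp [del, List.range_succ, UHom_nil_right hm]
    · rw [dif_pos (by omega), del_sum, List.length_range, Finset.sum_range]
      refine Finset.sum_congr rfl (fun i _ => ?_)
      refine congrArg (fun y => pm (i : ℕ) • y) ((ev_eq T ⟨a, ha⟩ P Q ?_ _ _).trans ?_)
      · simp at hn; omega
      refine (zstar_cell T v x a (good_range _) (good_erase i.2) (p := P) (q := Q) ?_ ?_
        (𝟙 _) ?_ _ _ ?_ ?_).symm
      · simp
      · rw [List.length_eraseIdx]; simp
      · intro j hj
        rw [getD_range hj]; simp
      · intro j hj h'
        show v.1 _ = v.1 _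
        refine congrArg v.1 (Fin.ext ?_)
        show _ = List.getD _ _ _
        rw [getD_erase hj i.2]
        exact succAbove_val i ⟨j, hj⟩
      · simp

end cells
end MVH

end


noncomputable section
open scoped TensorProduct
set_option linter.unusedSectionVars false
set_option linter.unusedSimpArgs false
set_option linter.unusedVariables false
namespace MVH

section cells
open CategoryTheory
variable {R : Type} [CommRing R] {X : SSet.{0}} {I : Type} [LinearOrder I] {U : I → SubSSet X}
variable (T : MVTotStr R X U)

theorem front_cast {P p r : ℕ} (h : P = p + r) (F : SimplexCategory.mk p ⟶ SimplexCategory.mk P)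
    (hF : ∀ i, (F.toOrderHom i : ℕ) = i) (x : X.simplex P) :
    X.map (frontHom p r).op (X.simpCast h x) = X.map F.op x := by
  subst h
  have : F = frontHom p r := hom_ext (fun i => by rw [hF]; rfl)
  subst this
  rfl

theorem back_cast {P p r : ℕ} (h : P = p + r) (F : SimplexCategory.mk r ⟶ SimplexCategory.mk P)
    (hF : ∀ i, (F.toOrderHom i : ℕ) = p + i) (x : X.simplex P) :
    X.map (backHom p r).op (X.simpCast h x) = X.map F.op x := by
  subst h
  have : F = backHom p r := hom_ext (fun i => by rw [hF]; rfl)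
  subst this
  rfl

/-- front inclusion -/
def frH {p P : ℕ} (h : p ≤ P) : SimplexCategory.mk p ⟶ SimplexCategory.mk P :=
  SimplexCategory.mkHom ⟨fun i => ⟨i.1, by have := i.isLt; omega⟩,
    fun a b h => by simpa [Fin.mk_le_mk] using h⟩

/-- back inclusion -/
def bkH {p P : ℕ} (h : p ≤ P) : SimplexCategory.mk (P - p) ⟶ SimplexCategory.mk P :=
  SimplexCategory.mkHom ⟨fun i => ⟨p + i.1, by have := i.isLt; omega⟩,
    fun a b h => by simpa [Fin.mk_le_mk] using h⟩

theorem good_take {N i : ℕ} : good N ((List.range (N + 1)).take (i + 1)) := by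
  refine ⟨?_, List.take_sublist _ _⟩
  rw [← List.length_pos_iff]; simp

theorem good_drop {N i : ℕ} (h : i < N + 1) : good N ((List.range (N + 1)).drop i) := by
  refine ⟨?_, List.drop_sublist _ _⟩
  rw [← List.length_pos_iff]; simp; omega

theorem getD_take {N i j : ℕ} (h : i < N + 1) (hj : j < i + 1) :
    ((List.range (N + 1)).take (i + 1)).getD j 0 = j := by
  rw [List.getD_eq_getElem _ _ (by simp; omega)]
  simp

theorem getD_drop {N i j : ℕ} (h : i < N + 1) (hj : j < N - i + 1) :
    ((List.range (N + 1)).drop i).getD j 0 = i + j := by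
  rw [List.getD_eq_getElem _ _ (by simp; omega)]
  simp

theorem ev_mul (z : Cell X U) {n n' : ℤ} {a b : T.Tot.carrier} (ha : a ∈ T.Tot.grading n)
    (hb : b ∈ T.Tot.grading n') :
    ev T z (a * b) =
      ucup (zstar T z a) (zstar T z b) (List.range (z.P + 1)) (List.range (z.Q + 1)) := by
  have hma := zstar_mem T z ha
  have hmb := zstar_mem T z hb
  by_cases hn : (z.P : ℤ) + z.Q = n + n'
  swap
  · rw [ev_ne T (T.Tot.mul_mem ha hb) z hn]
    refine (ucup_mem hma hmb _ _ (fun h => hn ?_)).symm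
    have := h.2.2
    simpa [dm] using this
  obtain ⟨P, Q, v, x⟩ := z
  have e := T.κ_mul n n' ⟨a, ha⟩ ⟨b, hb⟩ P Q hn v x
  rw [ev_eq] at e
  refine e.trans ?_
  rw [ucup, Sp_sum, List.length_range]
  refine Finset.sum_congr rfl (fun p hp => ?_)
  rw [Sp_sum, List.length_range]
  refine Finset.sum_congr rfl (fun q hq => ?_)
  have hp' : p < P + 1 := Finset.mem_range.1 hp
  have hq' : q < Q + 1 := Finset.mem_range.1 hq
  have d1 : dm ((List.range (Q + 1)).take (q + 1)) = (q : ℤ) := by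
    simp [dm]; omega
  have d2 : dm ((List.range (P + 1)).drop p) = ((P - p : ℕ) : ℤ) := by
    simp [dm]; omega
  have d3 : dm ((List.range (P + 1)).take (p + 1)) = (p : ℤ) := by
    simp [dm]; omega
  have d4 : dm ((List.range (Q + 1)).drop q) = ((Q - q : ℕ) : ℤ) := by
    simp [dm]; omega
  dsimp only
  rw [d1, d2]
  by_cases hc : (p : ℤ) + q = n ∧ ((P - p : ℕ) : ℤ) + ((Q - q : ℕ) : ℤ) = n'
  · rw [dif_pos ⟨by omega, by omega, hc.1, hc.2⟩]
    refine congrArg (fun y => pm ((q : ℤ) * ((P - p : ℕ) : ℤ)) • y) ?_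
    refine congrArg₂ (fun y y' => y * y') ?_ ?_
    · refine (ev_eq T ⟨a, ha⟩ p q hc.1 _ _).trans ?_
      refine (zstar_cell T v x a good_take good_take (p := p) (q := q) ?_ ?_
        (frH (show p ≤ P by omega)) ?_ _ _ ?_ ?_).symm
      · simp; omega
      · simp; omega
      · intro j hj
        rw [getD_take hp' hj]; rfl
      · intro j hj h'
        exact congrArg v.1 (Fin.ext (getD_take hq' hj).symm)
      · exact front_cast _ _ (fun i => rfl) _
    · refine (ev_eq T ⟨b, hb⟩ (P - p) (Q - q) hc.2 _ _).trans ?_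
      refine (zstar_cell T v x b (good_drop hp') (good_drop hq') (p := P - p) (q := Q - q) ?_ ?_
        (bkH (show p ≤ P by omega)) ?_ _ _ ?_ ?_).symm
      · simp; omega
      · simp; omega
      · intro j hj
        rw [getD_drop hp' hj]; rfl
      · intro j hj h'
        exact congrArg v.1 (Fin.ext (getD_drop hq' hj).symm)
      · exact back_cast _ _ (fun i => rfl) _
  · rw [dif_neg (fun h => hc ⟨h.2.2.1, h.2.2.2⟩)]
    by_cases hc1 : (p : ℤ) + q = n
    · rw [hmb ((List.range (P + 1)).drop p) ((List.range (Q + 1)).drop q)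
        (fun h => hc ⟨hc1, by rw [← d2, ← d4]; exact h.2.2⟩)]
      simp
    · rw [hma ((List.range (P + 1)).take (p + 1)) ((List.range (Q + 1)).take (q + 1))
        (fun h => hc1 (by rw [← d1, ← d3]; exact h.2.2))]
      simp

theorem ev_one {v : OrdTuple I 0} (x : InterSimp X U v.1 0) : ev T ⟨0, 0, v, x⟩ 1 = 1 := by
  let β : T.Tot.grading 0 := (T.κ 0).symm (fun _ _ _ => 1)
  have hβ : ev T ⟨0, 0, v, x⟩ β.1 = 1 := by
    rw [← ev_eq T β 0 0 (by simp) v x]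
    simp [β]
  have h := ev_mul T ⟨0, 0, v, x⟩ T.Tot.one_mem β.2
  rw [one_mul, hβ] at h
  have t1 := zstar_top T ⟨0, 0, v, x⟩ 1
  have t2 := zstar_top T ⟨0, 0, v, x⟩ β.1
  rw [hβ] at t2
  simp [List.range_succ] at t1 t2
  simp [ucup, Sp, dm, pm_zero, List.range_succ, t1, t2] at h
  exact h.symm

theorem zstar_one (z : Cell X U) {s t : List ℕ} (hs : s.Sublist (List.range (z.P + 1)))
    (ht : t.Sublist (List.range (z.Q + 1))) : zstar T z 1 s t = uone s t := by
  by_cases h : s.length = 1 ∧ t.length = 1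
  · have g1 : good z.P s := ⟨by rw [← List.length_pos_iff]; omega, hs⟩
    have g2 : good z.Q t := ⟨by rw [← List.length_pos_iff]; omega, ht⟩
    have e1 := g1.lt ⟨0, by omega⟩
    have e2 := g2.lt ⟨0, by omega⟩
    rw [zstar_face T z 1 g1 g2 (p := 0) (q := 0) (by omega) (by omega)
      (SimplexCategory.mkHom ⟨fun _ => ⟨s.getD 0 0, e1⟩, fun _ _ _ => le_rfl⟩)
      (fun _ => ⟨t.getD 0 0, e2⟩) (fun a b hab => by omega)
      (fun i hi => by obtain rfl : i = 0 := by omega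
                      rfl)
      (fun i hi => by obtain rfl : i = 0 := by omega
                      rfl)]
    have : ev T (faceH z (SimplexCategory.mkHom ⟨fun _ => ⟨s.getD 0 0, e1⟩, fun _ _ _ => le_rfl⟩)
      (fun _ : Fin (0 + 1) => ⟨t.getD 0 0, e2⟩) (fun a b hab => by omega)) 1 = 1 := ev_one T _
    rw [this]
    simp [uone, h]
  · have h1 : zstar T z 1 s t = 0 := by
      refine zstar_mem T z T.Tot.one_mem s t (fun hh => h ?_)
      have a1 := List.length_pos_iff.2 hh.1
      have a2 := List.length_pos_iff.2 hh.2.1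
      have a3 := hh.2.2
      simp only [dm] at a3
      omega
    rw [h1]
    simp [uone, h]

theorem map_getD_sub {σ s : List ℕ} (h : s.Sublist (List.range σ.length)) :
    (s.map (fun i => σ.getD i 0)).Sublist σ := by
  have := h.map (fun i => σ.getD i 0)
  have e : (List.range σ.length).map (fun i => σ.getD i 0) = σ := by
    refine List.ext_getElem (by simp) (fun i h1 h2 => ?_)
    simp [h2]
  rwa [e] at this

theorem zstar_loc (z : Cell X U) {σ τ : List ℕ} (hσ : good z.P σ) (hτ : good z.Q τ)
    (a : T.Tot.carrier) :
    Loc (fun i => σ.getD i 0) (fun i => τ.getD i 0) (List.range σ.length) (List.range τ.length)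
      (zstar T (face z σ τ hσ hτ) a) (zstar T z a) := by
  intro s t hs ht
  have l1 : σ.length - 1 + 1 = σ.length := by
    have := List.length_pos_iff.2 hσ.1
    omega
  have l2 : τ.length - 1 + 1 = τ.length := by
    have := List.length_pos_iff.2 hτ.1
    omega
  by_cases hn : s ≠ [] ∧ t ≠ []
  swap
  · rw [zstar_neg, zstar_neg]
    · rintro ⟨h1, h2⟩
      exact hn ⟨by simpa using h1.1, by simpa using h2.1⟩
    · rintro ⟨h1, h2⟩
      exact hn ⟨h1.1, h2.1⟩
  have g1 : good (σ.length - 1) s := ⟨hn.1, by rw [l1]; exact hs⟩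
  have g2 : good (τ.length - 1) t := ⟨hn.2, by rw [l2]; exact ht⟩
  have k1 : good z.P (s.map (fun i => σ.getD i 0)) :=
    ⟨by simpa using hn.1, (map_getD_sub hs).trans hσ.2⟩
  have k2 : good z.Q (t.map (fun i => τ.getD i 0)) :=
    ⟨by simpa using hn.2, (map_getD_sub ht).trans hτ.2⟩
  have p1 := List.length_pos_iff.2 hn.1
  have p2 := List.length_pos_iff.2 hn.2
  rw [zstar_pos T _ a (σ := s) (τ := t) g1 g2]
  have e : face (face z σ τ hσ hτ) s t g1 g2 =
      faceH z (vh s g1 ≫ vh σ hσ) (vf τ hτ ∘ vf t g2) ((vf_mono _ _).comp (vf_mono _ _)) :=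
    faceH_faceH z _ _ _ _ _ _
  rw [e]
  symm
  refine zstar_face T z a k1 k2 ?_ ?_ _ _ _ ?_ ?_
  · simp; omega
  · simp; omega
  · intro i hi
    have : i < s.length := by omega
    have e1 : ((vh s g1 ≫ vh σ hσ).toOrderHom ⟨i, hi⟩ : ℕ) = σ.getD (s.getD i 0) 0 := rfl
    rw [e1]
    simp [this]
  · intro i hi
    have : i < t.length := by omega
    have e1 : ((vf τ hτ ∘ vf t g2) ⟨i, hi⟩ : ℕ) = τ.getD (t.getD i 0) 0 := rfl
    rw [e1]
    simp [this]

/-- the base cell -/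
def z0 : Cell X U :=
  ⟨0, 0, ⟨fun _ => T.pti, fun a b hab => absurd (Fin.lt_def.mp hab)
        (by have ha := a.isLt; have hb := b.isLt; omega)⟩, T.ptx⟩

theorem aug_eq {n : ℤ} {a : T.Tot.carrier} (ha : a ∈ T.Tot.grading n) :
    T.Tot.aug a = ev T (z0 T) a := by
  by_cases h : n = 0
  · subst h
    have := T.κ_aug ⟨a, ha⟩
    refine this.trans ?_
    exact ev_eq T ⟨a, ha⟩ 0 0 _ _ _
  · rw [T.Tot.aug_graded ha h, ev_ne T ha]
    simpa [z0] using Ne.symm h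

end cells
end MVH

end


noncomputable section
open scoped TensorProduct
set_option linter.unusedSectionVars false
set_option linter.unusedSimpArgs false
set_option linter.unusedVariables false
namespace MVH

section cells
open CategoryTheory
variable {R : Type} [CommRing R] {X : SSet.{0}} {I : Type} [LinearOrder I] {U : I → SubSSet X}
variable (T : MVTotStr R X U)

theorem map_getD_range (σ : List ℕ) : (List.range σ.length).map (fun i => σ.getD i 0) = σ := by
  refine List.ext_getElem (by simp) (fun i h1 h2 => ?_)
  simp [h2]

theorem face_P (z : Cell X U) {σ τ : List ℕ} (hσ : good z.P σ) (hτ : good z.Q τ) :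
    List.range ((face z σ τ hσ hτ).P + 1) = List.range σ.length := by
  have := List.length_pos_iff.2 hσ.1
  show List.range (σ.length - 1 + 1) = _
  congr 1; omega

theorem face_Q (z : Cell X U) {σ τ : List ℕ} (hσ : good z.P σ) (hτ : good z.Q τ) :
    List.range ((face z σ τ hσ hτ).Q + 1) = List.range τ.length := by
  have := List.length_pos_iff.2 hτ.1
  show List.range (τ.length - 1 + 1) = _
  congr 1; omega

theorem zstar_mul (z : Cell X U) {n n' : ℤ} {a b : T.Tot.carrier} (ha : a ∈ T.Tot.grading n)
    (hb : b ∈ T.Tot.grading n') {s t : List ℕ} (hs : s.Sublist (List.range (z.P + 1)))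
    (ht : t.Sublist (List.range (z.Q + 1))) :
    zstar T z (a * b) s t = ucup (zstar T z a) (zstar T z b) s t := by
  by_cases h : s ≠ [] ∧ t ≠ []
  · have g1 : good z.P s := ⟨h.1, hs⟩
    have g2 : good z.Q t := ⟨h.2, ht⟩
    rw [zstar_pos T z _ g1 g2, ev_mul T _ ha hb, face_P, face_Q]
    have := (Loc.ucup (zstar_loc T z g1 g2 a) (zstar_loc T z g1 g2 b)) _ _
      (List.Sublist.refl _) (List.Sublist.refl _)
    rw [this, map_getD_range, map_getD_range]
  · have := ucup_mem (zstar_mem T z ha) (zstar_mem T z hb)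
    rw [this s t (fun q => h ⟨q.1, q.2.1⟩), zstar_neg]
    exact fun q => h ⟨q.1.1, q.2.1⟩

theorem zstar_d (z : Cell X U) {n : ℤ} {a : T.Tot.carrier} (ha : a ∈ T.Tot.grading n)
    {s t : List ℕ} (hs : s.Sublist (List.range (z.P + 1)))
    (ht : t.Sublist (List.range (z.Q + 1))) :
    zstar T z (T.Tot.d a) s t = ud (zstar T z a) s t := by
  by_cases h : s ≠ [] ∧ t ≠ []
  · have g1 : good z.P s := ⟨h.1, hs⟩
    have g2 : good z.Q t := ⟨h.2, ht⟩
    rw [zstar_pos T z _ g1 g2, ev_d T _ ha, face_P, face_Q]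
    have := (Loc.ud (zstar_loc T z g1 g2 a)) _ _
      (List.Sublist.refl _) (List.Sublist.refl _)
    rw [this, map_getD_range, map_getD_range]
  · have := ud_mem (zstar_mem T z ha)
    rw [this s t (fun q => h ⟨q.1, q.2.1⟩), zstar_neg]
    exact fun q => h ⟨q.1.1, q.2.1⟩

/-- restriction to a cell as a graded relation -/
def zrel (z : Cell X U) : GRel (AG T.Tot) (UG R) where
  Q n := { carrier := {p | p.1 ∈ T.Tot.grading n ∧ p.2 ∈ UHom n ∧
            Loc id id (List.range (z.P + 1)) (List.range (z.Q + 1)) (zstar T z p.1) p.2}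
           zero_mem' := by
            refine ⟨Submodule.zero_mem _, AddSubgroup.zero_mem _, fun s t _ _ => ?_⟩
            have := zstar_lin T z 0 0 0 0
            simp only [zero_smul, add_zero] at this
            simp only [Prod.fst_zero, Prod.snd_zero]
            rw [this]; rfl
           add_mem' := by
            rintro a b ⟨a1, a2, a3⟩ ⟨b1, b2, b3⟩
            refine ⟨Submodule.add_mem _ a1 b1, AddSubgroup.add_mem _ a2 b2, fun s t h1 h2 => ?_⟩
            have := zstar_lin T z 1 1 a.1 b.1
            simp only [one_smul] at this
            simp only [Prod.fst_add, Prod.snd_add, this, Pi.add_apply, a3 s t h1 h2, b3 s t h1 h2]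
           neg_mem' := by
            rintro a ⟨a1, a2, a3⟩
            refine ⟨Submodule.neg_mem _ a1, AddSubgroup.neg_mem _ a2, fun s t h1 h2 => ?_⟩
            have := zstar_lin T z (-1) 0 a.1 0
            simp only [neg_smul, one_smul, smul_zero, add_zero, zero_smul] at this
            simp only [Prod.fst_neg, Prod.snd_neg, this, Pi.neg_apply, a3 s t h1 h2] }
  mul := by
    rintro i j a a' b b' ⟨a1, a2, a3⟩ ⟨b1, b2, b3⟩
    refine ⟨T.Tot.mul_mem a1 b1, ucup_mem a2 b2, fun s t h1 h2 => ?_⟩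
    refine (zstar_mul T z a1 b1 h1 h2).trans ?_
    exact (Loc.ucup a3 b3) s t h1 h2
  d := by
    rintro i a a' ⟨a1, a2, a3⟩
    refine ⟨T.Tot.d_mem a1, ud_mem a2, fun s t h1 h2 => ?_⟩
    refine (zstar_d T z a1 h1 h2).trans ?_
    exact (Loc.ud a3) s t h1 h2

/-- restriction of words -/
def zl (z : Cell X U) (l : List (ℤ × T.Tot.carrier)) : List (ℤ × UM R) :=
  l.map (fun g => (g.1, zstar T z g.2))

theorem zl_bd (z : Cell X U) (l : List (ℤ × T.Tot.carrier)) : bd (zl T z l) = bd l := by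
  induction l with
  | nil => rfl
  | cons g l ih =>
    have : zl T z (g :: l) = (g.1, zstar T z g.2) :: zl T z l := rfl
    rw [this, bd_cons, bd_cons, ih]

theorem zl_hom (z : Cell X U) {l : List (ℤ × T.Tot.carrier)} (h : HomL (AG T.Tot) l) :
    HomL (UG R) (zl T z l) := by
  intro g hg
  obtain ⟨g', h1, rfl⟩ := List.mem_map.1 hg
  exact zstar_mem T z (h g' h1)

theorem zl_rel (z : Cell X U) {l : List (ℤ × T.Tot.carrier)} (h : HomL (AG T.Tot) l) :
    (zrel T z).RL l (zl T z l) := by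
  rw [GRel.RL, zl, List.forall₂_map_right_iff, List.forall₂_same]
  intro g hg
  refine ⟨rfl, h g hg, zstar_mem T z (h g hg), fun s t _ _ => ?_⟩
  simp

theorem zl_lin (z : Cell X U) {r s : R} {l l' l'' : List (ℤ × T.Tot.carrier)}
    (h : Lin3 r s l l' l'') : Lin3 r s (zl T z l) (zl T z l') (zl T z l'') := by
  induction h with
  | head n a b l =>
    have := Lin3.head (r := r) (s := s) n (zstar T z a) (zstar T z b) (zl T z l)
    rw [← zstar_lin] at this
    exact this
  | tail g h ih => exact Lin3.tail _ ih

/-- the twisting cochain on tagged words -/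
def eA (l m : List (ℤ × T.Tot.carrier)) : T.Tot.carrier :=
  ((T.κ (bd l + bd m + 1)).symm (fun pq v x =>
    EE (zl T ⟨pq.1.1, pq.1.2, v, x⟩ l) (zl T ⟨pq.1.1, pq.1.2, v, x⟩ m)
      (List.range (pq.1.1 + 1)) (List.range (pq.1.2 + 1)))).1

theorem eA_mem (l m : List (ℤ × T.Tot.carrier)) : eA T l m ∈ T.Tot.grading (bd l + bd m + 1) :=
  ((T.κ (bd l + bd m + 1)).symm _).2

theorem ev_eA' (z : Cell X U) (l m : List (ℤ × T.Tot.carrier))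
    (h : (z.P : ℤ) + z.Q = bd l + bd m + 1) : ev T z (eA T l m) =
      EE (zl T z l) (zl T z m) (List.range (z.P + 1)) (List.range (z.Q + 1)) := by
  obtain ⟨p, q, v, x⟩ := z
  dsimp only at h
  rw [eA, ← ev_eq T _ p q h v x, LinearEquiv.apply_symm_apply]

theorem ev_eA (z : Cell X U) {l m : List (ℤ × T.Tot.carrier)} (hl : HomL (AG T.Tot) l)
    (hm : HomL (AG T.Tot) m) : ev T z (eA T l m) =
      EE (zl T z l) (zl T z m) (List.range (z.P + 1)) (List.range (z.Q + 1)) := by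
  by_cases h : (z.P : ℤ) + z.Q = bd l + bd m + 1
  · exact ev_eA' T z l m h
  · rw [ev_ne T (eA_mem T l m) z h]
    have := EE_mem (zl_hom T z hl) (zl_hom T z hm)
    rw [this]
    rintro ⟨_, _, h3⟩
    rw [zl_bd, zl_bd] at h3
    simp [dm] at h3
    omega

theorem ev_ext {a b : T.Tot.carrier} (h : ∀ z : Cell X U, ev T z a = ev T z b) : a = b := by
  rw [← sub_eq_zero]
  refine ev_inj T (fun z => ?_)
  rw [map_sub, h, sub_self]

theorem eA_ML_left (m : List (ℤ × T.Tot.carrier)) : ML R (fun l => eA T l m) := by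
  intro r s l l' l'' h
  refine ev_ext T (fun z => ?_)
  obtain ⟨b1, b2⟩ := h.bd_eq
  by_cases hz : (z.P : ℤ) + z.Q = bd l'' + bd m + 1
  · rw [map_add, map_smul, map_smul, ev_eA' T z _ _ hz, ev_eA' T z _ _ (by rw [b1]; exact hz),
      ev_eA' T z _ _ (by rw [b2]; exact hz)]
    have := EE_ML_left (zl T z m) r s _ _ _ (zl_lin T z h)
    dsimp only at this
    rw [this]
    rfl
  · rw [map_add, map_smul, map_smul, ev_ne T (eA_mem T _ _) z hz,
      ev_ne T (eA_mem T _ _) z (by rw [b1]; exact hz),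
      ev_ne T (eA_mem T _ _) z (by rw [b2]; exact hz)]
    simp

theorem eA_ML_right (m : List (ℤ × T.Tot.carrier)) : ML R (eA T m) := by
  intro r s l l' l'' h
  refine ev_ext T (fun z => ?_)
  obtain ⟨b1, b2⟩ := h.bd_eq
  by_cases hz : (z.P : ℤ) + z.Q = bd m + bd l'' + 1
  · rw [map_add, map_smul, map_smul, ev_eA' T z _ _ hz, ev_eA' T z _ _ (by rw [b1]; exact hz),
      ev_eA' T z _ _ (by rw [b2]; exact hz), EE_ML_right (zl T z m) r s _ _ _ (zl_lin T z h)]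
    rfl
  · rw [map_add, map_smul, map_smul, ev_ne T (eA_mem T _ _) z hz,
      ev_ne T (eA_mem T _ _) z (by rw [b1]; exact hz),
      ev_ne T (eA_mem T _ _) z (by rw [b2]; exact hz)]
    simp

theorem RL_homL (z : Cell X U) {l l'} (h : (zrel T z).RL l l') : HomL (AG T.Tot) l := by
  induction h with
  | nil => exact (HomL_nil _)
  | cons h _ ih => exact (HomL_cons _).2 ⟨h.2.1, ih⟩

theorem RL_homR (z : Cell X U) {l l'} (h : (zrel T z).RL l l') : HomL (UG R) l' := by
  induction h with
  | nil => exact (HomL_nil _)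
  | cons h _ ih => exact (HomL_cons _).2 ⟨by rw [← h.1]; exact h.2.2.1, ih⟩

theorem good_inj {N : ℕ} {σ : List ℕ} (h : good N σ) :
    Set.InjOn (fun i => σ.getD i 0) {z | z ∈ List.range σ.length} := by
  have hp := List.length_pos_iff.2 h.1
  intro i hi j hj hij
  simp only [Set.mem_ofPred_eq, List.mem_range] at hi hj
  rcases lt_trichotomy i j with q | q | q
  · exact absurd hij (h.mono q (by omega)).ne
  · exact q
  · exact absurd hij (h.mono q (by omega)).ne'

theorem face_RL (z : Cell X U) {σ τ : List ℕ} (hσ : good z.P σ) (hτ : good z.Q τ) {l l'}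
    (h : (zrel T z).RL l l') :
    (locrel R (fun i => σ.getD i 0) (fun i => τ.getD i 0) (List.range σ.length)
      (List.range τ.length)).RL (zl T (face z σ τ hσ hτ) l) l' := by
  rw [GRel.RL, zl, List.forall₂_map_left_iff]
  refine List.Forall₂.imp ?_ h
  rintro a b ⟨h1, h2, h3, h4⟩
  refine ⟨h1, fun s t hs ht => ?_⟩
  refine (zstar_loc T z hσ hτ a.2 s t hs ht).trans ?_
  have := h4 _ _ ((map_getD_sub hs).trans hσ.2) ((map_getD_sub ht).trans hτ.2)
  simpa using this

theorem eA_rel (z : Cell X U) {l l' m m'} (hl : (zrel T z).RL l l') (hm : (zrel T z).RL m m') :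
    (eA T l m, EE l' m') ∈ (zrel T z).Q (bd l + bd m + 1) := by
  have he : EE l' m' ∈ UHom (R := R) (bd l + bd m + 1) := by
    rw [hl.bd_eq, hm.bd_eq]
    exact EE_mem (RL_homR T z hl) (RL_homR T z hm)
  refine ⟨eA_mem T l m, he, fun s t hs ht => ?_⟩
  simp only [List.map_id]
  by_cases h : s ≠ [] ∧ t ≠ []
  · have g1 : good z.P s := ⟨h.1, hs⟩
    have g2 : good z.Q t := ⟨h.2, ht⟩
    rw [zstar_pos T z _ g1 g2, ev_eA T _ (RL_homL T z hl) (RL_homL T z hm), face_P, face_Q]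
    have := EE_loc (good_inj g1) (good_inj g2) (face_RL T z g1 g2 hl) (face_RL T z g1 g2 hm) _ _
      (List.Sublist.refl _) (List.Sublist.refl _)
    rw [this, map_getD_range, map_getD_range]
  · rw [he s t (fun q => h ⟨q.1, q.2.1⟩), zstar_neg]
    exact fun q => h ⟨q.1.1, q.2.1⟩

theorem Th_eA {l m : List (ℤ × T.Tot.carrier)} (hl : HomL (AG T.Tot) l)
    (hm : HomL (AG T.Tot) m) : Th (AG T.Tot) (eA T) l m = 0 := by
  refine ev_inj T (fun z => ?_)
  have := Th_rel (zrel T z) (f := eA T) (f' := EE) (zl_rel T z hl) (zl_rel T z hm)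
    (fun x x' y y' hx hy => eA_rel T z hx hy)
  have h := this.2.2 _ _ (List.Sublist.refl _) (List.Sublist.refl _)
  simp only [List.map_id] at h
  rw [zstar_top, Th_zero _ _ _ (zl_hom T z hl) (zl_hom T z hm) rfl _ _ List.nodup_range
    List.nodup_range] at h
  exact h

theorem eA_nil_left {m : List (ℤ × T.Tot.carrier)} (hm : HomL (AG T.Tot) m) :
    eA T [] m = alA T.Tot m := by
  refine ev_ext T (fun z => ?_)
  rw [ev_eA T z (HomL_nil _) hm]
  show EE [] _ _ _ = _
  rw [EE_nil_left]
  match m with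
  | [] => exact (map_zero (ev T z)).symm
  | [b] => exact zstar_top T z b.2
  | _ :: _ :: _ => exact (map_zero (ev T z)).symm

theorem eA_nil_right {m : List (ℤ × T.Tot.carrier)} (hm : HomL (AG T.Tot) m) :
    eA T m [] = alA T.Tot m := by
  refine ev_ext T (fun z => ?_)
  rw [ev_eA T z hm (HomL_nil _)]
  show EE _ [] _ _ = _
  rw [EE_nil_right]
  match m with
  | [] => exact (map_zero (ev T z)).symm
  | [b] => exact zstar_top T z b.2
  | _ :: _ :: _ => exact (map_zero (ev T z)).symm

theorem eA_aug {l m : List (ℤ × T.Tot.carrier)} (hl : HomL (AG T.Tot) l)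
    (hm : HomL (AG T.Tot) m) (h : 1 < l.length + m.length) : T.Tot.aug (eA T l m) = 0 := by
  rw [aug_eq T (eA_mem T l m), ev_eA T _ hl hm]
  exact EE_vertex (zl_hom T _ hl) (zl_hom T _ hm) (by simpa [zl] using h) 0 0

open Classical in
/-- replace units by the universal unit -/
def zu (z : Cell X U) (l : List (ℤ × T.Tot.carrier)) : List (ℤ × UM R) :=
  l.map (fun g => if g = (0, 1) then ut else (g.1, zstar T z g.2))

theorem zu_rel (z : Cell X U) {l : List (ℤ × T.Tot.carrier)} (h : HomL (AG T.Tot) l) :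
    (zrel T z).RL l (zu T z l) := by
  rw [GRel.RL, zu, List.forall₂_map_right_iff, List.forall₂_same]
  intro g hg
  by_cases e : g = (0, 1)
  · subst e
    rw [if_pos rfl]
    refine ⟨rfl, T.Tot.one_mem, uone_mem, fun s t hs ht => ?_⟩
    simp only [List.map_id]
    exact zstar_one T z hs ht
  · rw [if_neg e]
    refine ⟨rfl, h g hg, zstar_mem T z (h g hg), fun s t _ _ => ?_⟩
    simp

theorem eA_van {l m : List (ℤ × T.Tot.carrier)} (hl : HomL (AG T.Tot) l)
    (hm : HomL (AG T.Tot) m) (h : 1 < l.length + m.length)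
    (hu : ((0 : ℤ), (1 : T.Tot.carrier)) ∈ l ∨ ((0 : ℤ), (1 : T.Tot.carrier)) ∈ m) :
    eA T l m = 0 := by
  refine ev_inj T (fun z => ?_)
  have r1 := zu_rel T z hl
  have r2 := zu_rel T z hm
  have h2 := (eA_rel T z r1 r2).2.2 _ _ (List.Sublist.refl _) (List.Sublist.refl _)
  simp only [List.map_id] at h2
  rw [zstar_top, EE_van (RL_homR T z r1) (RL_homR T z r2) (by simpa [zu] using h)] at h2
  · exact h2
  · rcases hu with hu | hu
    · exact Or.inl (List.mem_map.2 ⟨_, hu, by simp⟩)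
    · exact Or.inr (List.mem_map.2 ⟨_, hu, by simp⟩)

end cells
end MVH

end


noncomputable section
open scoped TensorProduct
set_option linter.unusedSectionVars false
set_option linter.unusedSimpArgs false
set_option linter.unusedVariables false
namespace MVH

section fin
variable {R : Type} [CommRing R] {X : SSet.{0}} {I : Type} [LinearOrder I] {U : I → SubSSet X}
variable (T : MVTotStr R X U)

/-- congruence for the bar differential on homogeneous words -/
theorem D1_homcongr {A : DGAlgebra R} {V : Type*} [AddCommGroup V]
    {F F' : List (ℤ × A.carrier) → V} {l} (hl : HomL (AG A) l)
    (h : ∀ x, HomL (AG A) x → F x = F' x) : D1 (AG A) F l = D1 (AG A) F' l := by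
  have key : ∀ x x', (hrel (AG A)).RL x x' → (F x - F' x, (0 : V)) ∈
      ((⊥ : AddSubgroup V).prod (⊤ : AddSubgroup V)) := fun x x' hx =>
    ⟨by simp [h x (HomL_of hx)], trivial⟩
  have := D1_rel (hrel (AG A)) ((⊥ : AddSubgroup V).prod (⊤ : AddSubgroup V)) (hrel_of hl)
    (F := fun x => F x - F' x) (F' := fun _ => 0) (fun x x' hx _ => key x x' hx)
  have h2 : D1 (AG A) (fun x => F x - F' x) l = 0 := this.1
  have e : (fun x => F x - F' x) = fun x => F x + (-1 : ℤ) • F' x := by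
    funext x; simp [sub_eq_add_neg]
  rw [e, D1_add, D1_zsmul] at h2
  rw [← sub_eq_zero, sub_eq_add_neg]
  simpa using h2

theorem midTw_tmul {A : DGAlgebra R} (BD : BarData A) (a b c d : A.Bar) :
    BD.midTw ((a ⊗ₜ b) ⊗ₜ (c ⊗ₜ d)) =
      (TensorProduct.assoc R A.Bar A.Bar (A.Bar ⊗[R] A.Bar)).symm
       ((LinearMap.lTensor A.Bar (TensorProduct.assoc R A.Bar A.Bar A.Bar).toLinearMap)
        (a ⊗ₜ (BD.tw (b ⊗ₜ c) ⊗ₜ d))) := by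
  simp [BarData.midTw, LinearMap.lTensor]

theorem zt_left {M N : Type} [AddCommGroup M] [AddCommGroup N] [Module R M] [Module R N] (c : ℤ)
    (x : M) (y : N) : (c • x) ⊗ₜ[R] y = c • (x ⊗ₜ[R] y) :=
  map_zsmul ((TensorProduct.mk R M N).flip y) c x

theorem zt_right {M N : Type} [AddCommGroup M] [AddCommGroup N] [Module R M] [Module R N] (c : ℤ)
    (x : M) (y : N) : x ⊗ₜ[R] (c • y) = c • (x ⊗ₜ[R] y) :=
  map_zsmul (TensorProduct.mk R M N x) c y

theorem midTw_sgn {A : DGAlgebra R} (BD : BarData A) (a b c d : A.Bar) (k : ℤ)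
    (h : BD.tw (b ⊗ₜ c) = k • (c ⊗ₜ[R] b)) :
    BD.midTw ((a ⊗ₜ b) ⊗ₜ (c ⊗ₜ d)) = (k : R) • ((a ⊗ₜ[R] c) ⊗ₜ[R] (b ⊗ₜ[R] d)) := by
  rw [midTw_tmul, h]
  have e : ∀ (x : A.Bar ⊗[R] A.Bar), k • x = (k : R) • x := fun x => (Int.cast_smul_eq_zsmul R k x).symm
  rw [e, ← TensorProduct.smul_tmul', TensorProduct.tmul_smul, map_smul, map_smul]
  simp

theorem main :
    ∃ BD : BarData T.Tot, ∃ E : T.Tot.Bar ⊗[R] T.Tot.Bar →ₗ[R] T.Tot.carrier,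
      IsTwistingCochain BD E ∧ IsNormalized E := by
  obtain ⟨BD, hdB, hsg, htw, hal, hΔ⟩ := exists_bd T.Tot
  obtain ⟨E, hE⟩ := exists_lin2 T.Tot.grading_internal (F := eA T) (eA_ML_left T) (eA_ML_right T)
  have hE' : ∀ l m : List (ℤ × T.Tot.carrier), HomL (AG T.Tot) l → HomL (AG T.Tot) m →
      E (tw_ R (l.map Prod.snd) ⊗ₜ tw_ R (m.map Prod.snd)) = eA T l m := hE
  have ul : ∀ b : T.Tot.Bar, E ((1 : T.Tot.Bar) ⊗ₜ[R] b) = BD.α b := by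
    intro b
    have : E ∘ₗ (TensorProduct.mk R T.Tot.Bar T.Tot.Bar 1) = BD.α := by
      refine tw_ext T.Tot.grading_internal (fun l hl => ?_)
      rw [hal]
      exact (hE' [] l (HomL_nil _) hl).trans (eA_nil_left T hl)
    exact LinearMap.congr_fun this b
  have ur : ∀ b : T.Tot.Bar, E (b ⊗ₜ[R] (1 : T.Tot.Bar)) = BD.α b := by
    intro b
    have : E ∘ₗ (TensorProduct.mk R T.Tot.Bar T.Tot.Bar).flip 1 = BD.α := by
      refine tw_ext T.Tot.grading_internal (fun l hl => ?_)
      rw [hal]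
      exact (hE' l [] hl (HomL_nil _)).trans (eA_nil_right T hl)
    exact LinearMap.congr_fun this b
  refine ⟨BD, E, ⟨?_, ul, ur, ?_⟩, ⟨?_, ?_, ?_, ?_⟩⟩
  · intro l m ds es h h'
    obtain ⟨L, h1, rfl, rfl⟩ := homog_tag T.Tot h
    obtain ⟨K, h2, rfl, rfl⟩ := homog_tag T.Tot h'
    rw [word_eq, word_eq, hE' L K h1 h2, bdeg_map, bdeg_map]
    exact eA_mem T L K
  · refine tw_ext2 T.Tot.grading_internal (fun l m hl hm => ?_)
    have hl' : HomL (AG T.Tot) l := hl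
    have hm' : HomL (AG T.Tot) m := hm
    have hTh := Th_eA T hl' hm'
    rw [Th, sub_eq_zero] at hTh
    have h1 : E (BD.dBB (tw_ R (l.map Prod.snd) ⊗ₜ tw_ R (m.map Prod.snd))) =
        DD (AG T.Tot) (eA T) l m := by
      simp only [BarData.dBB, LinearMap.add_apply, TensorProduct.map_tmul, LinearMap.id_apply,
        map_add]
      rw [hdB l hl', hdB m hm', hsg l hl', DD]
      congr 1
      · have := D1_map (AG T.Tot) ((E ∘ₗ (TensorProduct.mk R T.Tot.Bar T.Tot.Bar).flip
          (tw_ R (m.map Prod.snd))).toAddMonoidHom) (fun x => tw_ R (x.map Prod.snd)) l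
        refine this.trans (D1_homcongr hl' (fun x hx => hE' x m hx hm'))
      · have := D1_map (AG T.Tot) ((E ∘ₗ (TensorProduct.mk R T.Tot.Bar T.Tot.Bar)
          (tw_ R (l.map Prod.snd))).toAddMonoidHom) (fun x => tw_ R (x.map Prod.snd)) m
        rw [zt_left, map_zsmul]
        congr 1
        refine this.trans (D1_homcongr hm' (fun x hx => hE' l x hl' hx))
    have h2 : (LinearMap.mul' R T.Tot.carrier ∘ₗ
      TensorProduct.map (E ∘ₗ TensorProduct.map BD.sgnB BD.sgnB) E ∘ₗ BD.ΔBB)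
        (tw_ R (l.map Prod.snd) ⊗ₜ tw_ R (m.map Prod.snd)) = cup1 (AG T.Tot) (eA T) (eA T) l m := by
      let G := (LinearMap.mul' R T.Tot.carrier ∘ₗ
        TensorProduct.map (E ∘ₗ TensorProduct.map BD.sgnB BD.sgnB) E ∘ₗ BD.midTw)
      show G (TensorProduct.map BD.Δ BD.Δ _) = _
      rw [TensorProduct.map_tmul, hΔ, hΔ]
      have s1 := S_map ((G ∘ₗ (TensorProduct.mk R (T.Tot.Bar ⊗[R] T.Tot.Bar)
        (T.Tot.Bar ⊗[R] T.Tot.Bar)).flip (S m (fun x y => tw_ R (x.map Prod.snd) ⊗ₜ[R]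
          tw_ R (y.map Prod.snd)))).toAddMonoidHom) l (fun x y => tw_ R (x.map Prod.snd) ⊗ₜ[R]
          tw_ R (y.map Prod.snd))
      refine s1.trans (S_congr (fun l1 l2 hll => ?_))
      have s2 := S_map ((G ∘ₗ (TensorProduct.mk R (T.Tot.Bar ⊗[R] T.Tot.Bar)
        (T.Tot.Bar ⊗[R] T.Tot.Bar)) (tw_ R (l1.map Prod.snd) ⊗ₜ[R]
          tw_ R (l2.map Prod.snd))).toAddMonoidHom) m (fun x y => tw_ R (x.map Prod.snd) ⊗ₜ[R]
          tw_ R (y.map Prod.snd))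
      refine s2.trans (S_congr (fun m1 m2 hmm => ?_))
      subst hll hmm
      obtain ⟨a1, a2⟩ := (HomL_append _).1 hl'
      obtain ⟨b1, b2⟩ := (HomL_append _).1 hm'
      show LinearMap.mul' R T.Tot.carrier (TensorProduct.map (E ∘ₗ TensorProduct.map BD.sgnB BD.sgnB)
        E (BD.midTw _)) = _
      rw [TensorProduct.mk_apply, midTw_sgn BD _ _ _ _ _ (htw l2 m1 a2 b1)]
      simp only [map_smul, LinearMap.lTensor_tmul, LinearEquiv.coe_coe,
        TensorProduct.assoc_tmul, TensorProduct.assoc_symm_tmul, TensorProduct.map_tmul,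
        LinearMap.comp_apply, LinearMap.mul'_apply]
      rw [Int.cast_smul_eq_zsmul]
      rw [hsg l1 a1, hsg m1 b1, hE' l2 m2 a2 b2, zt_left, zt_right,
        map_zsmul, map_zsmul, hE' l1 m1 a1 b1, smul_mul_assoc, smul_mul_assoc, smul_smul, smul_smul,
        ← pm_add, ← pm_add]
      congr 2
      ring
    rw [h2, ← hTh]
    show T.Tot.d (E _) + E (BD.dBB _) = _
    rw [h1, hE' l m hl' hm']
    rfl
  · rw [ur]; exact BD.α_single 1
  · rw [ul]; exact BD.α_single 1
  · intro l m h hu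
    rw [word_eq, word_eq]
    refine tw_van2 T.Tot.grading_internal T.Tot.one_mem E l m (fun l' m' hl hm e1 e2 u1 u2 => ?_)
    rw [hE' l' m' hl hm]
    exact eA_van T hl hm (by omega) (hu.imp u1 u2)
  · intro l m h
    rw [word_eq, word_eq]
    refine tw_van2 T.Tot.grading_internal T.Tot.one_mem (T.Tot.aug.toLinearMap ∘ₗ E) l m
      (fun l' m' hl hm e1 e2 u1 u2 => ?_)
    show T.Tot.aug (E _) = 0
    rw [hE' l' m' hl hm]
    exact eA_aug T hl hm (by omega)

end fin
end MVH

end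

/-- **Example 5.3, Mayer–Vietoris.**  Let `X` be a simplicial set with
an ordered cover `U = (U_i)_{i∈I}`, and let
`C^{pq}(U) = ∏_{i₀<⋯<i_q} C^p(U_{i₀} ∩ ⋯ ∩ U_{i_q}; R)` be the Mayer–Vietoris double
complex.  Then the total complex `Tot C^{**}(U)` — an augmented dg algebra whose
degree-`n` part is `∏_{p+q=n} C^{pq}(U)`, with the simplicial-plus-Čech differential
and the standard product — carries the structure of a Hirsch algebra which extends
this familiar dg algebra structure: there is a normalized twisting cochain on its bar
construction. -/
theorem mayerVietoris_hirsch {R : Type} [CommRing R] (X : SSet.{0})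
    (I : Type) [LinearOrder I] (U : I → SubSSet X)
    (hcover : ∀ (n : SimplexCategoryᵒᵖ) (x : X.obj n), ∃ i : I, x ∈ (U i).carrier n)
    (MVT : MVTotStr R X U) :
    ∃ BD : BarData MVT.Tot, ∃ E : MVT.Tot.Bar ⊗[R] MVT.Tot.Bar →ₗ[R] MVT.Tot.carrier,
      IsTwistingCochain BD E ∧ IsNormalized E := by
  exact MVH.main MVT
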